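/- arXiv:math/0702119 — 3 statements merged into one kernel-verified Lean document; each statement's English description precedes it below -/
import Mathlib

section
/- Let $K$ be a field and $A$ a finitely generated $K$-algebra that is a domain with GK dimension strictly less than $3$. Suppose $K = D_0 \subseteq D_1 \subseteq \cdots \subseteq D_m \subseteq Q(A)$ is a chain of division subalgebras such that each $D_i$ ($i \ge 1$) is finitely generated as a division algebra and is infinite-dimensional as a left $D_{i-1}$-vector space. Then $m \le 2$. -/
open Filter

/-- The GK growth exponent `limsup_n log(dim V^n)/log n` (in `EReal`) of a
finite-dimensional subspace `V` of a `K`-algebra. -/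
noncomputable def gkWrt (K : Type*) {Q : Type*} [Field K] [Ring Q] [Algebra K Q]
    (V : Submodule K Q) : EReal :=
  Filter.limsup
    (fun n : ℕ => ((Real.log (Module.finrank K ↥(V ^ n)) / Real.log n : ℝ) : EReal)) atTop

/-- `E` is a division subring of `Q` containing (the image of) `K`. -/
def IsDivSub {K Q : Type*} [Field K] [DivisionRing Q] [Algebra K Q] (E : Subring Q) : Prop :=
  (∀ c : K, algebraMap K Q c ∈ E) ∧ (∀ x ∈ E, x⁻¹ ∈ E)

/-- `E` is generated, as a division algebra over `K`, by the finite set `S`: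
it is the smallest division subring containing `K` and `S`. -/
def IsDivGenBy {K Q : Type*} [Field K] [DivisionRing Q] [Algebra K Q]
    (E : Subring Q) (S : Finset Q) : Prop :=
  IsDivSub (K := K) E ∧ (S : Set Q) ⊆ E ∧
    ∀ E' : Subring Q, IsDivSub (K := K) E' → (S : Set Q) ⊆ E' → E ≤ E'

section PartOne
variable {K Q : Type*} [Field K] [DivisionRing Q] [Algebra K Q]

/-- view a left `E`-submodule as a `K`-submodule -/
def toK (E : Subfield Q) (hK : ∀ c : K, algebraMap K Q c ∈ E) (H : Submodule E Q) :
    Submodule K Q where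
  carrier := H
  add_mem' := fun ha hb => H.add_mem ha hb
  zero_mem' := H.zero_mem
  smul_mem' := fun c x hx => by
    rw [Algebra.smul_def]
    exact H.smul_mem ⟨algebraMap K Q c, hK c⟩ hx

/-- view a subfield as a `K`-submodule -/
def subK (E : Subfield Q) (hK : ∀ c : K, algebraMap K Q c ∈ E) : Submodule K Q where
  carrier := E
  add_mem' := fun ha hb => E.add_mem ha hb
  zero_mem' := E.zero_mem
  smul_mem' := fun c x hx => by
    rw [Algebra.smul_def]
    exact E.mul_mem (hK c) hx

theorem mem_toK {E : Subfield Q} {hK : ∀ c : K, algebraMap K Q c ∈ E} {H : Submodule E Q}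
    {x : Q} : x ∈ toK E hK H ↔ x ∈ H := Iff.rfl

theorem mem_subK {E : Subfield Q} {hK : ∀ c : K, algebraMap K Q c ∈ E}
    {x : Q} : x ∈ subK E hK ↔ x ∈ E := Iff.rfl

theorem finrank_inf_add_map (W H : Submodule K Q) [FiniteDimensional K W] :
    Module.finrank K ↥(W ⊓ H) + Module.finrank K ↥(W.map H.mkQ) = Module.finrank K W := by
  have h := LinearMap.finrank_range_add_finrank_ker (H.mkQ.domRestrict W)
  have h1 : LinearMap.range (H.mkQ.domRestrict W) = W.map H.mkQ := by
    rw [LinearMap.domRestrict, LinearMap.range_comp, Submodule.range_subtype]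
  have h2 : Module.finrank K ↥(LinearMap.ker (H.mkQ.domRestrict W)) =
      Module.finrank K ↥(W ⊓ H) := by
    have : (LinearMap.ker (H.mkQ.domRestrict W)).map W.subtype = W ⊓ H := by
      ext x
      simp [LinearMap.mem_ker]
      tauto
    rw [← this]
    exact (LinearEquiv.finrank_eq (Submodule.equivMapOfInjective W.subtype W.injective_subtype _))
  rw [h1, h2] at h
  omega

theorem lemLA (E : Subfield Q) (hK : ∀ c : K, algebraMap K Q c ∈ E)
    (hinf : ¬ FiniteDimensional K (subK E hK))
    (V1 : Submodule K Q) [FiniteDimensional K V1] (h1 : (1 : Q) ∈ V1) (hV1 : ∀ v ∈ V1, v ∈ E)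
    (hgen : ∀ T : Subfield Q, (∀ c : K, algebraMap K Q c ∈ T) → (∀ v ∈ V1, v ∈ T) → E ≤ T)
    (H : Submodule K Q) (hH : ∀ e ∈ E, ∀ h ∈ H, e * h ∈ H)
    (W : Submodule K Q) [FiniteDimensional K W] (w : Q) (hw : w ∈ W) (hwH : w ∉ H) :
    Module.finrank K (W.map H.mkQ) + 1 ≤ Module.finrank K ((V1 * W).map H.mkQ) := by
  by_contra hcon
  have hfVW : FiniteDimensional K ↥(V1 * W) := by
    have : (V1 * W).FG := Submodule.FG.mul (Module.Finite.iff_fg.1 ‹_›) (Module.Finite.iff_fg.1 ‹_›)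
    exact Module.Finite.iff_fg.2 this
  have hle : W ≤ V1 * W := by
    intro x hx
    have := Submodule.mul_mem_mul h1 hx
    rwa [one_mul] at this
  have heq : W.map H.mkQ = (V1 * W).map H.mkQ := by
    apply Submodule.eq_of_le_of_finrank_le (Submodule.map_mono hle)
    omega
  have hU : ∀ x, x ∈ W ⊔ H ↔ H.mkQ x ∈ W.map H.mkQ := by
    intro x
    rw [← Submodule.mem_comap, Submodule.comap_map_mkQ, sup_comm]
  have hV1U : ∀ v ∈ V1, ∀ u ∈ W ⊔ H, v * u ∈ W ⊔ H := by
    intro v hv u hu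
    obtain ⟨a, ha, b, hb, rfl⟩ := Submodule.mem_sup.1 hu
    rw [mul_add]
    refine Submodule.add_mem _ ?_ (Submodule.mem_sup_right (hH v (hV1 v hv) b hb))
    rw [hU, heq]
    exact Submodule.mem_map_of_mem (Submodule.mul_mem_mul hv ha)
  let T : Subfield Q :=
    { carrier := {q | q ∈ E ∧ ∀ u ∈ W ⊔ H, q * u ∈ W ⊔ H}
      mul_mem' := fun {a b} ha hb => ⟨E.mul_mem ha.1 hb.1, fun u hu => by
        rw [mul_assoc]; exact ha.2 _ (hb.2 u hu)⟩
      one_mem' := ⟨E.one_mem, fun u hu => by rwa [one_mul]⟩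
      add_mem' := fun {a b} ha hb => ⟨E.add_mem ha.1 hb.1, fun u hu => by
        rw [add_mul]; exact Submodule.add_mem _ (ha.2 _ hu) (hb.2 u hu)⟩
      zero_mem' := ⟨E.zero_mem, fun u hu => by rw [zero_mul]; exact Submodule.zero_mem _⟩
      neg_mem' := fun {a} ha => ⟨E.neg_mem ha.1, fun u hu => by
        rw [neg_mul]; exact Submodule.neg_mem _ (ha.2 _ hu)⟩
      inv_mem' := fun q hq => by
        refine ⟨E.inv_mem hq.1, fun u hu => ?_⟩
        by_cases hq0 : q = 0
        · simp [hq0]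
        have hqH : H ≤ H.comap (LinearMap.mulLeft K q) := fun h hh => hH q hq.1 h hh
        let L := Submodule.mapQ H H (LinearMap.mulLeft K q) hqH
        have hLinj : Function.Injective L := by
          rw [← LinearMap.ker_eq_bot, LinearMap.ker_eq_bot']
          intro y
          obtain ⟨y, rfl⟩ := H.mkQ_surjective y
          intro hy
          have : H.mkQ (q * y) = 0 := hy
          rw [Submodule.mkQ_apply, Submodule.Quotient.mk_eq_zero] at this ⊢
          have := hH q⁻¹ (E.inv_mem hq.1) _ this
          rwa [inv_mul_cancel_left₀ hq0] at this
        have hLle : (W.map H.mkQ).map L ≤ W.map H.mkQ := by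
          rintro _ ⟨_, ⟨y, hy, rfl⟩, rfl⟩
          have := hq.2 y (Submodule.mem_sup_left hy)
          rw [hU] at this
          exact this
        have hLeq : (W.map H.mkQ).map L = W.map H.mkQ := by
          apply Submodule.eq_of_le_of_finrank_le hLle
          rw [← LinearEquiv.finrank_eq (Submodule.equivMapOfInjective L hLinj (W.map H.mkQ))]
        have h2 := (hU u).1 hu
        rw [← hLeq] at h2
        obtain ⟨_, ⟨y, hy, rfl⟩, h3⟩ := h2
        have h4 : H.mkQ (q * y) = H.mkQ u := h3
        rw [Submodule.mkQ_apply, Submodule.mkQ_apply, Submodule.Quotient.eq] at h4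
        have h5 := hH q⁻¹ (E.inv_mem hq.1) _ h4
        rw [mul_sub, inv_mul_cancel_left₀ hq0] at h5
        have : q⁻¹ * u = y - (y - q⁻¹ * u) := by abel
        rw [this]
        exact Submodule.sub_mem _ (Submodule.mem_sup_left hy) (Submodule.mem_sup_right h5) }
  have hET : E ≤ T := by
    apply hgen
    · intro c
      refine ⟨hK c, fun u hu => ?_⟩
      rw [← Algebra.smul_def]
      exact Submodule.smul_mem _ _ hu
    · intro v hv
      exact ⟨hV1 v hv, hV1U v hv⟩
  apply hinf
  let φ : subK E hK →ₗ[K] (W.map H.mkQ) :=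
    LinearMap.codRestrict _ ((H.mkQ ∘ₗ LinearMap.mulRight K w).domRestrict (subK E hK)) (by
      rintro ⟨e, he⟩
      have := (hET he).2 w (Submodule.mem_sup_left hw)
      rw [hU] at this
      exact this)
  have hφ : Function.Injective φ := by
    rw [← LinearMap.ker_eq_bot, LinearMap.ker_eq_bot']
    rintro ⟨e, he⟩ h0
    have h6 : H.mkQ (e * w) = 0 := congrArg Subtype.val h0
    rw [Submodule.mkQ_apply, Submodule.Quotient.mk_eq_zero] at h6
    by_contra hne
    have he0 : e ≠ 0 := fun h => hne (Subtype.ext h)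
    have := hH e⁻¹ (E.inv_mem he) _ h6
    rw [inv_mul_cancel_left₀ he0] at this
    exact hwH this
  exact Module.Finite.of_injective φ hφ

theorem fd_mul (A B : Submodule K Q) [FiniteDimensional K A] [FiniteDimensional K B] :
    FiniteDimensional K ↥(A * B) :=
  Module.Finite.iff_fg.2 (Submodule.FG.mul (Module.Finite.iff_fg.1 ‹_›) (Module.Finite.iff_fg.1 ‹_›))

theorem fd_pow (A : Submodule K Q) [FiniteDimensional K A] (n : ℕ) :
    FiniteDimensional K ↥(A ^ n) :=
  Module.Finite.iff_fg.2 (Submodule.FG.pow (Module.Finite.iff_fg.1 ‹_›) n)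

theorem lemL1 (E : Subfield Q) (hK : ∀ c : K, algebraMap K Q c ∈ E)
    (hinf : ¬ FiniteDimensional K (subK E hK))
    (V1 : Submodule K Q) [FiniteDimensional K V1] (h1 : (1 : Q) ∈ V1) (hV1 : ∀ v ∈ V1, v ∈ E)
    (hgen : ∀ T : Subfield Q, (∀ c : K, algebraMap K Q c ∈ T) → (∀ v ∈ V1, v ∈ T) → E ≤ T)
    (s : ℕ) : ∀ (W : Submodule K Q) [FiniteDimensional K W] (f : Fin s → Q),
    LinearIndependent E f → (∀ i, f i ∈ W) →
    Module.finrank K W + s ≤ Module.finrank K ↥(V1 * W) := by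
  induction s with
  | zero =>
    intro W _ f _ _
    have := fd_mul V1 W
    apply Submodule.finrank_mono
    intro x hx
    have := Submodule.mul_mem_mul h1 hx
    rwa [one_mul] at this
  | succ s ih =>
    intro W _ f hf hfW
    have hfVW := fd_mul V1 W
    let H0 : Submodule E Q := Submodule.span E (Set.range (fun i : Fin s => f i.castSucc))
    let H := toK E hK H0
    have hH : ∀ e ∈ E, ∀ h ∈ H, e * h ∈ H := fun e he h hh =>
      H0.smul_mem (⟨e, he⟩ : E) hh
    have hf' := linearIndependent_finSucc'.1 hf
    have hA := lemLA E hK hinf V1 h1 hV1 hgen H hH W (f (Fin.last s)) (hfW _) (by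
      intro h
      exact hf'.2 h)
    have hWH : FiniteDimensional K ↥(W ⊓ H) := Submodule.finiteDimensional_inf_left _ _
    have hI := ih (W ⊓ H) (fun i => f i.castSucc) hf'.1 (fun i =>
      ⟨hfW _, Submodule.subset_span ⟨i, rfl⟩⟩)
    have hVWH : V1 * (W ⊓ H) ≤ (V1 * W) ⊓ H := by
      refine le_inf (mul_le_mul' le_rfl inf_le_left) ?_
      rw [Submodule.mul_le]
      intro v hv h hh
      exact hH v (hV1 v hv) h hh.2
    have : FiniteDimensional K ↥((V1 * W) ⊓ H) := Submodule.finiteDimensional_inf_left _ _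
    have h3 := Submodule.finrank_mono hVWH
    have h4 := finrank_inf_add_map W H
    have h5 := finrank_inf_add_map (V1 * W) H
    omega

end PartOne

section PartTwo
variable {K Q : Type*} [Field K] [DivisionRing Q] [Algebra K Q]

theorem lemLB (E : Subfield Q) (Y : Submodule E Q) (hY : Y.FG) :
    ∃ S : Subfield Q, ∀ q, q ∈ S ↔ ∀ y ∈ Y, y * q ∈ Y := by
  have hfd : FiniteDimensional E Y := Module.Finite.iff_fg.2 hY
  refine ⟨
    { carrier := {q | ∀ y ∈ Y, y * q ∈ Y}
      mul_mem' := fun {a b} ha hb y hy => by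
        rw [← mul_assoc]; exact hb _ (ha _ hy)
      one_mem' := fun y hy => by rwa [mul_one]
      add_mem' := fun {a b} ha hb y hy => by
        rw [mul_add]; exact Y.add_mem (ha _ hy) (hb _ hy)
      zero_mem' := fun y hy => by rw [mul_zero]; exact Y.zero_mem
      neg_mem' := fun {a} ha y hy => by
        rw [mul_neg]; exact Y.neg_mem (ha _ hy)
      inv_mem' := fun q hq y hy => by
        by_cases hq0 : q = 0
        · simp [hq0]
        let R : Y →ₗ[E] Y :=
          { toFun := fun y => ⟨y.1 * q, hq y.1 y.2⟩
            map_add' := fun a b => Subtype.ext (by simp [add_mul])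
            map_smul' := fun e a => Subtype.ext (by simp [Subfield.smul_def, mul_assoc]) }
        have hR : Function.Injective R := by
          intro a b hab
          have : a.1 * q = b.1 * q := congrArg Subtype.val hab
          exact Subtype.ext (mul_right_cancel₀ hq0 this)
        obtain ⟨z, hz⟩ := LinearMap.injective_iff_surjective.1 hR ⟨y, hy⟩
        have : z.1 * q = y := congrArg Subtype.val hz
        rw [← this, mul_inv_cancel_right₀ hq0]
        exact z.2 }, fun q => Iff.rfl⟩

theorem stab_K {E : Subfield Q} (hK : ∀ c : K, algebraMap K Q c ∈ E) (Y : Submodule E Q)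
    (c : K) (y : Q) (hy : y ∈ Y) : y * algebraMap K Q c ∈ Y := by
  rw [← Algebra.commutes]
  exact Y.smul_mem (⟨_, hK c⟩ : E) hy

theorem fg_spanE (E : Subfield Q) (hK : ∀ c : K, algebraMap K Q c ∈ E) (F : Submodule K Q)
    [hF : FiniteDimensional K F] : (Submodule.span E (F : Set Q)).FG := by
  obtain ⟨S, hS⟩ := Module.Finite.iff_fg.1 hF
  refine ⟨S, le_antisymm (Submodule.span_mono ?_) (Submodule.span_le.2 ?_)⟩
  · rw [← hS]; exact Submodule.subset_span
  · have : F ≤ toK E hK (Submodule.span E (S : Set Q)) := by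
      rw [← hS, Submodule.span_le]
      exact fun x hx => Submodule.subset_span hx
    exact this

theorem pow_mono_V {V : Submodule K Q} (h1 : (1 : Q) ∈ V) {a b : ℕ} (h : a ≤ b) :
    V ^ a ≤ V ^ b := pow_le_pow_right' (Submodule.one_le.2 h1) h

theorem lemL2 (E : Subfield Q) (hK : ∀ c : K, algebraMap K Q c ∈ E)
    (V : Submodule K Q) [FiniteDimensional K V] (h1 : (1 : Q) ∈ V) (c : Q) (hc : c ≠ 0)
    (hno : ∀ Y : Submodule E Q, Y.FG → c ∈ Y → (∀ v ∈ V, ∀ y ∈ Y, y * v ∈ Y) → False)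
    (n : ℕ) : ∃ a : Fin (n + 1) → Q, (∀ i, a i ∈ V ^ n) ∧
      LinearIndependent E (fun i => c * a i) := by
  induction n with
  | zero =>
    refine ⟨fun _ => 1, fun i => by simp, ?_⟩
    simpa using hc
  | succ n ih =>
    obtain ⟨a, ha, hli⟩ := ih
    let F := (V ^ n).map (LinearMap.mulLeft K c)
    have hfd := fd_pow V n
    have hFG := fg_spanE E hK F
    have hex : ∃ x ∈ V ^ (n + 1), c * x ∉ Submodule.span E (F : Set Q) := by
      by_contra hcon
      push Not at hcon
      refine hno _ hFG (Submodule.subset_span ⟨1, ?_, by simp⟩) ?_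
      · have := pow_mono_V h1 (Nat.zero_le n)
        apply this
        simp
      · intro v hv y hy
        induction hy using Submodule.span_induction with
        | mem x hx =>
          obtain ⟨z, hz, rfl⟩ := hx
          have := hcon (z * v) (by rw [pow_succ]; exact Submodule.mul_mem_mul hz hv)
          simpa [mul_assoc] using this
        | zero => simp
        | add x y _ _ hx hy => rw [add_mul]; exact Submodule.add_mem _ hx hy
        | smul e x _ hx =>
          have := Submodule.smul_mem _ e hx
          simpa [Subfield.smul_def, mul_assoc] using this
    obtain ⟨x, hx, hxn⟩ := hex
    refine ⟨Fin.snoc a x, ?_, ?_⟩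
    · intro i
      refine Fin.lastCases ?_ (fun j => ?_) i
      · simpa using hx
      · simpa using pow_mono_V h1 (Nat.le_succ n) (ha j)
    · have : (fun i => c * (Fin.snoc a x : Fin (n + 1 + 1) → Q) i) =
          Fin.snoc (fun i => c * a i) (c * x) := by
        funext i
        refine Fin.lastCases ?_ (fun j => ?_) i <;> simp
      rw [this, linearIndependent_finSnoc]
      refine ⟨hli, fun h => hxn (Submodule.span_le.2 ?_ h)⟩
      rintro _ ⟨i, rfl⟩
      exact Submodule.subset_span ⟨a i, ha i, rfl⟩

theorem mem_adjoin_pow {V : Submodule K Q} (h1 : (1 : Q) ∈ V) {x : Q}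
    (hx : x ∈ Algebra.adjoin K (V : Set Q)) : ∃ n, x ∈ V ^ n := by
  induction hx using Algebra.adjoin_induction with
  | mem x hx => exact ⟨1, by simpa using hx⟩
  | algebraMap r => 
    refine ⟨0, ?_⟩
    rw [pow_zero]
    exact Submodule.algebraMap_mem r
  | add x y _ _ hx hy =>
    obtain ⟨a, ha⟩ := hx
    obtain ⟨b, hb⟩ := hy
    exact ⟨max a b, Submodule.add_mem _ (pow_mono_V h1 (le_max_left _ _) ha)
      (pow_mono_V h1 (le_max_right _ _) hb)⟩
  | mul x y _ _ hx hy =>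
    obtain ⟨a, ha⟩ := hx
    obtain ⟨b, hb⟩ := hy
    exact ⟨a + b, by rw [pow_add]; exact Submodule.mul_mem_mul ha hb⟩

theorem lemL3a (A : Subalgebra K Q)
    (hQuot : ∀ q : Q, ∃ a ∈ A, ∃ b ∈ A, b ≠ 0 ∧ q = b⁻¹ * a) (S : Finset Q) :
    ∃ b ≠ 0, ∀ s ∈ S, b * s ∈ A := by
  classical
  suffices h : ∃ b ∈ A, b ≠ 0 ∧ ∀ s ∈ S, b * s ∈ A by
    obtain ⟨b, -, h⟩ := h
    exact ⟨b, h⟩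
  induction S using Finset.induction_on with
  | empty => exact ⟨1, A.one_mem, one_ne_zero, by simp⟩
  | insert s S _ ih =>
    obtain ⟨b, hbA, hb0, hb⟩ := ih
    obtain ⟨a, ha, d, hd, hd0, rfl⟩ := hQuot s
    obtain ⟨c', hc', c, hc, hc0, h⟩ := hQuot (b * d⁻¹)
    have h2 : c * b * d⁻¹ = c' := by
      rw [mul_assoc, h, mul_inv_cancel_left₀ hc0]
    refine ⟨c * b, A.mul_mem hc hbA, mul_ne_zero hc0 hb0, ?_⟩
    intro s hs
    rcases Finset.mem_insert.1 hs with rfl | hs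
    · rw [← mul_assoc, h2]
      exact A.mul_mem hc' ha
    · rw [mul_assoc]
      exact A.mul_mem hc (hb s hs)

theorem lemL3 (A : Subalgebra K Q)
    (hQuot : ∀ q : Q, ∃ a ∈ A, ∃ b ∈ A, b ≠ 0 ∧ q = b⁻¹ * a)
    (V : Submodule K Q) [FiniteDimensional K V] (h1 : (1 : Q) ∈ V)
    (hVA : Algebra.adjoin K (V : Set Q) = A)
    (T : Submodule K Q) [hT : FiniteDimensional K T] :
    ∃ k, ∀ n, Module.finrank K ↥(T * V ^ n) ≤ Module.finrank K ↥(V ^ (n + k)) := by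
  obtain ⟨S, hS⟩ := Module.Finite.iff_fg.1 hT
  obtain ⟨b, hb0, hb⟩ := lemL3a A hQuot S
  have h2 : ∀ s : Q, ∃ n, s ∈ S → b * s ∈ V ^ n := by
    intro s
    by_cases hs : s ∈ S
    · have := hb s hs
      rw [← hVA] at this
      obtain ⟨n, hn⟩ := mem_adjoin_pow h1 this
      exact ⟨n, fun _ => hn⟩
    · exact ⟨0, fun h => absurd h hs⟩
  choose f hf using h2
  let k := S.sup f
  have h3 : T.map (LinearMap.mulLeft K b) ≤ V ^ k := by
    rw [← hS, Submodule.map_span, Submodule.span_le]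
    rintro _ ⟨s, hs, rfl⟩
    exact pow_mono_V h1 (Finset.le_sup (f := f) hs) (hf s hs)
  refine ⟨k, fun n => ?_⟩
  have hinj : Function.Injective (LinearMap.mulLeft K b) := fun x y h => mul_left_cancel₀ hb0 h
  have hfd := fd_pow V (n + k)
  rw [LinearEquiv.finrank_eq (Submodule.equivMapOfInjective _ hinj (T * V ^ n))]
  apply Submodule.finrank_mono
  rw [Submodule.map_le_iff_le_comap, Submodule.mul_le]
  intro t ht v hv
  have := Submodule.mul_mem_mul (h3 ⟨t, ht, rfl⟩) hv
  rw [← pow_add, add_comm] at this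
  simpa [mul_assoc] using this

theorem lemL4 (Z W : Submodule K Q) [FiniteDimensional K Z] [FiniteDimensional K W]
    (h1 : (1 : Q) ∈ Z) (Δ : ℕ)
    (hΔ : Module.finrank K ↥(Z * W) ≤ Module.finrank K W + Δ) (x : ℕ → Q) (L : ℕ)
    (hx0 : x 0 = 1) (hx : ∀ i < L, ∃ j ≤ i, ∃ z ∈ Z, x (i + 1) = z * x j)
    (hL : L * Δ < Module.finrank K W) :
    ∃ c ≠ 0, ∀ i ≤ L, x i * c ∈ W := by
  have key : ∀ i ≤ L, ∃ C : Submodule K Q, C ≤ W ∧ (∀ j ≤ i, ∀ c ∈ C, x j * c ∈ W) ∧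
      Module.finrank K W ≤ Module.finrank K C + i * Δ := by
    intro i
    induction i with
    | zero =>
      intro _
      refine ⟨W, le_rfl, ?_, by simp⟩
      intro j hj c hc
      obtain rfl : j = 0 := by omega
      rwa [hx0, one_mul]
    | succ i ih =>
      intro hi
      obtain ⟨C, hCW, hC, hr⟩ := ih (by omega)
      obtain ⟨j, hj, z, hz, hxz⟩ := hx i (by omega)
      let H := W.comap (LinearMap.mulLeft K (x (i + 1)))
      refine ⟨C ⊓ H, inf_le_left.trans hCW, ?_, ?_⟩
      · intro l hl c hc
        rcases Nat.lt_or_ge l (i + 1) with h | h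
        · exact hC l (by omega) c hc.1
        · obtain rfl : l = i + 1 := by omega
          exact hc.2
      · have hfC : FiniteDimensional K C := Submodule.finiteDimensional_of_le hCW
        have hfZW := fd_mul Z W
        have e1 := finrank_inf_add_map C H
        have e2 := finrank_inf_add_map (Z * W) W
        have hWZ : W ≤ Z * W := by
          intro x hx
          have := Submodule.mul_mem_mul h1 hx
          rwa [one_mul] at this
        rw [inf_eq_right.2 hWZ] at e2
        let L := Submodule.mapQ H W (LinearMap.mulLeft K (x (i + 1))) le_rfl
        have hLinj : Function.Injective L := by
          rw [← LinearMap.ker_eq_bot, LinearMap.ker_eq_bot']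
          intro y
          obtain ⟨y, rfl⟩ := H.mkQ_surjective y
          intro hy
          have : W.mkQ (x (i + 1) * y) = 0 := hy
          rw [Submodule.mkQ_apply, Submodule.Quotient.mk_eq_zero] at this ⊢
          exact this
        have e3 : Module.finrank K (C.map H.mkQ) ≤ Module.finrank K ((Z * W).map W.mkQ) := by
          rw [LinearEquiv.finrank_eq (Submodule.equivMapOfInjective L hLinj (C.map H.mkQ))]
          apply Submodule.finrank_mono
          rintro _ ⟨_, ⟨y, hy, rfl⟩, rfl⟩
          refine ⟨x (i + 1) * y, ?_, rfl⟩
          rw [hxz, mul_assoc]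
          exact Submodule.mul_mem_mul hz (hC j hj y hy)
        have : (i + 1) * Δ = i * Δ + Δ := by ring
        omega
  obtain ⟨C, hCW, hC, hr⟩ := key L le_rfl
  have hpos : 0 < Module.finrank K C := by omega
  have hne : C ≠ ⊥ := by
    rintro rfl
    simp at hpos
  obtain ⟨c, hc, hc0⟩ := Submodule.exists_mem_ne_zero_of_ne_bot hne
  exact ⟨c, hc0, fun i hi => hC i hi c hc⟩

theorem lemL5 (D1 D2 : Subfield Q) (h12 : D1 ≤ D2) {M n : ℕ} (f : Fin M → Q) (g : Fin n → Q)
    (hfD : ∀ i, f i ∈ D2) (hf : LinearIndependent D1 f) (hg : LinearIndependent D2 g) :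
    LinearIndependent D1 (fun p : Fin M × Fin n => f p.1 * g p.2) := by
  rw [Fintype.linearIndependent_iff] at *
  intro e he
  rw [Fintype.sum_prod_type_right] at he
  have h1 : ∀ l : Fin n, ∑ i, (e (i, l) : Q) * f i = 0 := by
    intro l
    have := hg (fun l => ⟨∑ i, (e (i, l) : Q) * f i,
      D2.sum_mem fun i _ => D2.mul_mem (h12 (e (i, l)).2) (hfD i)⟩) (by
        rw [← he]
        refine Finset.sum_congr rfl fun l _ => ?_
        simp [Subfield.smul_def, Finset.sum_mul, mul_assoc]) l
    exact congrArg Subtype.val this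
  rintro ⟨i, l⟩
  exact hf (fun i => e (i, l)) (h1 l) i

end PartTwo

section PartThree

theorem growth_small (w : ℕ → ℕ) (hpos : ∀ n, 1 ≤ w n)
    (hlim : Filter.limsup
      (fun n : ℕ => ((Real.log (w n) / Real.log n : ℝ) : EReal)) atTop < 3) :
    Tendsto (fun n : ℕ => (w n : ℝ) / (n : ℝ) ^ 3) atTop (nhds 0) := by
  obtain ⟨α, hα1, hα2⟩ := EReal.lt_iff_exists_real_btwn.1 hlim
  have hα : α < 3 := by
    have h3 : ((3 : ℝ) : EReal) = 3 := rfl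
    rw [← h3] at hα2
    exact EReal.coe_lt_coe_iff.1 hα2
  have hev := Filter.eventually_lt_of_limsup_lt hα1
  have h0 : Tendsto (fun n : ℕ => ((n : ℝ) ^ (-(3 - α)))) atTop (nhds 0) :=
    (tendsto_rpow_neg_atTop (by linarith)).comp tendsto_natCast_atTop_atTop
  refine squeeze_zero' (Eventually.of_forall fun n => by positivity) ?_ h0
  filter_upwards [hev, eventually_ge_atTop 2] with n hn hn2
  have hn' : Real.log (w n) / Real.log n < α := by exact_mod_cast hn
  have hn2' : (2 : ℝ) ≤ n := by exact_mod_cast hn2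
  have hlog : 0 < Real.log n := Real.log_pos (by linarith)
  rw [div_lt_iff₀ hlog] at hn'
  have hw : (0 : ℝ) < w n := by exact_mod_cast hpos n
  have hn0 : (0 : ℝ) < n := by linarith
  have h1 : (w n : ℝ) < (n : ℝ) ^ α := by
    rw [← Real.log_lt_log_iff hw (Real.rpow_pos_of_pos hn0 _), Real.log_rpow hn0]
    exact hn'
  rw [div_le_iff₀ (by positivity)]
  refine h1.le.trans (le_of_eq ?_)
  rw [← Real.rpow_natCast (n : ℝ) 3, ← Real.rpow_add hn0]
  congr 1
  push_cast
  ring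

theorem tele_bound (w : ℕ → ℕ) (hm : Monotone w) (k A B : ℕ) (hAB : A ≤ B) :
    ∑ n ∈ Finset.Ico A B, ((w (n + k) : ℝ) - w n) ≤ k * w (B + k) := by
  induction k with
  | zero => simp
  | succ k ih =>
    have h1 : ∑ n ∈ Finset.Ico A B, ((w (n + (k + 1)) : ℝ) - w n) =
        ∑ n ∈ Finset.Ico A B, ((w (n + k) : ℝ) - w n) +
        ∑ n ∈ Finset.Ico A B, ((w (n + 1 + k) : ℝ) - w (n + k)) := by
      rw [← Finset.sum_add_distrib]
      refine Finset.sum_congr rfl fun n _ => ?_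
      rw [show n + (k + 1) = n + 1 + k by ring]
      ring
    have h2 : ∑ n ∈ Finset.Ico A B, ((w (n + 1 + k) : ℝ) - w (n + k)) = w (B + k) - w (A + k) :=
      Finset.sum_Ico_sub (f := fun n => (w (n + k) : ℝ)) hAB
    have h3 : (w (B + k) : ℝ) ≤ w (B + (k + 1)) := by exact_mod_cast hm (by omega)
    have h4 : (0 : ℝ) ≤ w (A + k) := by positivity
    have h5 : (k : ℝ) * w (B + k) ≤ k * w (B + (k + 1)) := by gcongr
    rw [h1, h2]
    push_cast
    linarith

theorem arith_contra (w : ℕ → ℕ) (hm : Monotone w) (hpos : ∀ n, 1 ≤ w n) (k : ℕ)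
    (hw : ∀ n, (n + 1) * w n ≤ 4 * ((w (n + k) - w n) * (w (2 * n + k) - w (2 * n))))
    (hlim : Tendsto (fun n : ℕ => (w n : ℝ) / (n : ℝ) ^ 3) atTop (nhds 0)) : False := by
  have hd : ∀ n j, ((w (n + j) - w n : ℕ) : ℝ) = (w (n + j) : ℝ) - w n := fun n j => by
    rw [Nat.cast_sub (hm (by omega))]
  have key : ∀ N : ℕ, 1 ≤ N → k ≤ N →
      (N : ℝ) ^ 3 * w N ≤ 4 * k ^ 2 * (w (5 * N) : ℝ) ^ 2 := by
    intro N hN hkN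
    let f : ℕ → ℝ := fun n => (w (n + k) : ℝ) - w n
    have hf0 : ∀ n, 0 ≤ f n := fun n => sub_nonneg.2 (by exact_mod_cast hm (by omega))
    have hcs := Finset.sum_sq_le_sum_mul_sum_of_sq_le_mul (Finset.Ico N (2 * N))
      (r := fun n => Real.sqrt (f n * f (2 * n))) (f := f) (g := fun n => f (2 * n))
      (fun n _ => hf0 n) (fun n _ => hf0 _)
      (fun n _ => (Real.sq_sqrt (mul_nonneg (hf0 n) (hf0 _))).le)
    have hS1 : ∑ n ∈ Finset.Ico N (2 * N), f n ≤ k * w (5 * N) := by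
      refine (tele_bound w hm k N (2 * N) (by omega)).trans ?_
      have : (w (2 * N + k) : ℝ) ≤ w (5 * N) := by exact_mod_cast hm (by omega)
      gcongr
    have hS2 : ∑ n ∈ Finset.Ico N (2 * N), f (2 * n) ≤ k * w (5 * N) := by
      have h1 : ∑ n ∈ Finset.Ico N (2 * N), f (2 * n) ≤
          ∑ n ∈ Finset.Ico (2 * N) (4 * N), f n := by
        rw [← Finset.sum_image (f := f) (g := fun n => 2 * n) (s := Finset.Ico N (2 * N))
          (fun a _ b _ h => by simpa using h)]
        refine Finset.sum_le_sum_of_subset_of_nonneg ?_ (fun i _ _ => hf0 i)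
        intro x hx
        simp only [Finset.mem_image, Finset.mem_Ico] at hx ⊢
        omega
      refine h1.trans ((tele_bound w hm k (2 * N) (4 * N) (by omega)).trans ?_)
      have : (w (4 * N + k) : ℝ) ≤ w (5 * N) := by exact_mod_cast hm (by omega)
      gcongr
    have hlow : (N : ℝ) * Real.sqrt (N * w N / 4) ≤
        ∑ n ∈ Finset.Ico N (2 * N), Real.sqrt (f n * f (2 * n)) := by
      have : (N : ℝ) * Real.sqrt (N * w N / 4) =
          ∑ n ∈ Finset.Ico N (2 * N), Real.sqrt (N * w N / 4) := by
        rw [Finset.sum_const, Nat.card_Ico, nsmul_eq_mul]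
        congr 2
        omega
      rw [this]
      refine Finset.sum_le_sum fun n hn => Real.sqrt_le_sqrt ?_
      rw [Finset.mem_Ico] at hn
      have h2 : (((n + 1) * w n : ℕ) : ℝ) ≤
          ((4 * ((w (n + k) - w n) * (w (2 * n + k) - w (2 * n))) : ℕ) : ℝ) := by
        exact_mod_cast hw n
      rw [Nat.cast_mul, Nat.cast_mul, Nat.cast_mul, hd, hd] at h2
      have h3 : (N : ℝ) * w N ≤ ((n + 1 : ℕ) : ℝ) * w n := by
        have : (w N : ℝ) ≤ w n := by exact_mod_cast hm hn.1
        have : (N : ℝ) ≤ ((n + 1 : ℕ) : ℝ) := by exact_mod_cast (by omega)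
        gcongr
      simp only [f]
      push_cast at h2 h3
      linarith
    have hS1' : 0 ≤ ∑ n ∈ Finset.Ico N (2 * N), f n := Finset.sum_nonneg fun n _ => hf0 n
    have hS2' : 0 ≤ ∑ n ∈ Finset.Ico N (2 * N), f (2 * n) := Finset.sum_nonneg fun n _ => hf0 _
    have h4 : ((N : ℝ) * Real.sqrt (N * w N / 4)) ^ 2 ≤ (k * w (5 * N)) * (k * w (5 * N)) := by
      refine (pow_le_pow_left₀ (by positivity) hlow 2).trans (hcs.trans ?_)
      gcongr
    rw [mul_pow, Real.sq_sqrt (by positivity)] at h4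
    nlinarith [h4]
  let u : ℕ → ℝ := fun j => (w (5 ^ j) : ℝ) / ((5 ^ j : ℕ) : ℝ) ^ 3
  have hu : Tendsto u atTop (nhds 0) :=
    hlim.comp (tendsto_pow_atTop_atTop_of_one_lt (by norm_num))
  have hupos : ∀ j, 0 < u j := fun j => by
    have : (0 : ℝ) < w (5 ^ j) := by exact_mod_cast hpos _
    positivity
  let C : ℝ := 4 * k ^ 2 * 5 ^ 6 + 1
  have hC : 0 < C := by positivity
  have hrec : ∀ j, k ≤ 5 ^ j → u j ≤ C * u (j + 1) ^ 2 := by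
    intro j hj
    have h := key (5 ^ j) (Nat.one_le_pow _ _ (by norm_num)) hj
    rw [← pow_succ'] at h
    have hX : (0 : ℝ) < ((5 ^ j : ℕ) : ℝ) := by positivity
    have e1 : (w (5 ^ j) : ℝ) = u j * ((5 ^ j : ℕ) : ℝ) ^ 3 := by
      simp only [u]; field_simp
    have e2 : (w (5 ^ (j + 1)) : ℝ) = u (j + 1) * (5 * ((5 ^ j : ℕ) : ℝ)) ^ 3 := by
      simp only [u]; push_cast; field_simp; ring
    rw [e1, e2] at h
    have h5 : (((5 ^ j : ℕ) : ℝ) ^ 6) * u j ≤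
      (((5 ^ j : ℕ) : ℝ) ^ 6) * (4 * k ^ 2 * 5 ^ 6 * u (j + 1) ^ 2) := by
      refine le_trans (le_of_eq ?_) (h.trans (le_of_eq ?_)) <;> ring
    have h6 := le_of_mul_le_mul_left h5 (by positivity)
    refine h6.trans ?_
    have : 0 ≤ u (j + 1) ^ 2 := by positivity
    simp only [C]
    nlinarith
  have hev : ∀ᶠ j in atTop, u j < 1 / C := hu.eventually (gt_mem_nhds (by positivity))
  obtain ⟨J0, hJ0⟩ := eventually_atTop.1 hev
  let J := max J0 k
  have hmono : ∀ i, u J ≤ u (J + i) := by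
    intro i
    induction i with
    | zero => simp
    | succ i ih =>
      refine ih.trans ?_
      have h1 := hrec (J + i) (by
        have : J + i < 5 ^ (J + i) := Nat.lt_pow_self (by norm_num)
        have : k ≤ J := le_max_right _ _
        omega)
      have h2 := hJ0 (J + i + 1) (by
        have : J0 ≤ J := le_max_left _ _
        omega)
      rw [lt_div_iff₀ hC] at h2
      have h3 := hupos (J + i + 1)
      rw [← add_assoc]
      nlinarith
  have hev2 : ∀ᶠ j in atTop, u j < u J := hu.eventually (gt_mem_nhds (hupos J))
  obtain ⟨J1, hJ1⟩ := eventually_atTop.1 hev2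
  have := hJ1 (J + J1) (by omega)
  linarith [hmono J1]

variable {K Q : Type*} [Field K] [DivisionRing Q] [Algebra K Q]

/-- the combinatorial tree data needed for the main estimate -/
def TreeHyp (D1 D2 : Subfield Q) (Z : Submodule K Q) : Prop :=
  ∀ M : ℕ, ∃ x : ℕ → Q, ∃ ι : Fin M → ℕ, x 0 = 1 ∧
    (∀ i < 2 * M, ∃ j ≤ i, ∃ z ∈ Z, x (i + 1) = z * x j) ∧ (∀ i, ι i ≤ 2 * M) ∧
    (∀ i, x (ι i) ∈ D2) ∧ LinearIndependent D1 (fun i => x (ι i))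

theorem main_contra (A : Subalgebra K Q)
    (V : Submodule K Q) [FiniteDimensional K V] (h1V : (1 : Q) ∈ V)
    (hVA : Algebra.adjoin K (V : Set Q) = A)
    (hGKA : Filter.limsup
      (fun n : ℕ => ((Real.log (Module.finrank K ↥(V ^ n)) / Real.log n : ℝ) : EReal)) atTop < 3)
    (hQuot : ∀ q : Q, ∃ a ∈ A, ∃ b ∈ A, b ≠ 0 ∧ q = b⁻¹ * a)
    (D1 D2 : Subfield Q) (h12 : D1 ≤ D2) (hK : ∀ c : K, algebraMap K Q c ∈ D1)
    (hinf : ¬ FiniteDimensional K (subK D1 hK))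
    (V1 : Submodule K Q) [FiniteDimensional K V1] (h1 : (1 : Q) ∈ V1) (hV1 : ∀ v ∈ V1, v ∈ D1)
    (hgen : ∀ T : Subfield Q, (∀ c : K, algebraMap K Q c ∈ T) → (∀ v ∈ V1, v ∈ T) → D1 ≤ T)
    (hinfQ : ¬ Module.Finite D2 Q)
    (Z : Submodule K Q) [FiniteDimensional K Z] (h1Z : (1 : Q) ∈ Z)
    (htree : TreeHyp D1 D2 Z) : False := by
  have hK2 : ∀ c : K, algebraMap K Q c ∈ D2 := fun c => h12 (hK c)
  have hA : ∀ n : ℕ, ∀ c : Q, c ≠ 0 → ∃ a : Fin (n + 1) → Q, (∀ i, a i ∈ V ^ n) ∧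
      LinearIndependent D2 (fun i => c * a i) := by
    intro n c hc
    refine lemL2 D2 hK2 V h1V c hc ?_ n
    intro Y hY hcY hYV
    obtain ⟨S, hS⟩ := lemLB D2 Y hY
    have hAS : ∀ a ∈ A, a ∈ S := by
      intro a ha
      rw [← hVA] at ha
      induction ha using Algebra.adjoin_induction with
      | mem x hx => exact (hS x).2 (hYV x hx)
      | algebraMap r => exact (hS _).2 (fun y hy => stab_K hK2 Y r y hy)
      | add x y _ _ hx hy => exact S.add_mem hx hy
      | mul x y _ _ hx hy => exact S.mul_mem hx hy
    apply hinfQ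
    have htop : Y = ⊤ := by
      rw [eq_top_iff]
      intro q _
      obtain ⟨a, ha, b, hb, hb0, hq⟩ := hQuot (c⁻¹ * q)
      have : c⁻¹ * q ∈ S := by rw [hq]; exact S.mul_mem (S.inv_mem (hAS b hb)) (hAS a ha)
      have := (hS _).1 this c hcY
      rwa [mul_inv_cancel_left₀ hc] at this
    rw [htop] at hY
    exact ⟨hY⟩
  let w : ℕ → ℕ := fun n => Module.finrank K ↥(V ^ n)
  have hfdp : ∀ n, FiniteDimensional K ↥(V ^ n) := fd_pow V
  have hm : Monotone w := fun a b hab => Submodule.finrank_mono (pow_mono_V h1V hab)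
  have hpos : ∀ n, 1 ≤ w n := by
    intro n
    refine le_trans ?_ (hm (Nat.zero_le n))
    simp only [w]
    rw [Nat.one_le_iff_ne_zero, Ne, Submodule.finrank_eq_zero]
    exact one_ne_zero
  obtain ⟨k, hk⟩ := lemL3 A hQuot V h1V hVA (V1 ⊔ Z)
  have hk1 : ∀ n, Module.finrank K ↥(V1 * V ^ n) ≤ w (n + k) := fun n => by
    have := fd_mul (V1 ⊔ Z) (V ^ n)
    exact (Submodule.finrank_mono (mul_le_mul' le_sup_left le_rfl)).trans (hk n)
  have hkZ : ∀ n, Module.finrank K ↥(Z * V ^ n) ≤ w (n + k) := fun n => by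
    have := fd_mul (V1 ⊔ Z) (V ^ n)
    exact (Submodule.finrank_mono (mul_le_mul' le_sup_right le_rfl)).trans (hk n)
  have hLI : ∀ (n M : ℕ) (f : Fin M → Q) (c : Q), c ≠ 0 → (∀ i, f i ∈ D2) →
      LinearIndependent D1 f → (∀ i, f i * c ∈ V ^ n) →
      w (2 * n) + M * (n + 1) ≤ w (2 * n + k) := by
    intro n M f c hc hfD hf hfV
    obtain ⟨a, ha, hli⟩ := hA n c hc
    have h5 := lemL5 D1 D2 h12 f _ hfD hf hli
    have h6 := h5.comp (finProdFinEquiv.symm) finProdFinEquiv.symm.injective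
    refine le_trans (lemL1 D1 hK hinf V1 h1 hV1 hgen (M * (n + 1)) (V ^ (2 * n)) _ h6 ?_) (hk1 _)
    intro i
    simp only [Function.comp]
    rw [← mul_assoc, two_mul, pow_add]
    exact Submodule.mul_mem_mul (hfV _) (ha _)
  have hd1 : ∀ n, w (2 * n) + (n + 1) ≤ w (2 * n + k) := by
    intro n
    have := hLI n 1 (fun _ => 1) 1 one_ne_zero (fun _ => D2.one_mem) (by simp)
      (fun _ => by
        rw [mul_one]
        exact pow_mono_V h1V (Nat.zero_le n) (by simp))
    simpa using this
  have hdM : ∀ n M, (2 * M) * (w (n + k) - w n) < w n →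
      w (2 * n) + M * (n + 1) ≤ w (2 * n + k) := by
    intro n M hM
    obtain ⟨x, ι, hx0, hx, hι, hxD, hxl⟩ := htree M
    have hmono : w n ≤ w (n + k) := hm (by omega)
    obtain ⟨c, hc, hcx⟩ := lemL4 Z (V ^ n) h1Z (w (n + k) - w n)
      ((hkZ n).trans (show w (n + k) ≤ w n + (w (n + k) - w n) by omega)) x (2 * M) hx0 hx hM
    exact hLI n M _ c hc hxD hxl (fun i => hcx _ (hι i))
  refine arith_contra w hm hpos k ?_ (growth_small w hpos hGKA)
  intro n
  set Δ := w (n + k) - w n with hΔ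
  set Δ' := w (2 * n + k) - w (2 * n) with hΔ'
  have e1 : n + 1 ≤ Δ' := by have := hd1 n; omega
  have e2 : ∀ M, 2 * M * Δ < w n → M * (n + 1) ≤ Δ' := fun M hM => by
    have := hdM n M hM; omega
  have hp := hpos n
  rcases Nat.eq_zero_or_pos Δ with h0 | h0
  · have := e2 (Δ' + 1) (by rw [h0]; omega)
    nlinarith
  · let M := (w n - 1) / (2 * Δ)
    have hM1 : M * (2 * Δ) ≤ w n - 1 := Nat.div_mul_le_self _ _
    have hM2 : w n - 1 < (M + 1) * (2 * Δ) := by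
      have := Nat.lt_div_mul_add (a := w n - 1) (b := 2 * Δ) (by omega)
      rw [add_mul, one_mul]; exact this
    have hMe := e2 M (by
      have : 2 * M * Δ = M * (2 * Δ) := by ring
      omega)
    rcases Nat.eq_zero_or_pos M with hM0 | hM0
    · rw [hM0] at hM2
      have : w n ≤ 2 * Δ := by omega
      calc (n + 1) * w n ≤ Δ' * (2 * Δ) := Nat.mul_le_mul e1 this
        _ ≤ 4 * (Δ * Δ') := by nlinarith
    · have h7 : w n ≤ 4 * (M * Δ) := by
        have : (M + 1) * (2 * Δ) ≤ 4 * (M * Δ) := by nlinarith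
        omega
      calc (n + 1) * w n ≤ (n + 1) * (4 * (M * Δ)) := Nat.mul_le_mul le_rfl h7
        _ = 4 * (Δ * (M * (n + 1))) := by ring
        _ ≤ 4 * (Δ * Δ') := by gcongr

end PartThree

section PartFour
variable {K Q : Type*} [Field K] [DivisionRing Q] [Algebra K Q]

theorem eigen_li {E M ι : Type*} [DivisionRing E] [AddCommGroup M] [Module E M]
    (N : M →ₗ[E] M) (c : ι → E) (hc : Function.Injective c) (hcc : ∀ i (e : E), e * c i = c i * e)
    (v : ι → M) (hv0 : ∀ i, v i ≠ 0) (hv : ∀ i, N (v i) = c i • v i) : LinearIndependent E v := by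
  classical
  rw [linearIndependent_iff']
  intro s
  induction s using Finset.induction_on with
  | empty => simp
  | insert a s ha ih =>
    intro g hg
    rw [Finset.sum_insert ha] at hg
    have h1 : N (g a • v a + ∑ i ∈ s, g i • v i) - c a • (g a • v a + ∑ i ∈ s, g i • v i) = 0 := by
      rw [hg]; simp
    have h2 : ∑ i ∈ s, (g i * (c i - c a)) • v i = 0 := by
      rw [← h1]
      simp only [map_add, map_sum, map_smul, hv, smul_add, Finset.smul_sum, smul_smul, ← hcc]
      rw [add_sub_add_left_eq_sub, ← Finset.sum_sub_distrib]
      refine Finset.sum_congr rfl fun i _ => ?_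
      rw [mul_sub, sub_smul]
    have h3 : ∀ i ∈ s, g i = 0 := by
      intro i hi
      have := ih _ h2 i hi
      rcases mul_eq_zero.1 this with h | h
      · exact h
      · exfalso
        have := hc (sub_eq_zero.1 h)
        exact ha (this ▸ hi)
    intro i hi
    rcases Finset.mem_insert.1 hi with rfl | hi
    · rw [Finset.sum_eq_zero (fun j hj => by rw [h3 j hj, zero_smul]), add_zero] at hg
      exact (smul_eq_zero.1 hg).resolve_right (hv0 i)
    · exact h3 i hi

theorem lemG (E : Subfield Q) (hK : ∀ c : K, algebraMap K Q c ∈ E) {m : ℕ} (u w : Fin m → Q)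
    (hu : LinearIndependent E u) :
    {τ : K | ¬ LinearIndependent E (fun j => u j + τ • w j)}.Finite := by
  classical
  by_contra hinf
  have hinf' : {τ : K | ¬ LinearIndependent E (fun j => u j + τ • w j)}.Infinite := hinf
  have hinf2 := hinf'.sdiff (Set.finite_singleton (0 : K))
  obtain ⟨t, ht, htc⟩ := hinf2.exists_subset_card_eq (m + 1)
  obtain ⟨φ, hφ⟩ := LinearMap.exists_leftInverse_of_injective (Fintype.linearCombination E u)
    (LinearMap.ker_eq_bot.2 (linearIndependent_iff_injective_fintypeLinearCombination.1 hu))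
  let N : (Fin m → E) →ₗ[E] (Fin m → E) := φ ∘ₗ (Fintype.linearCombination E w)
  have hex : ∀ τ : t, ∃ e : Fin m → E, e ≠ 0 ∧
      N e = (⟨algebraMap K Q (-(τ : K)⁻¹), hK _⟩ : E) • e := by
    rintro ⟨τ, hτ⟩
    obtain ⟨hτ1, hτ0⟩ := ht hτ
    have hτ0 : τ ≠ 0 := hτ0
    have hτ1 : ¬ LinearIndependent E (fun j => u j + τ • w j) := hτ1
    rw [Fintype.linearIndependent_iff] at hτ1
    push Not at hτ1
    obtain ⟨e, he, i, hi⟩ := hτ1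
    refine ⟨e, fun h => hi (by rw [h]; rfl), ?_⟩
    have h1 : Fintype.linearCombination E u e +
        (⟨algebraMap K Q τ, hK _⟩ : E) • Fintype.linearCombination E w e = 0 := by
      rw [← he]
      simp only [Fintype.linearCombination_apply, Finset.smul_sum, ← Finset.sum_add_distrib]
      refine Finset.sum_congr rfl fun j _ => ?_
      rw [smul_add]
      congr 1
      simp only [Subfield.smul_def, smul_eq_mul, Algebra.smul_def]
      rw [← mul_assoc, ← mul_assoc, Algebra.commutes]
    have h2 : e + (⟨algebraMap K Q τ, hK _⟩ : E) • N e = 0 := by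
      have := congrArg φ h1
      rw [map_add, map_smul, map_zero] at this
      rw [← this]
      congr 1
      exact (LinearMap.congr_fun hφ e).symm
    have h3 : (⟨algebraMap K Q (-(τ : K)⁻¹), hK _⟩ : E) * ⟨algebraMap K Q τ, hK _⟩ = -1 := by
      apply Subtype.ext
      simp only [Subfield.coe_mul, Subfield.coe_neg, Subfield.coe_one]
      rw [← map_mul]
      simp [hτ0]
    have h4 : (⟨algebraMap K Q (-(τ : K)⁻¹), hK _⟩ : E) • (e +
        (⟨algebraMap K Q τ, hK _⟩ : E) • N e) = 0 := by rw [h2, smul_zero]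
    rw [smul_add, smul_smul, h3, neg_smul, one_smul] at h4
    exact (add_neg_eq_zero.1 h4).symm
  choose e he0 he using hex
  have hli := eigen_li N (fun τ : t => (⟨algebraMap K Q (-(τ : K)⁻¹), hK _⟩ : E)) (by
      intro a b hab
      have := congrArg Subtype.val hab
      have := (algebraMap K Q).injective this
      exact Subtype.ext (inv_injective (neg_injective this))) (by
      intro i e
      apply Subtype.ext
      exact (Algebra.commutes _ _).symm) e he0 he
  have := hli.fintype_card_le_finrank
  simp [htc] at this

/-- product path -/
def pathx {V : Submodule K Q} (z : ℕ → V) : ℕ → Q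
  | 0 => 1
  | (i + 1) => (z i : Q) * pathx z i

/-- openness along lines -/
def IsOp {V : Submodule K Q} (A : (ℕ → V) → Prop) : Prop :=
  ∀ z, A z → ∀ i v, {τ : K | ¬ A (Function.update z i (z i + τ • v))}.Finite

/-- first `M+1` products independent -/
def PP (E : Subfield Q) {V : Submodule K Q} (M : ℕ) (z : ℕ → V) : Prop :=
  LinearIndependent E (fun j : Fin (M + 1) => pathx z j)

theorem pathx_congr {V : Submodule K Q} (z z' : ℕ → V) (j : ℕ) (h : ∀ i < j, z i = z' i) :
    pathx z j = pathx z' j := by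
  induction j with
  | zero => rfl
  | succ j ih =>
    rw [pathx, pathx, h j (by omega), ih (fun i hi => h i (by omega))]

theorem pathx_shift {V : Submodule K Q} (z : ℕ → V) (s i : ℕ) :
    pathx (fun n => z (n + s)) i * pathx z s = pathx z (i + s) := by
  induction i with
  | zero => simp [pathx]
  | succ i ih =>
    rw [show i + 1 + s = (i + s) + 1 by ring, pathx, pathx, mul_assoc, ih]

theorem pathx_update {V : Submodule K Q} (z : ℕ → V) (i : ℕ) (v : V) (j : ℕ) :
    ∃ w : Q, ∀ τ : K, pathx (Function.update z i (z i + τ • v)) j = pathx z j + τ • w := by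
  induction j with
  | zero => exact ⟨0, fun τ => by simp [pathx]⟩
  | succ j ih =>
    by_cases hji : j = i
    · subst hji
      refine ⟨(v : Q) * pathx z j, fun τ => ?_⟩
      have : pathx (Function.update z j (z j + τ • v)) j = pathx z j :=
        pathx_congr _ _ _ fun i hi => Function.update_of_ne (by omega) _ _
      rw [pathx, pathx, this, Function.update_self]
      simp [add_mul]
    · obtain ⟨w, hw⟩ := ih
      refine ⟨(z j : Q) * w, fun τ => ?_⟩
      rw [pathx, pathx, hw, Function.update_of_ne hji]
      simp [mul_add]

theorem PP_op (E : Subfield Q) (hK : ∀ c : K, algebraMap K Q c ∈ E) {V : Submodule K Q} (M : ℕ) :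
    IsOp (K := K) (PP E (V := V) M) := by
  intro z hz i v
  choose w hw using pathx_update z i v
  have := lemG E hK (fun j : Fin (M + 1) => pathx z j) (fun j => w j) hz
  refine this.subset ?_
  intro τ hτ h
  apply hτ
  unfold PP
  simp only [hw]
  exact h

theorem op_shift {V : Submodule K Q} {A : (ℕ → V) → Prop} (hA : IsOp (K := K) A) (s : ℕ) :
    IsOp (K := K) (fun z : ℕ → V => A (fun n => z (n + s))) := by
  intro z hz i v
  by_cases hi : i < s
  · convert Set.finite_empty (α := K) using 1
    ext τ
    simp only [Set.mem_ofPred_eq, Set.mem_empty_iff_false, iff_false, not_not]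
    convert hz using 2 with n
    exact Function.update_of_ne (by omega) _ _
  · have := hA _ hz (i - s) v
    refine this.subset ?_
    intro τ hτ h
    apply hτ
    convert h using 2 with n
    simp only [Function.update_apply, show (n + s = i) ↔ (n = i - s) by omega,
      show i - s + s = i by omega]

theorem op_forall {V : Submodule K Q} {A : ℕ → (ℕ → V) → Prop} (hA : ∀ s, IsOp (K := K) (A s))
    (S : ℕ) : IsOp (K := K) (fun z : ℕ → V => ∀ s < S, A s z) := by
  intro z hz i v
  refine ((Set.finite_lt_nat S).biUnion (fun s hs => hA s z (hz s hs) i v)).subset ?_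
  intro τ hτ
  simp only [Set.mem_ofPred_eq] at hτ
  push Not at hτ
  obtain ⟨s, hs, h⟩ := hτ
  exact Set.mem_biUnion (show s ∈ {i | i < S} from hs) h

theorem op_inter [Infinite K] {V : Submodule K Q} {A B : (ℕ → V) → Prop}
    (hA : IsOp (K := K) A) (hB : IsOp (K := K) B) (L : ℕ)
    (hdep : ∀ z z' : ℕ → V, (∀ i < L, z i = z' i) → B z → B z')
    (hAn : ∃ z, A z) (hBn : ∃ z, B z) : ∃ z, A z ∧ B z := by
  suffices h : ∀ l, ∃ z z', A z ∧ B z' ∧ ∀ i < l, z' i = z i by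
    obtain ⟨z, z', h1, h2, h3⟩ := h L
    exact ⟨z, h1, hdep _ _ h3 h2⟩
  intro l
  induction l with
  | zero =>
    obtain ⟨z, hz⟩ := hAn
    obtain ⟨z', hz'⟩ := hBn
    exact ⟨z, z', hz, hz', by simp⟩
  | succ l ih =>
    obtain ⟨z, z', hz, hz', h⟩ := ih
    have f1 := hA z hz l (z' l - z l)
    have f2 := hB z' hz' l (z l - z' l)
    have f3 := f2.preimage (f := fun τ : K => 1 - τ) (sub_right_injective.injOn)
    obtain ⟨τ, hτ⟩ := (f1.union f3).exists_notMem
    simp only [Set.mem_union, Set.mem_preimage, Set.mem_ofPred_eq, not_or, not_not] at hτ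
    refine ⟨_, _, hτ.1, hτ.2, ?_⟩
    intro i hi
    by_cases hil : i = l
    · subst hil
      simp only [Function.update_self]
      module
    · rw [Function.update_of_ne hil, Function.update_of_ne hil]
      exact h i (by omega)

theorem op_inter_all [Infinite K] {V : Submodule K Q} {A : ℕ → (ℕ → V) → Prop}
    (hA : ∀ s, IsOp (K := K) (A s)) (L : ℕ → ℕ)
    (hdep : ∀ s, ∀ z z' : ℕ → V, (∀ i < L s, z i = z' i) → A s z → A s z')
    (hAn : ∀ s, ∃ z, A s z) (S : ℕ) : ∃ z, ∀ s < S, A s z := by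
  induction S with
  | zero => exact ⟨fun _ => 0, by simp⟩
  | succ S ih =>
    obtain ⟨z, h1, h2⟩ := op_inter (op_forall hA S) (hA S) (L S) (hdep S) ih (hAn S)
    refine ⟨z, fun s hs => ?_⟩
    rcases Nat.lt_succ_iff_lt_or_eq.1 hs with h | rfl
    · exact h1 s h
    · exact h2

theorem PP_exists [Infinite K] (E : Subfield Q) (hK : ∀ c : K, algebraMap K Q c ∈ E)
    (V : Submodule K Q) [FiniteDimensional K V] (h1 : (1 : Q) ∈ V)
    (hno : ∀ Y : Submodule E Q, Y.FG → (1 : Q) ∈ Y → (∀ v ∈ V, ∀ y ∈ Y, y * v ∈ Y) → False)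
    (M : ℕ) : ∃ z : ℕ → V, PP E M z := by
  induction M with
  | zero =>
    refine ⟨fun _ => 0, ?_⟩
    unfold PP
    simp [pathx]
  | succ M ih =>
    by_contra hemp
    push Not at hemp
    let A : ℕ → (ℕ → V) → Prop := fun s z => PP E M (fun n => z (n + s))
    have hA : ∀ s, IsOp (K := K) (A s) := fun s => op_shift (PP_op E hK M) s
    obtain ⟨zs, hzs⟩ := op_inter_all hA (fun s => M + s) (by
      intro s z z' hzz h
      have e : (fun j : Fin (M + 1) => pathx (fun n => z (n + s)) j) =
          fun j : Fin (M + 1) => pathx (fun n => z' (n + s)) j := by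
        funext j
        exact pathx_congr _ _ _ fun i hi => hzz _ (by omega)
      simp only [A, PP] at h ⊢
      rwa [e] at h) (by
      intro s
      obtain ⟨z, hz⟩ := ih
      refine ⟨fun n => z (n - s), ?_⟩
      simpa [A] using hz) (M + 1)
    let Ω : (ℕ → V) → Prop := fun z => ∀ s < M + 1, A s z
    have hΩ : IsOp (K := K) Ω := op_forall hA (M + 1)
    let F : Submodule E Q := Submodule.span E (Set.range fun j : Fin (M + 1) => pathx zs j)
    have claim1 : ∀ a, Ω a → (∀ i < M, a i = zs i) → ∀ j ≤ 2 * M + 1, pathx a j ∈ F := by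
      intro a ha haz j
      induction j using Nat.strong_induction_on with
      | _ j ihj =>
        intro hj
        rcases Nat.lt_or_ge j (M + 1) with h | h
        · rw [pathx_congr a zs j (fun i hi => haz i (by omega))]
          exact Submodule.subset_span ⟨⟨j, h⟩, rfl⟩
        · obtain ⟨s, rfl⟩ := Nat.exists_eq_add_of_le h
          have hs : s < M + 1 := by omega
          have hP := ha s hs
          have hn := hemp (fun n => a (n + s))
          unfold PP at hn
          rw [linearIndependent_finSucc'] at hn
          have hmem : pathx (fun n => a (n + s)) (M + 1) ∈ Submodule.span E
              (Set.range (fun j : Fin (M + 1) => pathx (fun n => a (n + s)) j)) := by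
            by_contra hcon
            apply hn
            refine ⟨hP, hcon⟩
          rw [← pathx_shift a s (M + 1)]
          have hspan : ∀ y ∈ Submodule.span E
              (Set.range (fun j : Fin (M + 1) => pathx (fun n => a (n + s)) j)),
              y * pathx a s ∈ F := by
            intro y hy
            induction hy using Submodule.span_induction with
            | mem x hx =>
              obtain ⟨i, rfl⟩ := hx
              simp only
              rw [pathx_shift a s i]
              exact ihj _ (by omega) (by omega)
            | zero => simp
            | add x y _ _ hx hy => rw [add_mul]; exact Submodule.add_mem _ hx hy
            | smul e x _ hx =>
              have := Submodule.smul_mem _ e hx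
              simpa [Subfield.smul_def, mul_assoc] using this
          exact hspan _ hmem
    have claim2 : ∀ r ≤ M + 1, ∀ a, Ω a → (∀ i < M, a i = zs i) →
        ∀ u ∈ V ^ r, u * pathx a (2 * M + 1 - r) ∈ F := by
      intro r
      induction r with
      | zero =>
        intro _ a ha haz u hu
        rw [pow_zero, Submodule.mem_one] at hu
        obtain ⟨c, rfl⟩ := hu
        exact F.smul_mem (⟨_, hK c⟩ : E) (claim1 a ha haz _ (by omega))
      | succ r ihr =>
        intro hr a ha haz u hu
        obtain ⟨j, hj⟩ : ∃ j, 2 * M + 1 - (r + 1) = j := ⟨_, rfl⟩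
        have hj1 : 2 * M + 1 - r = j + 1 := by omega
        have hjM : M ≤ j := by omega
        rw [hj]
        rw [pow_succ] at hu
        induction hu using Submodule.mul_induction_on' with
        | mem_mul_mem w hw v hv =>
          have hfin := hΩ a ha j (⟨v, hv⟩ - a j)
          obtain ⟨τ, hτ⟩ := (hfin.union (Set.finite_singleton (0 : K))).exists_notMem
          simp only [Set.mem_union, Set.mem_ofPred_eq, not_or, not_not,
            Set.mem_singleton_iff] at hτ
          have g0 := ihr (by omega) a ha haz w hw
          have g1 := ihr (by omega) _ hτ.1 (fun i hi => by
            rw [Function.update_of_ne (by omega)]; exact haz i hi) w hw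
          rw [hj1, pathx] at g0 g1
          rw [Function.update_self, pathx_congr (Function.update a j _) a j
            (fun i hi => Function.update_of_ne (by omega) _ _)] at g1
          have g2 := F.sub_mem g1 g0
          have g3 := F.smul_mem (⟨_, hK τ⁻¹⟩ : E) g2
          have g4 := F.add_mem g0 g3
          convert g4 using 1
          simp only [Subfield.smul_def, smul_eq_mul, ← Algebra.smul_def]
          simp only [Submodule.coe_add, Submodule.coe_smul, Submodule.coe_sub]
          rw [add_mul, mul_add, add_sub_cancel_left, smul_mul_assoc, mul_smul_comm, smul_smul,
            inv_mul_cancel₀ hτ.2, one_smul, sub_mul, mul_sub, mul_assoc]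
          abel
        | add x _ y _ hx hy => rw [add_mul]; exact F.add_mem hx hy
    obtain ⟨b, hb, hbli⟩ := lemL2 E hK V h1 1 one_ne_zero hno (M + 1)
    have hx0 : pathx zs M ≠ 0 := by
      have := (hzs 0 (by omega))
      have := this.ne_zero (Fin.last M)
      simpa using this
    let R : Q →ₗ[E] Q :=
          { toFun := fun y => y * pathx zs M
            map_add' := fun a b => by simp [add_mul]
            map_smul' := fun e a => by simp [Subfield.smul_def, mul_assoc] }
    have hR : LinearMap.ker R = ⊥ := by
      rw [LinearMap.ker_eq_bot]
      exact fun x y h => mul_right_cancel₀ hx0 h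
    have hli2 := hbli.map' R hR
    have hmem : ∀ i, (R ∘ fun i => 1 * b i) i ∈ F := by
      intro i
      have := claim2 (M + 1) le_rfl zs hzs (fun _ _ => rfl) (b i) (hb i)
      rw [show 2 * M + 1 - (M + 1) = M by omega] at this
      simpa [R] using this
    have hFfg : F.FG := Submodule.fg_span (Set.finite_range _)
    have : FiniteDimensional E F := Module.Finite.iff_fg.2 hFfg
    have hli3 : LinearIndependent E (fun i => (⟨_, hmem i⟩ : F)) := by
      apply LinearIndependent.of_comp F.subtype
      exact hli2
    have c1 := hli3.fintype_card_le_finrank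
    have c2 : Module.finrank E F ≤ M + 1 := by
      have := finrank_range_le_card (R := E) (fun j : Fin (M + 1) => pathx zs j)
      simpa [Set.finrank] using this
    simp at c1
    omega

theorem tree_infinite [Infinite K] (E D2 : Subfield Q) (hK : ∀ c : K, algebraMap K Q c ∈ E)
    (V : Submodule K Q) [FiniteDimensional K V] (h1 : (1 : Q) ∈ V) (hVD : ∀ v ∈ V, v ∈ D2)
    (hno : ∀ Y : Submodule E Q, Y.FG → (1 : Q) ∈ Y → (∀ v ∈ V, ∀ y ∈ Y, y * v ∈ Y) → False) :
    TreeHyp E D2 V := by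
  intro M
  obtain ⟨z, hz⟩ := PP_exists E hK V h1 hno M
  refine ⟨pathx z, fun i => i, rfl, fun i _ => ⟨i, le_rfl, z i, (z i).2, rfl⟩, fun i => ?_,
    ?_, ?_⟩
  · have := i.2
    simp only
    omega
  · intro i
    simp only
    generalize (i : ℕ) = j
    induction j with
    | zero => exact D2.one_mem
    | succ j ih => exact D2.mul_mem (hVD _ (z j).2) ih
  · exact hz.comp Fin.castSucc (Fin.castSucc_injective M)

end PartFour

section PartFive

open Polynomial in
theorem lemJ0 {P D : Type*} [Field P] [Finite P] [Ring D] [IsDomain D] (φ : P →+* D) (a : P)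
    (b : D) (hab : b * φ a ≠ φ a * b) :
    ∃ x : D, x ≠ 0 ∧ ∃ l : P, l ≠ a ∧ x * φ a = φ l * x := by
  classical
  cases nonempty_fintype P
  letI : Module P D := Module.compHom D φ
  have hsm : ∀ (p : P) (d : D), p • d = φ p * d := fun _ _ => rfl
  let T : Module.End P D :=
    { toFun := fun x => x * φ a
      map_add' := fun x y => add_mul _ _ _
      map_smul' := fun p x => by simp [hsm, mul_assoc] }
  have hT : ∀ x, T x = x * φ a := fun _ => rfl
  have hTn : ∀ n x, (T ^ n) x = x * φ a ^ n := by
    intro n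
    induction n with
    | zero => intro x; simp
    | succ n ih => intro x; rw [pow_succ, Module.End.mul_apply, ih, hT, mul_assoc, pow_succ']
  have hq : (1 : ℕ) < Fintype.card P := Fintype.one_lt_card
  have hmon : (X ^ Fintype.card P - X : P[X]).Monic :=
    monic_X_pow_sub (by rw [degree_X]; exact_mod_cast hq)
  have hprod := prod_multiset_X_sub_C_of_monic_of_roots_card_eq hmon (by
    rw [FiniteField.roots_X_pow_card_sub_X, FiniteField.X_pow_card_sub_X_natDegree_eq P hq]
    simp)
  rw [FiniteField.roots_X_pow_card_sub_X] at hprod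
  have hprod' : ∏ l : P, (X - C l) = (X ^ Fintype.card P - X : P[X]) := hprod
  have h0 : aeval T (X ^ Fintype.card P - X : P[X]) = 0 := by
    ext x
    simp only [map_sub, map_pow, aeval_X, LinearMap.sub_apply, hTn, hT, LinearMap.zero_apply]
    rw [← map_pow, FiniteField.pow_card, sub_self]
  rw [← hprod', ← Finset.prod_erase_mul _ _ (Finset.mem_univ a), map_mul] at h0
  have h1 := LinearMap.congr_fun h0 b
  rw [Module.End.mul_apply, LinearMap.zero_apply] at h1
  have hval : ∀ (l : P) (y : D), aeval T (X - C l) y = y * φ a - φ l * y := by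
    intro l y
    simp [hT, hsm]
  by_contra hcon
  push Not at hcon
  have hinj : ∀ s : Finset P, a ∉ s → ∀ y : D, aeval T (∏ l ∈ s, (X - C l)) y = 0 → y = 0 := by
    intro s
    induction s using Finset.induction_on with
    | empty => intro _ y hy; simpa using hy
    | insert l s hl ih =>
      intro ha y hy
      rw [Finset.mem_insert, not_or] at ha
      rw [Finset.prod_insert hl, mul_comm, map_mul, Module.End.mul_apply] at hy
      have h3 := ih ha.2 _ hy
      rw [hval, sub_eq_zero] at h3
      by_contra hy0
      exact hcon y hy0 l (fun h => ha.1 h.symm) h3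
  have h2 := hinj _ (Finset.notMem_erase a _) _ h1
  rw [hval, sub_eq_zero] at h2
  exact hab h2

variable {K Q : Type*} [Field K] [DivisionRing Q] [Algebra K Q]

theorem prodAlg (P X : Subalgebra K Q) [FiniteDimensional K P] [FiniteDimensional K X]
    (h : ∀ y ∈ X, ∀ p ∈ P, y * p ∈ Subalgebra.toSubmodule P * Subalgebra.toSubmodule X) :
    ∃ B : Subalgebra K Q, FiniteDimensional K B ∧ P ≤ B ∧ X ≤ B ∧
      ∀ b ∈ B, b ∈ Subalgebra.toSubmodule P * Subalgebra.toSubmodule X := by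
  set P' := Subalgebra.toSubmodule P with hP'
  set X' := Subalgebra.toSubmodule X with hX'
  have hfP : FiniteDimensional K P' := ‹FiniteDimensional K P›
  have hfX : FiniteDimensional K X' := ‹FiniteDimensional K X›
  have hPP : P' * P' = P' := Subalgebra.isIdempotentElem_toSubmodule P
  have hXX : X' * X' = X' := Subalgebra.isIdempotentElem_toSubmodule X
  have hXP : X' * P' ≤ P' * X' := Submodule.mul_le.2 h
  have hclosed : (P' * X') * (P' * X') ≤ P' * X' := by
    calc (P' * X') * (P' * X') = P' * (X' * P') * X' := by simp only [mul_assoc]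
      _ ≤ P' * (P' * X') * X' := by gcongr
      _ = (P' * P') * (X' * X') := by simp only [mul_assoc]
      _ = P' * X' := by rw [hPP, hXX]
  have h1P : (1 : Q) ∈ P' := P.one_mem
  have h1X : (1 : Q) ∈ X' := X.one_mem
  refine ⟨Submodule.toSubalgebra (P' * X') ?_ ?_, ?_, ?_, ?_, ?_⟩
  · simpa using Submodule.mul_mem_mul h1P h1X
  · intro x y hx hy
    exact hclosed (Submodule.mul_mem_mul hx hy)
  · exact fd_mul P' X'
  · intro p hp
    have : p ∈ P' * X' := by simpa using Submodule.mul_mem_mul (show p ∈ P' from hp) h1X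
    exact this
  · intro x hx
    have : x ∈ P' * X' := by simpa using Submodule.mul_mem_mul h1P (show x ∈ X' from hx)
    exact this
  · intro b hb
    exact hb

theorem finite_sub_field [Finite K] (B : Subalgebra K Q) [FiniteDimensional K B] : IsField B := by
  have : Finite B := Module.finite_of_finite K
  exact Finite.isDomain_to_isField B

theorem lemJac [Finite K] (E : Subfield Q) (hK : ∀ c : K, algebraMap K Q c ∈ E)
    (halg : ∀ x ∈ E, IsIntegral K x) (a b : Q) (ha : a ∈ E) (hb : b ∈ E) : b * a = a * b := by
  by_contra hab
  let P := Algebra.adjoin K {a}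
  have hPE : ∀ p ∈ P, p ∈ E := by
    intro p hp
    induction hp using Algebra.adjoin_induction with
    | mem x hx => rw [Set.mem_singleton_iff.1 hx]; exact ha
    | algebraMap r => exact hK r
    | add x y _ _ hx hy => exact E.add_mem hx hy
    | mul x y _ _ hx hy => exact E.mul_mem hx hy
  have hfP : FiniteDimensional K P := Algebra.finite_adjoin_simple_of_isIntegral (halg a ha)
  have hfinP : Finite P := Module.finite_of_finite K
  letI : Field P := (finite_sub_field P).toField
  let φ : P →+* E :=
    { toFun := fun p => ⟨p.1, hPE _ p.2⟩
      map_one' := rfl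
      map_zero' := rfl
      map_add' := fun _ _ => rfl
      map_mul' := fun _ _ => rfl }
  obtain ⟨x, hx0, l, hla, hxl⟩ := lemJ0 φ ⟨a, Algebra.self_mem_adjoin_singleton K a⟩ ⟨b, hb⟩
    (fun h => hab (congrArg Subtype.val h))
  have hxl' : (x : Q) * a = l * x := congrArg Subtype.val hxl
  have hx0' : (x : Q) ≠ 0 := fun h => hx0 (Subtype.ext h)
  let X := Algebra.adjoin K {(x : Q)}
  have hfX : FiniteDimensional K X := Algebra.finite_adjoin_simple_of_isIntegral (halg x x.2)
  have hxP : ∀ p ∈ P, ∃ p' ∈ P, (x : Q) * p = p' * x := by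
    intro p hp
    induction hp using Algebra.adjoin_induction with
    | mem y hy => rw [Set.mem_singleton_iff.1 hy]; exact ⟨l, l.2, hxl'⟩
    | algebraMap r => exact ⟨_, P.algebraMap_mem r, (Algebra.commutes _ _).symm⟩
    | add y z _ _ hy hz =>
      obtain ⟨y', hy', e1⟩ := hy
      obtain ⟨z', hz', e2⟩ := hz
      exact ⟨y' + z', P.add_mem hy' hz', by rw [mul_add, add_mul, e1, e2]⟩
    | mul y z _ _ hy hz =>
      obtain ⟨y', hy', e1⟩ := hy
      obtain ⟨z', hz', e2⟩ := hz
      exact ⟨y' * z', P.mul_mem hy' hz', by rw [← mul_assoc, e1, mul_assoc, e2, mul_assoc]⟩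
  have hXX : Subalgebra.toSubmodule X * Subalgebra.toSubmodule X = Subalgebra.toSubmodule X :=
    Subalgebra.isIdempotentElem_toSubmodule X
  obtain ⟨B, hfB, hPB, hXB, -⟩ := prodAlg P X (by
    intro y hy
    induction hy using Algebra.adjoin_induction with
    | mem y hy =>
      intro p hp
      rw [Set.mem_singleton_iff.1 hy]
      obtain ⟨p', hp', e⟩ := hxP p hp
      rw [e]
      exact Submodule.mul_mem_mul hp' (Algebra.self_mem_adjoin_singleton K (x : Q))
    | algebraMap r =>
      intro p hp
      rw [Algebra.commutes]
      exact Submodule.mul_mem_mul hp (X.algebraMap_mem r)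
    | add y z _ _ hy hz =>
      intro p hp
      rw [add_mul]
      exact Submodule.add_mem _ (hy p hp) (hz p hp)
    | mul y z _ _ hy hz =>
      intro p hp
      rw [mul_assoc]
      have h1 := hz p hp
      generalize z * p = u at h1 ⊢
      induction h1 using Submodule.mul_induction_on' with
      | mem_mul_mem m hm n hn =>
        rw [← mul_assoc]
        have := Submodule.mul_mem_mul (hy m hm) hn
        rwa [mul_assoc, hXX] at this
      | add m _ n _ hm hn => rw [mul_add]; exact Submodule.add_mem _ hm hn)
  have hc := (finite_sub_field B).mul_comm
    ⟨a, hPB (Algebra.self_mem_adjoin_singleton K a)⟩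
    ⟨x, hXB (Algebra.self_mem_adjoin_singleton K (x : Q))⟩
  have hc' : a * (x : Q) = x * a := congrArg Subtype.val hc
  rw [hxl'] at hc'
  exact hla (Subtype.ext (mul_right_cancel₀ hx0' hc').symm)

theorem exists_transc [Finite K] (E : Subfield Q) (hK : ∀ c : K, algebraMap K Q c ∈ E)
    (hinf : ¬ FiniteDimensional K (subK E hK))
    (V1 : Submodule K Q) [hfV : FiniteDimensional K V1] (hV1 : ∀ v ∈ V1, v ∈ E)
    (hgen : ∀ T : Subfield Q, (∀ c : K, algebraMap K Q c ∈ T) → (∀ v ∈ V1, v ∈ T) → E ≤ T) :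
    ∃ t ∈ E, ¬ IsIntegral K t := by
  classical
  by_contra hcon
  push Not at hcon
  have hcomm := lemJac E hK hcon
  have key : ∀ S : Finset Q, (∀ s ∈ S, s ∈ E) → ∃ B : Subalgebra K Q, FiniteDimensional K B ∧
      (∀ b ∈ B, b ∈ E) ∧ ∀ s ∈ S, s ∈ B := by
    intro S
    induction S using Finset.induction_on with
    | empty =>
      intro _
      refine ⟨⊥, inferInstance, ?_, by simp⟩
      intro b hb
      obtain ⟨c, rfl⟩ := Algebra.mem_bot.1 hb
      exact hK c
    | insert s S _ ih =>
      intro hS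
      obtain ⟨B, hfB, hBE, hSB⟩ := ih (fun t ht => hS t (Finset.mem_insert_of_mem ht))
      have hs := hS s (Finset.mem_insert_self _ _)
      let X := Algebra.adjoin K {s}
      have hfX : FiniteDimensional K X := Algebra.finite_adjoin_simple_of_isIntegral (hcon s hs)
      have hXE : ∀ p ∈ X, p ∈ E := by
        intro p hp
        induction hp using Algebra.adjoin_induction with
        | mem x hx => rw [Set.mem_singleton_iff.1 hx]; exact hs
        | algebraMap r => exact hK r
        | add x y _ _ hx hy => exact E.add_mem hx hy
        | mul x y _ _ hx hy => exact E.mul_mem hx hy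
      obtain ⟨C, hfC, hBC, hXC, hC⟩ := prodAlg B X (by
        intro y hy p hp
        rw [hcomm p y (hBE p hp) (hXE y hy)]
        exact Submodule.mul_mem_mul hp hy)
      refine ⟨C, hfC, ?_, ?_⟩
      · intro b hb
        have h1 := hC b hb
        induction h1 using Submodule.mul_induction_on' with
        | mem_mul_mem m hm n hn => exact E.mul_mem (hBE m hm) (hXE n hn)
        | add m hm n hn h1 h2 =>
          have hle : ∀ z, z ∈ Subalgebra.toSubmodule B * Subalgebra.toSubmodule X → z ∈ E := by
            intro z hz
            have : Subalgebra.toSubmodule B * Subalgebra.toSubmodule X ≤ subK E hK :=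
              Submodule.mul_le.2 fun m hm n hn => E.mul_mem (hBE m hm) (hXE n hn)
            exact this hz
          exact E.add_mem (hle _ hm) (hle _ hn)
      · intro t ht
        rcases Finset.mem_insert.1 ht with rfl | ht
        · exact hXC (Algebra.self_mem_adjoin_singleton K t)
        · exact hBC (hSB t ht)
  obtain ⟨S, hS⟩ := Module.Finite.iff_fg.1 hfV
  obtain ⟨B, hfB, hBE, hSB⟩ := key S (fun s hs => hV1 s (by
    rw [← hS]; exact Submodule.subset_span hs))
  let T : Subfield Q :=
    { B.toSubring with
      inv_mem' := fun x hx => by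
        by_cases h0 : x = 0
        · rw [h0, inv_zero]; exact B.zero_mem
        · obtain ⟨y, hy⟩ := (finite_sub_field B).mul_inv_cancel (a := ⟨x, hx⟩)
            (fun h => h0 (congrArg Subtype.val h))
          have hy' : x * (y : Q) = 1 := congrArg Subtype.val hy
          rw [inv_eq_of_mul_eq_one_right hy']
          exact y.2 }
  have hET : E ≤ T := hgen T (fun c => B.algebraMap_mem c) (by
    intro v hv
    have : V1 ≤ Subalgebra.toSubmodule B := by
      rw [← hS, Submodule.span_le]
      exact hSB
    exact this hv)
  apply hinf
  have hfB' : FiniteDimensional K (Subalgebra.toSubmodule B) := hfB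
  exact Submodule.finiteDimensional_of_le (show subK E hK ≤ Subalgebra.toSubmodule B from
    fun x hx => hET hx)

end PartFive

section PartSix
variable {K Q : Type*} [Field K] [DivisionRing Q] [Algebra K Q]

/-- Case II of the finite field situation. -/
theorem tree_caseII (E D2 : Subfield Q) (hK : ∀ c : K, algebraMap K Q c ∈ E) (h12 : E ≤ D2)
    (t : Q) (ht : t ∈ E)
    (hgen : ∀ T : Subfield Q, (∀ c : K, algebraMap K Q c ∈ T) → t ∈ T → E ≤ T)
    (v : Q) (hv : v ∈ D2) (hvE : ∀ Y : Submodule E Q, Y.FG → ∃ e ∈ E, v * e ∉ Y) :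
    TreeHyp E D2 (Submodule.span K ({1, t, v} : Set Q)) := by
  have hli : ∀ M : ℕ, LinearIndependent E (fun i : Fin M => v * t ^ (i : ℕ)) := by
    intro M
    induction M with
    | zero => exact linearIndependent_empty_type
    | succ M ih =>
      rw [linearIndependent_finSucc']
      refine ⟨ih, fun hmem => ?_⟩
      let Y := Submodule.span E (Set.range (fun i : Fin M => v * t ^ (i : ℕ)))
      have hmem : v * t ^ M ∈ Y := hmem
      have hpow : ∀ i ≤ M, v * t ^ i ∈ Y := by
        intro i hi
        rcases Nat.lt_or_ge i M with h | h
        · exact Submodule.subset_span ⟨⟨i, h⟩, rfl⟩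
        · obtain rfl : i = M := by omega
          exact hmem
      have hFG : Y.FG := Submodule.fg_span (Set.finite_range _)
      obtain ⟨S, hS⟩ := lemLB E Y hFG
      have hES : E ≤ S := by
        apply hgen
        · intro c
          exact (hS _).2 (fun y hy => stab_K hK Y c y hy)
        · rw [hS]
          intro y hy
          induction hy using Submodule.span_induction with
          | mem x hx =>
            obtain ⟨i, rfl⟩ := hx
            simp only
            rw [mul_assoc, ← pow_succ]
            exact hpow _ i.2
          | zero => simp
          | add x y _ _ hx hy => rw [add_mul]; exact Submodule.add_mem _ hx hy
          | smul e x _ hx =>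
            have := Submodule.smul_mem _ e hx
            simpa [Subfield.smul_def, mul_assoc] using this
      obtain ⟨e, he, hne⟩ := hvE Y hFG
      apply hne
      have := hpow 0 (Nat.zero_le _)
      rw [pow_zero, mul_one] at this
      exact (hS e).1 (hES he) v this
  intro M
  refine ⟨fun n => if n % 2 = 0 then t ^ (n / 2) else v * t ^ (n / 2), fun i => 2 * i + 1,
    by simp, ?_, ?_, ?_, ?_⟩
  · intro i _
    rcases Nat.even_or_odd' i with ⟨k, rfl | rfl⟩
    · refine ⟨2 * k, le_rfl, v, Submodule.subset_span (by simp), ?_⟩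
      simp [show (2 * k + 1) % 2 = 1 by omega, show (2 * k + 1) / 2 = k by omega]
    · refine ⟨2 * k, by omega, t, Submodule.subset_span (by simp), ?_⟩
      simp [show (2 * k + 1 + 1) % 2 = 0 by omega, show (2 * k + 1 + 1) / 2 = k + 1 by omega,
        pow_succ']
  · intro i
    have := i.2
    simp only
    omega
  · intro i
    simp only [show (2 * (i : ℕ) + 1) % 2 = 1 by omega, show (2 * (i : ℕ) + 1) / 2 = i by omega]
    exact D2.mul_mem hv (D2.pow_mem (h12 ht) _)
  · have := hli M
    convert this using 2 with i
    simp only [show (2 * (i : ℕ) + 1) % 2 = 1 by omega, show (2 * (i : ℕ) + 1) / 2 = i by omega]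
    simp

/-- Case I of the finite field situation. -/
theorem tree_caseI (E D2 : Subfield Q) (hK : ∀ c : K, algebraMap K Q c ∈ E) (h12 : E ≤ D2)
    (V : Submodule K Q) [hfV : FiniteDimensional K V] (h1 : (1 : Q) ∈ V) (hVD : ∀ v ∈ V, v ∈ D2)
    (hno : ∀ Y : Submodule E Q, Y.FG → (1 : Q) ∈ Y → (∀ v ∈ V, ∀ y ∈ Y, y * v ∈ Y) → False)
    (hI : ∀ v ∈ V, ∃ Y : Submodule E Q, Y.FG ∧ ∀ e ∈ E, v * e ∈ Y) :
    ∃ Z : Submodule K Q, FiniteDimensional K Z ∧ (1 : Q) ∈ Z ∧ TreeHyp E D2 Z := by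
  classical
  obtain ⟨S, hS⟩ := Module.Finite.iff_fg.1 hfV
  have hSV : ∀ s ∈ S, s ∈ V := fun s hs => by rw [← hS]; exact Submodule.subset_span hs
  have hex : ∀ s : Q, ∃ Y : Submodule E Q, Y.FG ∧ (s ∈ S → ∀ e ∈ E, s * e ∈ Y) := by
    intro s
    by_cases hs : s ∈ S
    · obtain ⟨Y, h, h'⟩ := hI s (hSV s hs)
      exact ⟨Y, h, fun _ => h'⟩
    · exact ⟨⊥, Submodule.fg_bot, fun h => absurd h hs⟩
  choose Y hYfg hY using hex
  let Θ : Submodule E Q := S.sup Y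
  have hΘ : Θ.FG := Submodule.fg_finset_sup S Y (fun s _ => hYfg s)
  have hVE : ∀ v ∈ V, ∀ e ∈ E, v * e ∈ Θ := by
    intro v hv
    rw [← hS] at hv
    induction hv using Submodule.span_induction with
    | mem s hs => exact fun e he => (Finset.le_sup (f := Y) hs) (hY s hs e he)
    | zero => intro e _; simp
    | add x y _ _ hx hy => intro e he; rw [add_mul]; exact Θ.add_mem (hx e he) (hy e he)
    | smul c x _ hx =>
      intro e he
      rw [smul_mul_assoc]
      exact (toK E hK Θ).smul_mem c (hx e he)
  let G : Set Q := {q | ∃ v ∈ V, ∃ e ∈ E, q = v * e}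
  have hGΘ : Submodule.span E G ≤ Θ := by
    rw [Submodule.span_le]
    rintro _ ⟨v, hv, e, he, rfl⟩
    exact hVE v hv e he
  have hGfg : (Submodule.span E G).FG := by
    have : FiniteDimensional E Θ := Module.Finite.iff_fg.2 hΘ
    have : FiniteDimensional E (Submodule.span E G) := Submodule.finiteDimensional_of_le hGΘ
    exact Module.Finite.iff_fg.1 this
  obtain ⟨T, hTG, hT⟩ := (Submodule.fg_span_iff_fg_span_finset_subset G).1 hGfg
  have hTD : ∀ τ ∈ T, τ ∈ D2 := by
    intro τ hτ
    obtain ⟨v, hv, e, he, rfl⟩ := hTG hτ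
    exact D2.mul_mem (hVD v hv) (h12 he)
  let Z : Submodule K Q := Submodule.span K (insert 1 T : Finset Q)
  refine ⟨Z, FiniteDimensional.span_finset K _, Submodule.subset_span (by simp), ?_⟩
  have key : ∀ n : ℕ, ∃ x : ℕ → Q, x 0 = 1 ∧ (∀ i < n, ∃ j ≤ i, ∃ z ∈ Z, x (i + 1) = z * x j) ∧
      (∀ i ≤ n, x i ∈ D2) ∧ LinearIndependent E (fun i : Fin (n + 1) => x i) := by
    intro n
    induction n with
    | zero =>
      refine ⟨fun _ => 1, rfl, by simp, fun _ _ => D2.one_mem, ?_⟩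
      simp
    | succ n ih =>
      obtain ⟨x, hx0, hx, hxD, hli⟩ := ih
      let F : Submodule E Q := Submodule.span E (Set.range (fun i : Fin (n + 1) => x i))
      have hstep : ∃ τ ∈ T, ∃ j ≤ n, τ * x j ∉ F := by
        by_contra hcon
        push Not at hcon
        have hTx : ∀ q ∈ Submodule.span E G, ∀ j ≤ n, q * x j ∈ F := by
          intro q hq j hj
          rw [hT] at hq
          induction hq using Submodule.span_induction with
          | mem s hs => exact hcon s hs j hj
          | zero => simp
          | add x y _ _ hx hy => rw [add_mul]; exact Submodule.add_mem _ hx hy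
          | smul e x _ hx =>
            have := Submodule.smul_mem _ e hx
            simpa [Subfield.smul_def, mul_assoc] using this
        have hVF : ∀ v ∈ V, ∀ y ∈ F, v * y ∈ F := by
          have haux : ∀ y ∈ F, ∀ v ∈ V, ∀ e ∈ E, v * e * y ∈ F := by
            intro y hy
            induction hy using Submodule.span_induction with
            | mem s hs =>
              intro v hv e he
              obtain ⟨i, rfl⟩ := hs
              exact hTx _ (Submodule.subset_span ⟨v, hv, e, he, rfl⟩) _ (by omega)
            | zero => intros; simp
            | add x y _ _ hx hy =>
              intro v hv e he
              rw [mul_add]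
              exact Submodule.add_mem _ (hx v hv e he) (hy v hv e he)
            | smul f x _ hx =>
              intro v hv e he
              have := hx v hv (e * f) (E.mul_mem he f.2)
              simpa [Subfield.smul_def, mul_assoc] using this
          intro v hv y hy
          simpa using haux y hy v hv 1 E.one_mem
        have h1F : (1 : Q) ∈ F := by
          have : x 0 ∈ F := Submodule.subset_span ⟨0, rfl⟩
          rwa [hx0] at this
        have hpow : ∀ m, V ^ m ≤ toK E hK F := by
          intro m
          induction m with
          | zero =>
            rw [pow_zero, Submodule.one_le]
            exact h1F
          | succ m ihm =>
            rw [pow_succ', Submodule.mul_le]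
            intro v hv y hy
            exact hVF v hv y (ihm hy)
        obtain ⟨b, hb, hbli⟩ := lemL2 E hK V h1 1 one_ne_zero hno (n + 1)
        have hmem : ∀ i, 1 * b i ∈ F := fun i => by
          rw [one_mul]; exact hpow _ (hb i)
        have hFfg : F.FG := Submodule.fg_span (Set.finite_range _)
        have : FiniteDimensional E F := Module.Finite.iff_fg.2 hFfg
        have hli3 : LinearIndependent E (fun i => (⟨_, hmem i⟩ : F)) := by
          apply LinearIndependent.of_comp F.subtype
          exact hbli
        have c1 := hli3.fintype_card_le_finrank
        have c2 : Module.finrank E F ≤ n + 1 := by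
          have := finrank_range_le_card (R := E) (fun j : Fin (n + 1) => x j)
          simpa [Set.finrank] using this
        simp at c1
        omega
      obtain ⟨τ, hτ, j, hj, hτj⟩ := hstep
      have hup : ∀ i ≤ n, Function.update x (n + 1) (τ * x j) i = x i := fun i hi =>
        Function.update_of_ne (by omega) _ _
      refine ⟨Function.update x (n + 1) (τ * x j), ?_, ?_, ?_, ?_⟩
      · rw [hup 0 (by omega), hx0]
      · intro i hi
        rcases Nat.lt_or_ge i n with h | h
        · obtain ⟨j', hj', z, hz, e⟩ := hx i h
          exact ⟨j', hj', z, hz, by rw [hup _ (by omega), hup _ (by omega), e]⟩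
        · obtain rfl : i = n := by omega
          refine ⟨j, hj, τ, Submodule.subset_span (by simp [hτ]), ?_⟩
          rw [hup j hj, Function.update_self]
      · intro i hi
        rcases Nat.lt_or_ge i (n + 1) with h | h
        · rw [hup i (by omega)]; exact hxD i (by omega)
        · obtain rfl : i = n + 1 := by omega
          rw [Function.update_self]
          exact D2.mul_mem (hTD τ hτ) (hxD j hj)
      · rw [linearIndependent_finSucc']
        have e : (Fin.init fun i : Fin (n + 1 + 1) =>
            Function.update x (n + 1) (τ * x j) i) = fun i : Fin (n + 1) => x i := by
          funext i
          exact hup _ (by simp; omega)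
        rw [e]
        refine ⟨hli, ?_⟩
        simpa using hτj
  intro M
  obtain ⟨x, hx0, hx, hxD, hli⟩ := key (2 * M)
  refine ⟨x, fun i => i, hx0, hx, fun i => by have := i.2; simp only; omega,
    fun i => hxD _ (by have := i.2; simp only; omega), ?_⟩
  exact hli.comp (Fin.castLE (by omega)) (Fin.castLE_injective _)

theorem finite_case [Finite K] (D1 D2 : Subfield Q) (h12 : D1 ≤ D2)
    (hK1 : ∀ c : K, algebraMap K Q c ∈ D1)
    (hinf : ¬ FiniteDimensional K (subK D1 hK1))
    (V1 : Submodule K Q) [FiniteDimensional K V1] (hV1 : ∀ v ∈ V1, v ∈ D1)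
    (hgen : ∀ T : Subfield Q, (∀ c : K, algebraMap K Q c ∈ T) → (∀ v ∈ V1, v ∈ T) → D1 ≤ T)
    (V2 : Submodule K Q) [FiniteDimensional K V2] (h1 : (1 : Q) ∈ V2) (hV2 : ∀ v ∈ V2, v ∈ D2)
    (hgen2 : ∀ T : Subfield Q, (∀ c : K, algebraMap K Q c ∈ T) → (∀ v ∈ V2, v ∈ T) → D2 ≤ T)
    (hinf2 : ∀ Y : Submodule D1 Q, Y.FG → ∃ q ∈ D2, q ∉ Y) :
    ∃ (E : Subfield Q) (hK : ∀ c : K, algebraMap K Q c ∈ E) (V1' Z : Submodule K Q),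
      E ≤ D2 ∧ ¬ FiniteDimensional K (subK E hK) ∧ FiniteDimensional K V1' ∧ (1 : Q) ∈ V1' ∧
      (∀ v ∈ V1', v ∈ E) ∧
      (∀ T : Subfield Q, (∀ c : K, algebraMap K Q c ∈ T) → (∀ v ∈ V1', v ∈ T) → E ≤ T) ∧
      FiniteDimensional K Z ∧ (1 : Q) ∈ Z ∧ TreeHyp E D2 Z := by
  obtain ⟨t, ht1, ht⟩ := exists_transc D1 hK1 hinf V1 hV1 hgen
  let E : Subfield Q := Subfield.closure (Set.range (algebraMap K Q) ∪ {t})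
  have hK : ∀ c : K, algebraMap K Q c ∈ E := fun c =>
    Subfield.subset_closure (Or.inl ⟨c, rfl⟩)
  have htE : t ∈ E := Subfield.subset_closure (Or.inr rfl)
  have hgenE : ∀ T : Subfield Q, (∀ c : K, algebraMap K Q c ∈ T) → t ∈ T → E ≤ T := by
    intro T h1 h2
    rw [Subfield.closure_le]
    rintro _ (⟨c, rfl⟩ | rfl)
    · exact h1 c
    · exact h2
  have hED1 : E ≤ D1 := hgenE D1 hK1 ht1
  have hinfE : ¬ FiniteDimensional K (subK E hK) := by
    intro hfd
    apply ht
    let B : Subalgebra K Q := { E.toSubring with algebraMap_mem' := hK }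
    have hB : Module.Finite K B := hfd
    exact IsIntegral.of_mem_of_fg B (Module.Finite.iff_fg.1 hB) t htE
  have hnoE : ∀ Y : Submodule E Q, Y.FG → (1 : Q) ∈ Y →
      (∀ v ∈ V2, ∀ y ∈ Y, y * v ∈ Y) → False := by
    intro Y hY h1Y hst
    obtain ⟨S, hS⟩ := lemLB E Y hY
    have hD2S : D2 ≤ S := hgen2 S (fun c => (hS _).2 (fun y hy => stab_K hK Y c y hy))
      (fun v hv => (hS v).2 (hst v hv))
    obtain ⟨s, hs⟩ := hY
    obtain ⟨q, hq, hqn⟩ := hinf2 (Submodule.span D1 (s : Set Q)) ⟨s, rfl⟩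
    apply hqn
    have hqY : q ∈ Y := by simpa using (hS q).1 (hD2S hq) 1 h1Y
    rw [← hs] at hqY
    clear hqn hq
    induction hqY using Submodule.span_induction with
    | mem x hx => exact Submodule.subset_span hx
    | zero => exact Submodule.zero_mem _
    | add x y _ _ hx hy => exact Submodule.add_mem _ hx hy
    | smul e x _ hx => exact Submodule.smul_mem _ (⟨e, hED1 e.2⟩ : D1) hx
  have hsp : ∀ T : Subfield Q, (∀ c : K, algebraMap K Q c ∈ T) → t ∈ T →
      ∀ v ∈ Submodule.span K ({1, t} : Set Q), v ∈ T := by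
    intro T hKT htT
    have : Submodule.span K ({1, t} : Set Q) ≤ subK T hKT := by
      rw [Submodule.span_le]
      rintro x (rfl | rfl)
      · exact T.one_mem
      · exact htT
    exact fun v hv => this hv
  suffices h : ∃ Z : Submodule K Q, FiniteDimensional K Z ∧ (1 : Q) ∈ Z ∧ TreeHyp E D2 Z by
    obtain ⟨Z, hZ1, hZ2, hZ3⟩ := h
    refine ⟨E, hK, Submodule.span K ({1, t} : Set Q), Z, hED1.trans h12, hinfE,
      FiniteDimensional.span_of_finite K (by simp), Submodule.subset_span (by simp),
      hsp E hK htE, ?_, hZ1, hZ2, hZ3⟩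
    intro T hKT hT
    exact hgenE T hKT (hT t (Submodule.subset_span (by simp)))
  by_cases hII : ∃ v ∈ V2, ∀ Y : Submodule E Q, Y.FG → ∃ e ∈ E, v * e ∉ Y
  · obtain ⟨v, hv, hvE⟩ := hII
    exact ⟨_, FiniteDimensional.span_of_finite K (by simp), Submodule.subset_span (by simp),
      tree_caseII E D2 hK (hED1.trans h12) t htE hgenE v (hV2 v hv) hvE⟩
  · push Not at hII
    exact tree_caseI E D2 hK (hED1.trans h12) V2 h1 hV2 hnoE hII

end PartSix

section PartSeven
variable {K Q : Type*} [Field K] [DivisionRing Q] [Algebra K Q]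

theorem fin_coeffs (E F : Subfield Q) (h : E ≤ F) (Y : Submodule E Q) (hY : Y.FG)
    (hF : ∀ q ∈ F, q ∈ Y) :
    ∃ s : Finset Q, (∀ x ∈ s, x ∈ F) ∧ ∀ q ∈ F, ∃ c : Q → Q,
      (∀ x ∈ s, c x ∈ E) ∧ q = ∑ x ∈ s, c x * x := by
  let FE : Submodule E Q :=
    { carrier := F
      add_mem' := fun ha hb => F.add_mem ha hb
      zero_mem' := F.zero_mem
      smul_mem' := fun c x hx => F.mul_mem (h c.2) hx }
  have hfd : FiniteDimensional E Y := Module.Finite.iff_fg.2 hY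
  have hle : FE ≤ Y := fun q hq => hF q hq
  have hfd2 : FiniteDimensional E FE := Submodule.finiteDimensional_of_le hle
  obtain ⟨s, hs⟩ := (Module.Finite.iff_fg.1 hfd2 : FE.FG)
  refine ⟨s, fun x hx => ?_, fun q hq => ?_⟩
  · have : x ∈ FE := hs ▸ Submodule.subset_span hx
    exact this
  · have hq' : q ∈ Submodule.span E (s : Set Q) := by rw [hs]; exact hq
    obtain ⟨f, -, hf⟩ := Submodule.mem_span_finset.1 hq'
    exact ⟨fun x => (f x : Q), fun x _ => (f x).2, hf.symm⟩

theorem fin_coeffs_K (F : Subfield Q) (hK : ∀ c : K, algebraMap K Q c ∈ F)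
    (hfd : FiniteDimensional K (subK F hK)) :
    ∃ s : Finset Q, (∀ x ∈ s, x ∈ F) ∧ ∀ q ∈ F, ∃ c : Q → Q,
      (∀ x ∈ s, c x ∈ (algebraMap K Q).range) ∧ q = ∑ x ∈ s, c x * x := by
  obtain ⟨s, hs⟩ := (Module.Finite.iff_fg.1 hfd : (subK F hK).FG)
  refine ⟨s, fun x hx => ?_, fun q hq => ?_⟩
  · have : x ∈ subK F hK := hs ▸ Submodule.subset_span hx
    exact this
  · have hq' : q ∈ Submodule.span K (s : Set Q) := by rw [hs]; exact hq
    obtain ⟨f, -, hf⟩ := Submodule.mem_span_finset.1 hq'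
    refine ⟨fun x => algebraMap K Q (f x), fun x _ => ⟨f x, rfl⟩, ?_⟩
    rw [← hf]
    exact Finset.sum_congr rfl (fun x _ => Algebra.smul_def _ _)

theorem gen_space (F : Subfield Q) (hK : ∀ c : K, algebraMap K Q c ∈ F) (S : Finset Q)
    (hS : IsDivGenBy (K := K) F.toSubring S) :
    ∃ W : Submodule K Q, FiniteDimensional K W ∧ (1 : Q) ∈ W ∧ (∀ v ∈ W, v ∈ F) ∧
      ∀ T : Subfield Q, (∀ c : K, algebraMap K Q c ∈ T) → (∀ v ∈ W, v ∈ T) → F ≤ T := by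
  refine ⟨Submodule.span K (insert 1 (S : Set Q)),
    FiniteDimensional.span_of_finite K (S.finite_toSet.insert 1),
    Submodule.subset_span (Set.mem_insert _ _), ?_, ?_⟩
  · have : Submodule.span K (insert 1 (S : Set Q)) ≤ subK F hK := by
      rw [Submodule.span_le]
      rintro x (rfl | hx)
      · exact F.one_mem
      · exact hS.2.1 hx
    exact fun v hv => this hv
  · intro T hKT hT
    exact hS.2.2 T.toSubring ⟨hKT, fun x hx => T.inv_mem hx⟩
      (fun x hx => hT x (Submodule.subset_span (Set.mem_insert_of_mem _ hx)))

end PartSeven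

/-- Theorem 1 of the paper: if `A` is a finitely generated domain over `K` of GK
dimension `< 3` with quotient division algebra `Q(A) = Q`, then any chain
`K = D₀ ⊆ D₁ ⊆ ⋯ ⊆ D_m ⊆ Q` of division subalgebras, each `D_i` (for `i ≥ 1`)
finitely generated as a division algebra and infinite-dimensional as a left
`D_{i-1}`-vector space, has `m ≤ 2`. -/
theorem stmt9 {K Q : Type*} [Field K] [DivisionRing Q] [Algebra K Q]
    (A : Subalgebra K Q)
    (V : Submodule K Q) (hVfin : FiniteDimensional K ↥V) (h1V : (1 : Q) ∈ V)
    (hVA : Algebra.adjoin K (V : Set Q) = A)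
    (hGKA : gkWrt K V < 3)
    (hQuot : ∀ q : Q, ∃ a ∈ A, ∃ b ∈ A, b ≠ 0 ∧ q = b⁻¹ * a)
    (m : ℕ) (D : ℕ → Subring Q)
    (hD0 : D 0 = (algebraMap K Q).range)
    (hchain : ∀ i : ℕ, i < m → D i ≤ D (i + 1))
    (hdiv : ∀ i : ℕ, i ≤ m → IsDivSub (K := K) (D i))
    (hfg : ∀ i : ℕ, 1 ≤ i → i ≤ m → ∃ S : Finset Q, IsDivGenBy (K := K) (D i) S)
    (hinf : ∀ i : ℕ, 1 ≤ i → i ≤ m →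
      ¬ ∃ s : Finset Q, (s : Set Q) ⊆ D i ∧ ∀ q ∈ D i, ∃ c : Q → Q,
        (∀ x ∈ s, c x ∈ D (i - 1)) ∧ q = ∑ x ∈ s, c x * x) :
    m ≤ 2 := by
  by_contra hm
  have hdv1 := hdiv 1 (by omega)
  have hdv2 := hdiv 2 (by omega)
  have hdv3 := hdiv 3 (by omega)
  let D1 : Subfield Q := { D 1 with inv_mem' := fun x hx => hdv1.2 x hx }
  let D2 : Subfield Q := { D 2 with inv_mem' := fun x hx => hdv2.2 x hx }
  let D3 : Subfield Q := { D 3 with inv_mem' := fun x hx => hdv3.2 x hx }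
  have h12 : D1 ≤ D2 := fun x hx => hchain 1 (by omega) hx
  have h23 : D2 ≤ D3 := fun x hx => hchain 2 (by omega) hx
  have hK1 : ∀ c : K, algebraMap K Q c ∈ D1 := hdv1.1
  have hK2 : ∀ c : K, algebraMap K Q c ∈ D2 := hdv2.1
  obtain ⟨S1, hS1⟩ := hfg 1 (by omega) (by omega)
  obtain ⟨S2, hS2⟩ := hfg 2 (by omega) (by omega)
  obtain ⟨V1, hV1fin, h1V1, hV1D, hgen1⟩ := gen_space D1 hK1 S1 hS1
  obtain ⟨V2, hV2fin, h1V2, hV2D, hgen2⟩ := gen_space D2 hK2 S2 hS2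
  have hinf1 : ¬ FiniteDimensional K (subK D1 hK1) := by
    intro hfd
    obtain ⟨s, hs1, hs2⟩ := fin_coeffs_K D1 hK1 hfd
    refine hinf 1 (by omega) (by omega) ⟨s, hs1, fun q hq => ?_⟩
    obtain ⟨c, hc1, hc2⟩ := hs2 q hq
    exact ⟨c, fun x hx => by rw [Nat.sub_self, hD0]; exact hc1 x hx, hc2⟩
  have hinf2 : ∀ Y : Submodule D1 Q, Y.FG → ∃ q ∈ D2, q ∉ Y := by
    intro Y hY
    by_contra hcon
    push Not at hcon
    obtain ⟨s, hs1, hs2⟩ := fin_coeffs D1 D2 h12 Y hY hcon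
    exact hinf 2 (by omega) (by omega) ⟨s, hs1, hs2⟩
  have hinfQ : ¬ Module.Finite D2 Q := by
    intro hfin
    obtain ⟨s, hs1, hs2⟩ := fin_coeffs D2 D3 h23 ⊤ hfin.fg_top (fun q _ => Submodule.mem_top)
    exact hinf 3 (by omega) (by omega) ⟨s, hs1, hs2⟩
  cases finite_or_infinite K with
  | inl hfinK =>
    obtain ⟨E, hK, W, Z, hED, hinfE, hW, h1W, hWE, hgenE, hZ, h1Z, htree⟩ :=
      finite_case D1 D2 h12 hK1 hinf1 V1 hV1D hgen1 V2 h1V2 hV2D hgen2 hinf2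
    exact main_contra A V h1V hVA hGKA hQuot E D2 hED hK hinfE W h1W hWE hgenE hinfQ Z h1Z htree
  | inr hinfK =>
    have htree : TreeHyp D1 D2 V2 := by
      refine tree_infinite D1 D2 hK1 V2 h1V2 hV2D ?_
      intro Y hY h1Y hst
      obtain ⟨S, hS⟩ := lemLB D1 Y hY
      have hD2S : D2 ≤ S := hgen2 S (fun c => (hS _).2 (fun y hy => stab_K hK1 Y c y hy))
        (fun v hv => (hS v).2 (hst v hv))
      obtain ⟨q, hq, hqn⟩ := hinf2 Y hY
      exact hqn (by simpa using (hS q).1 (hD2S hq) 1 h1Y)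
    exact main_contra A V h1V hVA hGKA hQuot D1 D2 h12 hK1 hinf1 V1 h1V1 hV1D hgen1 hinfQ V2
      h1V2 htree
end

section
/- Let $K$ be an algebraically closed field and $A$ a finitely generated $K$-algebra that is a domain of GK dimension less than $3$. If $F \subseteq Q(A)$ is a subfield containing $K$ of transcendence degree at least $2$ over $K$, then $Q(A)$ is finite-dimensional over its center. -/
open Filter

section
variable {Q : Type*} [DivisionRing Q]

theorem aux_indep {ι : Type*} (q : ι → Q) (hq : LinearIndependent (Subring.center Q) q) :
    ∀ (s : Finset ι) (f : ι → Q), (∀ v, ∑ i ∈ s, q i * v * f i = 0) → ∀ i ∈ s, f i = 0 := by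
  classical
  intro s
  induction s using Finset.induction_on with
  | empty => simp
  | insert a s ha ih =>
    intro f hf
    by_cases h0 : f a = 0
    · have := ih f (by intro v; have := hf v; rw [Finset.sum_insert ha, h0] at this; simpa using this)
      intro i hi
      rcases Finset.mem_insert.1 hi with rfl | hi
      · exact h0
      · exact this i hi
    · exfalso
      set g : ι → Q := fun i => f i * (f a)⁻¹ with hg
      have hga : g a = 1 := by simp [hg, h0]
      have hgs : ∀ v, ∑ i ∈ insert a s, q i * v * g i = 0 := by
        intro v
        have := congrArg (· * (f a)⁻¹) (hf v)
        simpa [Finset.sum_mul, hg, mul_assoc] using this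
      have hc : ∀ w, ∀ i ∈ s, w * g i - g i * w = 0 := by
        intro w
        refine ih (fun i => w * g i - g i * w) ?_
        intro v
        have h1 := hgs (v * w)
        have h2 := congrArg (· * w) (hgs v)
        simp only [Finset.sum_mul, zero_mul] at h2
        have h3 : ∑ i ∈ insert a s, q i * v * (w * g i - g i * w) = 0 := by
          have : ∀ i, q i * v * (w * g i - g i * w) = q i * (v * w) * g i - q i * v * g i * w := by
            intro i; simp only [mul_sub, mul_assoc]
          simp only [this, Finset.sum_sub_distrib, h1, h2, sub_zero]
        rw [Finset.sum_insert ha, hga] at h3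
        simpa using h3
      have hcen : ∀ i ∈ insert a s, g i ∈ Subring.center Q := by
        intro i hi
        rw [Subring.mem_center_iff]
        rcases Finset.mem_insert.1 hi with rfl | hi
        · simp [hga]
        · intro w; exact sub_eq_zero.1 (hc w i hi)
      let z : ι → Subring.center Q := fun i => if h : i ∈ insert a s then ⟨g i, hcen i h⟩ else 0
      have hz := linearIndependent_iff'.1 hq (insert a s) z (by
        rw [← hgs 1]
        refine Finset.sum_congr rfl fun i hi => ?_
        have : (z i : Q) = g i := by simp only [z, dif_pos hi]
        rw [Subring.smul_def, this, mul_one, smul_eq_mul]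
        exact ((Subring.mem_center_iff.1 (hcen i hi)) (q i)).symm) a (Finset.mem_insert_self _ _)
      have : (z a : Q) = g a := by simp only [z, dif_pos (Finset.mem_insert_self a s)]
      rw [hz, hga] at this
      simp at this

theorem finite_center {L : Type*} [Field L] [Module L Q] (j : L →+* Q)
    (hj : ∀ (l : L) (q : Q), l • q = q * j l) (hfin : FiniteDimensional L Q) :
    ∃ s : Finset Q, ∀ q : Q, ∃ c : Q → Q,
      (∀ x ∈ s, c x ∈ Subring.center Q) ∧ q = ∑ x ∈ s, c x * x := by
  classical
  have hr : Module.rank (Subring.center Q) Q ≤ (Module.finrank L (Q →ₗ[L] Q) : ℕ) := by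
    refine rank_le fun s hs => ?_
    let T : Q → (Q →ₗ[L] Q) := fun q =>
      { toFun := fun v => q * v
        map_add' := fun a b => mul_add _ _ _
        map_smul' := fun l v => by simp [hj, mul_assoc] }
    have hli : LinearIndependent L (fun i : s => T i) := by
      rw [linearIndependent_iff']
      intro t g hg i hi
      have := aux_indep (fun i : s => (i : Q)) hs t (fun i => j (g i)) (by
        intro v
        have := congrArg (fun φ : Q →ₗ[L] Q => φ v) hg
        simpa [T, hj, LinearMap.sum_apply] using this) i hi
      exact (map_eq_zero j).1 this
    simpa using hli.fintype_card_le_finrank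
  have : Module.Finite (Subring.center Q) Q := by
    rw [← Module.rank_lt_aleph0_iff]
    exact lt_of_le_of_lt hr (Cardinal.natCast_lt_aleph0)
  obtain ⟨s, hs⟩ := this.fg_top
  refine ⟨s, fun q => ?_⟩
  have hq : q ∈ Submodule.span (Subring.center Q) (s : Set Q) := by rw [hs]; trivial
  obtain ⟨f, hf⟩ := Submodule.mem_span_finset.1 hq
  refine ⟨fun x => f x, fun x _ => (f x).2, ?_⟩
  rw [← hf.2]; rfl
end

section
variable {K Q L : Type*} [Field K] [DivisionRing Q] [Algebra K Q] [Field L] [Module L Q] [Algebra K L]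
  [IsScalarTower K L Q]

/-- strict growth -/
theorem finite_of_stable (j : L →+* Q) (hj : ∀ (l : L) (q : Q), l • q = q * j l)
    (A : Subalgebra K Q) (V : Submodule K Q) (hVA : Algebra.adjoin K (V : Set Q) = A)
    (hQuot : ∀ q : Q, ∃ a ∈ A, ∃ b ∈ A, b ≠ 0 ∧ q = b⁻¹ * a)
    (N : Submodule L Q) (hN : N ≠ ⊥) (hNf : FiniteDimensional L N)
    (hV : ∀ v ∈ V, ∀ z ∈ N, v * z ∈ N) : FiniteDimensional L Q := by
  have hA : ∀ a ∈ A, ∀ z ∈ N, a * z ∈ N := by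
    intro a ha
    rw [← hVA] at ha
    induction ha using Algebra.adjoin_induction with
    | mem x hx => exact hV x hx
    | algebraMap r =>
      intro z hz
      rw [← Algebra.smul_def, ← algebraMap_smul L r z]
      exact N.smul_mem _ hz
    | add x y _ _ hx hy => intro z hz; rw [add_mul]; exact N.add_mem (hx z hz) (hy z hz)
    | mul x y _ _ hx hy => intro z hz; rw [mul_assoc]; exact hx _ (hy z hz)
  have hinv : ∀ b ∈ A, b ≠ 0 → ∀ z ∈ N, b⁻¹ * z ∈ N := by
    intro b hb hb0 z hz
    let T : N →ₗ[L] N :=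
      { toFun := fun v => ⟨b * v, hA b hb v v.2⟩
        map_add' := fun u v => by ext; simp [mul_add]
        map_smul' := fun l v => by ext; simp [hj, mul_assoc] }
    have hTi : Function.Injective T := by
      intro u v h
      have := congrArg Subtype.val h
      ext
      exact mul_left_cancel₀ hb0 this
    obtain ⟨w, hw⟩ := (LinearMap.injective_iff_surjective.1 hTi) ⟨z, hz⟩
    have : b * (w : Q) = z := congrArg Subtype.val hw
    rw [← this, inv_mul_cancel_left₀ hb0]
    exact w.2
  obtain ⟨x, hx, hx0⟩ := N.ne_bot_iff.1 hN
  have : N = ⊤ := by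
    rw [eq_top_iff]
    intro z _
    obtain ⟨a, ha, b, hb, hb0, h⟩ := hQuot (z * x⁻¹)
    have : z = b⁻¹ * (a * x) := by
      rw [← mul_assoc, ← h, inv_mul_cancel_right₀ hx0]
    rw [this]
    exact hinv b hb hb0 _ (hA a ha x hx)
  subst this
  exact Module.Finite.equiv (Submodule.topEquiv (R := L) (M := Q))
end
section
variable {K Q : Type*} [Field K] [DivisionRing Q] [Algebra K Q]

theorem petridis_step (W X Y : Submodule K Q) (hW : W.FG) (hX : X.FG) (hY : Y.FG) (κ : ℝ)
    (hmin : ∀ Z ≤ X, κ * Module.finrank K Z ≤ Module.finrank K ↥(Z * W))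
    (hXW : (Module.finrank K ↥(X * W) : ℝ) ≤ κ * Module.finrank K X)
    (hYW : (Module.finrank K ↥(Y * W) : ℝ) ≤ κ * Module.finrank K Y)
    (T : Q →ₗ[K] Q) (hT : Function.Injective T) (hTW : ∀ u, ∀ w ∈ W, T (u * w) = T u * w) :
    (Module.finrank K ↥((Y ⊔ X.map T) * W) : ℝ) ≤ κ * Module.finrank K ↥(Y ⊔ X.map T) := by
  have hmul : ∀ Z : Submodule K Q, Z.map T * W = (Z * W).map T := by
    intro Z
    apply le_antisymm
    · rw [Submodule.mul_le]
      rintro _ ⟨z, hz, rfl⟩ w hw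
      exact ⟨z * w, Submodule.mul_mem_mul hz hw, hTW z w hw⟩
    · rw [Submodule.map_le_iff_le_comap, Submodule.mul_le]
      intro z hz w hw
      rw [Submodule.mem_comap, hTW z w hw]
      exact Submodule.mul_mem_mul ⟨z, hz, rfl⟩ hw
  have hdim : ∀ Z : Submodule K Q, Module.finrank K (Z.map T) = Module.finrank K Z := fun Z =>
    (Submodule.equivMapOfInjective T hT Z).finrank_eq.symm
  set Z := X ⊓ Y.comap T with hZ
  have hinf : Y ⊓ X.map T = Z.map T := by
    apply le_antisymm
    · rintro _ ⟨h1, x, hx, rfl⟩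
      exact ⟨x, ⟨hx, h1⟩, rfl⟩
    · rintro _ ⟨x, ⟨hx, h1⟩, rfl⟩
      exact ⟨h1, x, hx, rfl⟩
  have : Module.Finite K X := Module.Finite.of_fg hX
  have : Module.Finite K Y := Module.Finite.of_fg hY
  have : Module.Finite K ↥(X * W) := Module.Finite.of_fg (hX.mul hW)
  have : Module.Finite K ↥(Y * W) := Module.Finite.of_fg (hY.mul hW)
  have e1 := Submodule.finrank_sup_add_finrank_inf_eq Y (X.map T)
  rw [hinf, hdim, hdim] at e1
  have e2 := Submodule.finrank_sup_add_finrank_inf_eq (Y * W) ((X * W).map T)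
  rw [hdim] at e2
  rw [Submodule.sup_mul, hmul]
  have h3 : (Z * W).map T ≤ Y * W ⊓ (X * W).map T := by
    refine le_inf ?_ (Submodule.map_mono (mul_le_mul_left inf_le_left W))
    rw [← hmul]
    exact mul_le_mul_left (by rw [← hinf]; exact inf_le_left) W
  have h4 := Submodule.finrank_mono h3
  rw [hdim] at h4
  have h5 := hmin Z inf_le_left
  have e1' : (Module.finrank K ↥(Y ⊔ X.map T) : ℝ) + Module.finrank K Z
      = Module.finrank K Y + Module.finrank K X := by exact_mod_cast e1
  have e2' : (Module.finrank K ↥(Y * W ⊔ (X * W).map T) : ℝ)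
      + Module.finrank K ↥(Y * W ⊓ (X * W).map T)
      = Module.finrank K ↥(Y * W) + Module.finrank K ↥(X * W) := by exact_mod_cast e2
  have h4' : (Module.finrank K ↥(Z * W) : ℝ) ≤ Module.finrank K ↥(Y * W ⊓ (X * W).map T) := by
    exact_mod_cast h4
  have : κ * Module.finrank K ↥(Y ⊔ X.map T) = κ * Module.finrank K Y + κ * Module.finrank K X
      - κ * Module.finrank K Z := by linear_combination κ * e1'
  rw [this]
  linarith

theorem petridis (W X : Submodule K Q) (hW : W.FG) (hX : X.FG) (κ : ℝ)
    (hmin : ∀ Z ≤ X, κ * Module.finrank K Z ≤ Module.finrank K ↥(Z * W))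
    (hXW : (Module.finrank K ↥(X * W) : ℝ) ≤ κ * Module.finrank K X)
    (C B : Submodule K Q) (hC : C.FG) (hB : B.FG)
    (hcomm : ∀ b ∈ B, ∀ w ∈ W, b * w = w * b) :
    (Module.finrank K ↥(C * X * B * W) : ℝ) ≤ κ * Module.finrank K ↥(C * X * B) := by
  classical
  obtain ⟨s, hs⟩ := hC
  obtain ⟨t, ht⟩ := hB
  let T : Q × Q → (Q →ₗ[K] Q) := fun p => LinearMap.mulLeft K p.1 ∘ₗ LinearMap.mulRight K p.2
  have hTapp : ∀ p u, T p u = p.1 * (u * p.2) := fun p u => rfl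
  have key : ∀ S : Finset (Q × Q), (∀ p ∈ S, p.2 ∈ B) →
      (S.sup fun p => X.map (T p)).FG ∧
      (Module.finrank K ↥((S.sup fun p => X.map (T p)) * W) : ℝ)
        ≤ κ * Module.finrank K ↥(S.sup fun p => X.map (T p)) := by
    intro S
    induction S using Finset.induction_on with
    | empty => intro _; rw [Finset.sup_empty, Submodule.bot_mul]; simp [Submodule.fg_bot]
    | insert p S hp ih =>
      intro hS
      obtain ⟨i1, i2⟩ := ih fun p hp => hS p (Finset.mem_insert_of_mem hp)
      have hpB := hS p (Finset.mem_insert_self _ _)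
      rw [Finset.sup_insert, sup_comm]
      refine ⟨i1.sup (hX.map _), ?_⟩
      by_cases h0 : p.1 = 0 ∨ p.2 = 0
      · have : X.map (T p) = ⊥ := by
          rw [eq_bot_iff]
          rintro _ ⟨u, _, rfl⟩
          rw [Submodule.mem_bot, hTapp]
          rcases h0 with h | h <;> simp [h]
        rw [this, sup_bot_eq]
        exact i2
      · push Not at h0
        refine petridis_step W X _ hW hX i1 κ hmin hXW i2 (T p) ?_ ?_
        · intro u v h
          rw [hTapp, hTapp] at h
          exact mul_right_cancel₀ h0.2 (mul_left_cancel₀ h0.1 h)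
        · intro u w hw
          rw [hTapp, hTapp, mul_assoc, mul_assoc, mul_assoc, hcomm _ hpB w hw]
  have heq : C * X * B = (s ×ˢ t).sup fun p => X.map (T p) := by
    apply le_antisymm
    · rw [← hs, ← ht]
      have hX' : X = Submodule.span K (X : Set Q) := (Submodule.span_eq X).symm
      conv_lhs => rw [hX']
      rw [Submodule.span_mul_span, Submodule.span_mul_span, Submodule.span_le]
      rintro _ ⟨_, ⟨a, ha, x, hx, rfl⟩, b, hb, rfl⟩
      have : X.map (T (a, b)) ≤ (s ×ˢ t).sup fun p => X.map (T p) :=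
        Finset.le_sup (f := fun p => X.map (T p)) (by simpa using ⟨ha, hb⟩)
      exact this ⟨x, hx, by simp [hTapp, mul_assoc]⟩
    · apply Finset.sup_le
      rintro ⟨a, b⟩ hab
      rw [Finset.mem_product] at hab
      rintro _ ⟨x, hx, rfl⟩
      rw [hTapp, ← mul_assoc]
      exact Submodule.mul_mem_mul (Submodule.mul_mem_mul (hs ▸ Submodule.subset_span hab.1) hx)
        (ht ▸ Submodule.subset_span hab.2)
  rw [heq]
  refine (key _ ?_).2
  rintro ⟨a, b⟩ hab
  rw [Finset.mem_product] at hab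
  exact ht ▸ Submodule.subset_span hab.2

theorem exists_min_ratio (W U : Submodule K Q) (hW : W.FG) (hU : U.FG) (hU0 : U ≠ ⊥) :
    ∃ X ≤ U, X ≠ ⊥ ∧ ∃ κ : ℝ, 0 ≤ κ ∧ (∀ Z ≤ X, κ * Module.finrank K Z ≤ Module.finrank K ↥(Z * W)) ∧
      (Module.finrank K ↥(X * W) : ℝ) ≤ κ * Module.finrank K X ∧
      κ * Module.finrank K U ≤ Module.finrank K ↥(U * W) := by
  have : Module.Finite K U := Module.Finite.of_fg hU
  have : Module.Finite K ↥(U * W) := Module.Finite.of_fg (hU.mul hW)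
  let P : Set (Submodule K Q) := {Z | Z ≤ U ∧ Z ≠ ⊥}
  let f : Submodule K Q → ℕ × ℕ := fun Z => (Module.finrank K ↥(Z * W), Module.finrank K Z)
  have hfin : (f '' P).Finite := by
    refine (Set.finite_Iic ((Module.finrank K ↥(U * W), Module.finrank K U) : ℕ × ℕ)).subset ?_
    rintro _ ⟨Z, hZ, rfl⟩
    exact ⟨Submodule.finrank_mono (mul_le_mul_left hZ.1 W), Submodule.finrank_mono hZ.1⟩
  obtain ⟨_, ⟨X, hX, rfl⟩, hmin⟩ := Set.exists_min_image (f '' P)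
    (fun p => (p.1 : ℝ) / p.2) hfin ⟨_, U, ⟨le_rfl, hU0⟩, rfl⟩
  have hpos : ∀ Z ∈ P, (0 : ℝ) < Module.finrank K Z := by
    intro Z hZ
    have := Submodule.finiteDimensional_of_le hZ.1
    have := Submodule.one_le_finrank_iff.2 hZ.2
    exact_mod_cast this
  have hall : ∀ Z ≤ U, ((Module.finrank K ↥(X * W) : ℝ) / Module.finrank K X) * Module.finrank K Z
      ≤ Module.finrank K ↥(Z * W) := by
    intro Z hZ
    by_cases h0 : Z = ⊥
    · subst h0; simp
    · have := hmin _ ⟨Z, ⟨hZ, h0⟩, rfl⟩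
      exact (le_div_iff₀ (hpos Z ⟨hZ, h0⟩)).1 this
  refine ⟨X, hX.1, hX.2, (Module.finrank K ↥(X * W) : ℝ) / Module.finrank K X, by positivity,
    fun Z hZ => hall Z (hZ.trans hX.1), ?_, hall U le_rfl⟩
  rw [div_mul_cancel₀ _ (hpos X hX).ne']

variable {L : Type*} [Field L] [Module L Q] [Algebra K L] [IsScalarTower K L Q]

theorem lower_bound (j : L →+* Q) (hj : ∀ (l : L) (q : Q), l • q = q * j l)
    (x y : L) (hxy : ∀ m : ℕ, LinearIndependent K (fun p : Fin (m+1) × Fin (m+1) =>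
      x ^ (p.1 : ℕ) * y ^ (p.2 : ℕ)))
    (W : Submodule K Q) (hW : W.FG) (h1 : (1 : Q) ∈ W) (hx : j x ∈ W) (hy : j y ∈ W)
    (Y : Submodule K Q) (hY : Y.FG) (m : ℕ) :
    FiniteDimensional L (Submodule.span L (Y : Set Q)) ∧
    (m + 1) ^ 2 * Module.finrank L (Submodule.span L (Y : Set Q))
      ≤ Module.finrank K ↥(Y * W ^ (2 * m)) := by
  classical
  have hfd : FiniteDimensional L (Submodule.span L (Y : Set Q)) := by
    obtain ⟨s, hs⟩ := hY
    rw [← hs, Submodule.span_span_of_tower]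
    exact FiniteDimensional.span_finset L s
  refine ⟨hfd, ?_⟩
  have : Module.Finite K ↥(Y * W ^ (2 * m)) := Module.Finite.of_fg (hY.mul (hW.pow _))
  obtain ⟨b, hbY, hbs, hbi⟩ := exists_linearIndependent L (Y : Set Q)
  rw [← hbs] at hfd ⊢
  have : Finite b := by
    have h1 := linearIndependent_span hbi
    rw [← Subtype.range_coe (s := b)] at hfd
    exact h1.finite
  have := Fintype.ofFinite b
  have hc : Module.finrank L (Submodule.span L b) = Fintype.card b := by
    have := finrank_span_eq_card hbi
    rwa [Subtype.range_coe] at this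
  have hli := linearIndependent_smul (hxy m) hbi
  have hle : Submodule.span K (Set.range fun p : (Fin (m+1) × Fin (m+1)) × b =>
      (x ^ (p.1.1 : ℕ) * y ^ (p.1.2 : ℕ)) • (p.2 : Q)) ≤ Y * W ^ (2 * m) := by
    rw [Submodule.span_le]
    rintro _ ⟨⟨⟨i, k⟩, v⟩, rfl⟩
    simp only [hj, map_mul, map_pow]
    refine Submodule.mul_mem_mul (hbY v.2) ?_
    have h1' : (1 : Submodule K Q) ≤ W := by rwa [Submodule.one_le]
    rw [two_mul, pow_add]
    refine Submodule.mul_mem_mul ?_ ?_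
    · exact pow_le_pow_right₀ h1' (Nat.lt_succ_iff.1 i.2) (Submodule.pow_mem_pow _ hx _)
    · exact pow_le_pow_right₀ h1' (Nat.lt_succ_iff.1 k.2) (Submodule.pow_mem_pow _ hy _)
  have := Submodule.finrank_mono hle
  rw [finrank_span_eq_card hli] at this
  rw [hc]
  simpa [sq, Fintype.card_prod] using this
end

theorem numeric (d : ℕ → ℝ) (hpos : ∀ n, 1 ≤ d n) (hmono : Monotone d) (c : ℕ) (hc : 1 ≤ c)
    (hd : ∀ n m k : ℕ, ((m : ℝ) + 1) ^ 2 * (k + 1) * d n ^ (2 * m) ≤ d (n + c) ^ (2 * m) * d (n + k))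
    (hgr : ∀ B : ℝ, ∀ᶠ n : ℕ in atTop, B * d n ≤ (n : ℝ) ^ 3) : False := by
  have hc' : (1 : ℝ) ≤ c := by exact_mod_cast hc
  obtain ⟨n0, hn0⟩ := eventually_atTop.1 (hgr (256 * 27 * c ^ 2))
  have h16 : ∀ t : ℕ, n0 + 1 ≤ t → 16 * d (c * t) ≤ d (2 * (c * t)) := by
    intro t ht
    have ht0 : 0 < t := by omega
    have hG : 256 * d (3 * (c * t)) ≤ (t : ℝ) ^ 2 * (c * t) := by
      have h := hn0 (3 * (c * t)) (by nlinarith)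
      push_cast at h
      have : (256 * d (3 * (c * t))) * (27 * (c : ℝ) ^ 2) ≤ ((t : ℝ) ^ 2 * (c * t)) * (27 * (c : ℝ) ^ 2) := by
        calc _ = 256 * 27 * (c : ℝ) ^ 2 * d (3 * (c * t)) := by ring
          _ ≤ _ := h
          _ = _ := by ring
      exact le_of_mul_le_mul_right this (by positivity)
    have hstep : ∀ i < t, 256 * d (c * t + c * i) ^ (2 * t) ≤ d (c * t + c * (i + 1)) ^ (2 * t) := by
      intro i hi
      have h := hd (c * t + c * i) t (c * t)
      have hle : d (c * t + c * i + c * t) ≤ d (3 * (c * t)) := hmono (by nlinarith)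
      have e : c * t + c * (i + 1) = c * t + c * i + c := by ring
      rw [e]
      set D := d (3 * (c * t))
      have hD : 1 ≤ D := hpos _
      have hp1 : 0 ≤ d (c * t + c * i + c) ^ (2 * t) := pow_nonneg (by linarith [hpos (c * t + c * i + c)]) _
      have hp2 : 0 ≤ d (c * t + c * i) ^ (2 * t) := pow_nonneg (by linarith [hpos (c * t + c * i)]) _
      have h2 : 256 * D ≤ ((t : ℝ) + 1) ^ 2 * ((c * t : ℕ) + 1) := by
        refine hG.trans ?_
        push_cast
        gcongr <;> linarith
      have h3 : (256 * d (c * t + c * i) ^ (2 * t)) * D ≤ d (c * t + c * i + c) ^ (2 * t) * D := by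
        calc _ = 256 * D * d (c * t + c * i) ^ (2 * t) := by ring
          _ ≤ ((t : ℝ) + 1) ^ 2 * ((c * t : ℕ) + 1) * d (c * t + c * i) ^ (2 * t) := by gcongr
          _ ≤ _ := h
          _ ≤ _ := by gcongr
      exact le_of_mul_le_mul_right h3 (by linarith)
    have hind : ∀ i ≤ t, 256 ^ i * d (c * t) ^ (2 * t) ≤ d (c * t + c * i) ^ (2 * t) := by
      intro i
      induction i with
      | zero => simp
      | succ i ih =>
        intro hi
        have a := ih (by omega)
        have b := hstep i (by omega)
        calc _ = 256 * (256 ^ i * d (c * t) ^ (2 * t)) := by ring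
          _ ≤ 256 * d (c * t + c * i) ^ (2 * t) := by gcongr
          _ ≤ _ := b
    have h := hind t le_rfl
    have e : (256 : ℝ) ^ t * d (c * t) ^ (2 * t) = (16 * d (c * t)) ^ (2 * t) := by
      rw [mul_pow, pow_mul 16]; norm_num
    rw [e, ← two_mul] at h
    exact le_of_pow_le_pow_left₀ (by omega) (by linarith [hpos (2 * (c * t))]) h
  have hiter : ∀ i : ℕ, (16 : ℝ) ^ i ≤ d (c * ((n0 + 1) * 2 ^ i)) := by
    intro i
    induction i with
    | zero => simpa using hpos _
    | succ i ih =>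
      have := h16 ((n0 + 1) * 2 ^ i) (Nat.le_mul_of_pos_right _ (by positivity))
      have e : c * ((n0 + 1) * 2 ^ (i + 1)) = 2 * (c * ((n0 + 1) * 2 ^ i)) := by ring
      rw [e, pow_succ]
      linarith
  obtain ⟨n1, hn1⟩ := eventually_atTop.1 (hgr 1)
  obtain ⟨i, hi⟩ := pow_unbounded_of_one_lt (max (n1 : ℝ) ((c * (n0 + 1) : ℝ) ^ 3)) (one_lt_two)
  have hin1 : n1 ≤ c * ((n0 + 1) * 2 ^ i) := by
    have : (n1 : ℝ) < 2 ^ i := lt_of_le_of_lt (le_max_left _ _) hi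
    have : n1 < 2 ^ i := by exact_mod_cast this
    nlinarith [Nat.zero_le n0, Nat.zero_le (n0 * 2 ^ i), Nat.mul_le_mul hc (Nat.le_mul_of_pos_left (2 ^ i) (Nat.succ_pos n0))]
  have h1 := hn1 _ hin1
  have h2 := hiter i
  push_cast at h1
  have h3 : (16 : ℝ) ^ i ≤ (c * (n0 + 1)) ^ 3 * 8 ^ i := by
    calc _ ≤ _ := h2
      _ ≤ _ := by simpa using h1
      _ = (c * (n0 + 1) : ℝ) ^ 3 * (2 ^ i) ^ 3 := by ring
      _ = _ := by rw [← pow_mul, mul_comm i 3, pow_mul]; norm_num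
  have h4 : (16 : ℝ) ^ i = 2 ^ i * 8 ^ i := by rw [← mul_pow]; norm_num
  rw [h4] at h3
  have h5 := le_of_mul_le_mul_right h3 (by positivity)
  linarith [le_max_right (n1 : ℝ) ((c * (n0 + 1) : ℝ) ^ 3)]

section
variable {K Q L : Type*} [Field K] [DivisionRing Q] [Algebra K Q] [Field L] [Module L Q]
  [Algebra K L] [IsScalarTower K L Q]

theorem mono_indep (x y : L)
    (hind : ∀ P : MvPolynomial (Fin 2) K, MvPolynomial.aeval ![x, y] P = 0 → P = 0) (m : ℕ) :
    LinearIndependent K (fun p : Fin (m+1) × Fin (m+1) => x ^ (p.1 : ℕ) * y ^ (p.2 : ℕ)) := by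
  classical
  rw [Fintype.linearIndependent_iff]
  intro g hg p
  let e : Fin (m+1) × Fin (m+1) → (Fin 2 →₀ ℕ) := fun p =>
    Finsupp.equivFunOnFinite.symm ![(p.1 : ℕ), (p.2 : ℕ)]
  have he : Function.Injective e := by
    intro p q h
    have h0 := DFunLike.congr_fun h 0
    have h1 := DFunLike.congr_fun h 1
    simp [e] at h0 h1
    exact Prod.ext (Fin.ext h0) (Fin.ext h1)
  have hP := hind (∑ p, MvPolynomial.monomial (e p) (g p)) (by
    rw [map_sum, ← hg]
    refine Finset.sum_congr rfl fun p _ => ?_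
    rw [MvPolynomial.aeval_monomial, Algebra.smul_def, Finsupp.prod_fintype _ _ (by simp)]
    simp [e, Fin.prod_univ_two])
  have := congrArg (MvPolynomial.coeff (e p)) hP
  simpa [MvPolynomial.coeff_sum, MvPolynomial.coeff_monomial, he.eq_iff] using this

theorem mem_pow_of_mem_adjoin (V : Submodule K Q) (h1V : (1 : Q) ∈ V) (a : Q)
    (ha : a ∈ Algebra.adjoin K (V : Set Q)) : ∃ n, a ∈ V ^ n := by
  have h1' : (1 : Submodule K Q) ≤ V := by rwa [Submodule.one_le]
  induction ha using Algebra.adjoin_induction with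
  | mem x hx => exact ⟨1, by simpa using hx⟩
  | algebraMap r => exact ⟨0, by rw [pow_zero]; exact Submodule.algebraMap_mem r⟩
  | add x y _ _ hx hy =>
    obtain ⟨n, hn⟩ := hx
    obtain ⟨k, hk⟩ := hy
    exact ⟨n + k, (V ^ (n + k)).add_mem (pow_le_pow_right₀ h1' (by omega) hn)
      (pow_le_pow_right₀ h1' (by omega) hk)⟩
  | mul x y _ _ hx hy =>
    obtain ⟨n, hn⟩ := hx
    obtain ⟨k, hk⟩ := hy
    exact ⟨n + k, by rw [pow_add]; exact Submodule.mul_mem_mul hn hk⟩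

theorem span_growth (j : L →+* Q) (hj : ∀ (l : L) (q : Q), l • q = q * j l)
    (A : Subalgebra K Q) (V : Submodule K Q) (hV : V.FG) (h1V : (1 : Q) ∈ V)
    (hVA : Algebra.adjoin K (V : Set Q) = A)
    (hQuot : ∀ q : Q, ∃ a ∈ A, ∃ b ∈ A, b ≠ 0 ∧ q = b⁻¹ * a)
    (hinf : ¬ FiniteDimensional L Q) (X : Submodule K Q) (hX : X.FG) (hX0 : X ≠ ⊥) (k : ℕ) :
    k + 1 ≤ Module.finrank L (Submodule.span L ((V ^ k * X : Submodule K Q) : Set Q)) := by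
  have h1' : (1 : Submodule K Q) ≤ V := by rwa [Submodule.one_le]
  have hfd : ∀ k, FiniteDimensional L
      (Submodule.span L ((V ^ k * X : Submodule K Q) : Set Q)) := by
    intro k
    obtain ⟨s, hs⟩ := (hV.pow k).mul hX
    rw [← hs, Submodule.span_span_of_tower]
    exact FiniteDimensional.span_finset L s
  have hsub : ∀ k, X ≤ V ^ k * X := by
    intro k
    calc X = 1 * X := (one_mul X).symm
      _ ≤ V ^ k * X := mul_le_mul_left (one_le_pow_of_one_le' h1' k) X
  have hne : ∀ k, Submodule.span L ((V ^ k * X : Submodule K Q) : Set Q) ≠ ⊥ := by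
    intro k
    obtain ⟨x, hx, hx0⟩ := X.ne_bot_iff.1 hX0
    exact (Submodule.ne_bot_iff _).2 ⟨x, Submodule.subset_span (hsub k hx), hx0⟩
  induction k with
  | zero =>
    have := hfd 0
    simpa using Submodule.one_le_finrank_iff.2 (hne 0)
  | succ k ih =>
    have := hfd (k + 1)
    have hle : Submodule.span L ((V ^ k * X : Submodule K Q) : Set Q)
        ≤ Submodule.span L ((V ^ (k + 1) * X : Submodule K Q) : Set Q) :=
      Submodule.span_mono (mul_le_mul_left (pow_le_pow_right₀ h1' (Nat.le_succ k)) X)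
    have hlt := lt_of_le_of_ne hle (by
      intro heq
      refine hinf (finite_of_stable j hj A V hVA hQuot _ (hne k) (hfd k) ?_)
      intro v hv z hz
      rw [heq]
      induction hz using Submodule.span_induction with
      | mem z hz =>
        refine Submodule.subset_span ?_
        rw [pow_succ', mul_assoc]
        exact Submodule.mul_mem_mul hv hz
      | zero => simp
      | add a b _ _ ha hb => rw [mul_add]; exact Submodule.add_mem _ ha hb
      | smul l a _ ha =>
        have : v * l • a = l • (v * a) := by simp [hj, mul_assoc]
        rw [this]; exact Submodule.smul_mem _ _ ha)
    have := Submodule.finrank_lt_finrank_of_lt hlt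
    omega

theorem main_ineq (j : L →+* Q) (hj : ∀ (l : L) (q : Q), l • q = q * j l)
    (A : Subalgebra K Q) (V : Submodule K Q) (hV : V.FG) (h1V : (1 : Q) ∈ V)
    (hVA : Algebra.adjoin K (V : Set Q) = A)
    (hQuot : ∀ q : Q, ∃ a ∈ A, ∃ b ∈ A, b ≠ 0 ∧ q = b⁻¹ * a)
    (x y : L)
    (hind : ∀ P : MvPolynomial (Fin 2) K, MvPolynomial.aeval ![x, y] P = 0 → P = 0)
    (hinf : ¬ FiniteDimensional L Q) :
    ∃ c : ℕ, 1 ≤ c ∧ ∀ n m k : ℕ, ((m : ℝ) + 1) ^ 2 * (k + 1) * (Module.finrank K ↥(V ^ n) : ℝ) ^ (2 * m)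
      ≤ (Module.finrank K ↥(V ^ (n + c)) : ℝ) ^ (2 * m) * Module.finrank K ↥(V ^ (n + k)) := by
  classical
  have h1' : (1 : Submodule K Q) ≤ V := by rwa [Submodule.one_le]
  -- common left denominator
  obtain ⟨q, hqA, hq0, hqx, hqy⟩ : ∃ q ∈ A, q ≠ 0 ∧ q * j x ∈ A ∧ q * j y ∈ A := by
    obtain ⟨a1, ha1, b1, hb1, hb10, e1⟩ := hQuot (j x)
    obtain ⟨a2, ha2, b2, hb2, hb20, e2⟩ := hQuot (j y)
    obtain ⟨a, ha, b, hb, hb0, e⟩ := hQuot (b2 * b1⁻¹)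
    have e' : b * b2 = a * b1 := by
      have : b2 = b⁻¹ * a * b1 := by rw [← e, inv_mul_cancel_right₀ hb10]
      rw [this, mul_assoc, mul_inv_cancel_left₀ hb0]
    refine ⟨b * b2, A.mul_mem hb hb2, mul_ne_zero hb0 hb20, ?_, ?_⟩
    · rw [e', e1, mul_assoc, mul_inv_cancel_left₀ hb10]
      exact A.mul_mem ha ha1
    · rw [e2, mul_assoc, mul_inv_cancel_left₀ hb20]
      exact A.mul_mem hb ha2
  rw [← hVA] at hqA hqx hqy
  obtain ⟨c0, hc0⟩ := mem_pow_of_mem_adjoin V h1V _ hqA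
  obtain ⟨c1, hc1⟩ := mem_pow_of_mem_adjoin V h1V _ hqx
  obtain ⟨c2, hc2⟩ := mem_pow_of_mem_adjoin V h1V _ hqy
  set c := c0 + c1 + c2 + 1 with hc
  refine ⟨c, by omega, fun n m k => ?_⟩
  set W : Submodule K Q := Submodule.span K (({1, j x, j y} : Finset Q) : Set Q) with hWdef
  have hW : W.FG := ⟨_, rfl⟩
  have hW1 : (1 : Q) ∈ W := Submodule.subset_span (by simp)
  have hWx : j x ∈ W := Submodule.subset_span (by simp)
  have hWy : j y ∈ W := Submodule.subset_span (by simp)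
  have hjK : ∀ r : K, j (algebraMap K L r) = algebraMap K Q r := by
    intro r
    have := hj (algebraMap K L r) 1
    rw [one_mul, algebraMap_smul, Algebra.smul_def, mul_one] at this
    exact this.symm
  have hWr : ∀ i, ∀ w ∈ W ^ i, ∃ l, j l = w := by
    intro i w hw
    induction hw using Submodule.pow_induction_on_left' with
    | algebraMap r => exact ⟨_, hjK r⟩
    | add a b i _ _ ha hb =>
      obtain ⟨l, rfl⟩ := ha
      obtain ⟨l', rfl⟩ := hb
      exact ⟨l + l', map_add _ _ _⟩
    | mem_mul w hw i a _ ha =>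
      obtain ⟨l, rfl⟩ := ha
      have : ∃ l', j l' = w := by
        induction hw using Submodule.span_induction with
        | mem z hz =>
          simp only [Finset.coe_insert, Finset.coe_singleton, Set.mem_insert_iff,
            Set.mem_singleton_iff] at hz
          rcases hz with rfl | rfl | rfl
          · exact ⟨1, map_one _⟩
          · exact ⟨x, rfl⟩
          · exact ⟨y, rfl⟩
        | zero => exact ⟨0, map_zero _⟩
        | add a b _ _ ha hb =>
          obtain ⟨l, rfl⟩ := ha
          obtain ⟨l', rfl⟩ := hb
          exact ⟨l + l', map_add _ _ _⟩
        | smul r a _ ha =>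
          obtain ⟨l, rfl⟩ := ha
          exact ⟨algebraMap K L r * l, by rw [map_mul, hjK, Algebra.smul_def]⟩
      obtain ⟨l', rfl⟩ := this
      exact ⟨l' * l, map_mul _ _ _⟩
  have hcomm : ∀ i, ∀ b ∈ W ^ i, ∀ w ∈ W, b * w = w * b := by
    intro i b hb w hw
    obtain ⟨l, rfl⟩ := hWr i b hb
    obtain ⟨l', rfl⟩ := hWr 1 w (by simpa using hw)
    rw [← map_mul, ← map_mul, mul_comm]
  -- the space U = V^n q
  set R : Q →ₗ[K] Q := LinearMap.mulRight K q with hR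
  have hRinj : Function.Injective R := fun u v h => mul_right_cancel₀ hq0 h
  have hRdim : ∀ Z : Submodule K Q, Module.finrank K (Z.map R) = Module.finrank K Z := fun Z =>
    (Submodule.equivMapOfInjective R hRinj Z).finrank_eq.symm
  have hVf : ∀ n, Module.Finite K ↥(V ^ n) := fun n => Module.Finite.of_fg (hV.pow n)
  have hVpos : ∀ n, (0 : ℝ) < Module.finrank K ↥(V ^ n) := by
    intro n
    have := hVf n
    have h : V ^ n ≠ ⊥ := (Submodule.ne_bot_iff _).2
      ⟨1, Submodule.one_le.1 (one_le_pow_of_one_le' h1' n), one_ne_zero⟩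
    have := Submodule.one_le_finrank_iff.2 h
    exact_mod_cast this
  set U := (V ^ n).map R with hU
  have hUfg : U.FG := (hV.pow n).map _
  have hU0 : U ≠ ⊥ := by
    intro h
    have h1 := hRdim (V ^ n)
    rw [← hU, h, finrank_bot] at h1
    have h2 := hVpos n
    rw [← h1] at h2
    simp at h2
  have hqW : ∀ w ∈ W, q * w ∈ V ^ c := by
    intro w hw
    have : W ≤ (V ^ c).comap (LinearMap.mulLeft K q) := by
      rw [hWdef, Submodule.span_le]
      intro z hz
      simp only [Finset.coe_insert, Finset.coe_singleton, Set.mem_insert_iff,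
        Set.mem_singleton_iff] at hz
      rcases hz with rfl | rfl | rfl
      · simpa using pow_le_pow_right₀ h1' (by omega : c0 ≤ c) hc0
      · exact pow_le_pow_right₀ h1' (by omega : c1 ≤ c) hc1
      · exact pow_le_pow_right₀ h1' (by omega : c2 ≤ c) hc2
    exact this hw
  have hUW : U * W ≤ V ^ (n + c) := by
    rw [Submodule.mul_le]
    rintro _ ⟨v, hv, rfl⟩ w hw
    change v * q * w ∈ _
    rw [mul_assoc, pow_add]
    exact Submodule.mul_mem_mul hv (hqW w hw)
  obtain ⟨X, hXU, hX0, κ, hκ, hmin, hXW, hκU⟩ := exists_min_ratio W U hW hUfg hU0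
  have hX : X.FG := by
    have : Module.Finite K U := Module.Finite.of_fg hUfg
    have := Submodule.finiteDimensional_of_le hXU
    exact (Submodule.fg_iff_finiteDimensional X).2 this
  have hκ' : κ * Module.finrank K ↥(V ^ n) ≤ Module.finrank K ↥(V ^ (n + c)) := by
    have := hVf (n + c)
    have h1 := Submodule.finrank_mono hUW
    rw [hU, hRdim, ← hU] at hκU
    exact hκU.trans (by exact_mod_cast h1)
  have hit : ∀ i, (Module.finrank K ↥(V ^ k * X * W ^ i) : ℝ)
      ≤ κ ^ i * Module.finrank K ↥(V ^ k * X) := by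
    intro i
    induction i with
    | zero => rw [pow_zero, pow_zero, mul_one, one_mul]
    | succ i ih =>
      have := petridis W X hW hX κ hmin hXW (V ^ k) (W ^ i) (hV.pow k) (hW.pow i) (hcomm i)
      rw [pow_succ, ← mul_assoc]
      calc _ ≤ _ := this
        _ ≤ κ * (κ ^ i * Module.finrank K ↥(V ^ k * X)) := by gcongr
        _ = _ := by ring
  have hlow := (lower_bound j hj x y (mono_indep x y hind) W hW hW1 hWx hWy (V ^ k * X)
    ((hV.pow k).mul hX) m).2
  have hgrow := span_growth j hj A V hV h1V hVA hQuot hinf X hX hX0 k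
  have hVX : (Module.finrank K ↥(V ^ k * X) : ℝ) ≤ Module.finrank K ↥(V ^ (n + k)) := by
    have hle : V ^ k * X ≤ (V ^ (n + k)).map R := by
      rw [Submodule.mul_le]
      intro v hv z hz
      obtain ⟨u, hu, rfl⟩ := hXU hz
      refine ⟨v * u, ?_, by simp [hR, mul_assoc]⟩
      rw [add_comm n k, pow_add]
      exact Submodule.mul_mem_mul hv hu
    have := hVf (n + k)
    have h := Submodule.finrank_mono hle
    rw [hRdim] at h
    exact_mod_cast h
  have hlow' : ((m : ℝ) + 1) ^ 2 * (k + 1) ≤ Module.finrank K ↥(V ^ k * X * W ^ (2 * m)) := by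
    have : (m + 1) ^ 2 * (k + 1) ≤ Module.finrank K ↥(V ^ k * X * W ^ (2 * m)) :=
      (Nat.mul_le_mul_left _ hgrow).trans hlow
    exact_mod_cast this
  have hpn := (hVpos n).le
  calc ((m : ℝ) + 1) ^ 2 * (k + 1) * (Module.finrank K ↥(V ^ n) : ℝ) ^ (2 * m)
      ≤ (κ ^ (2 * m) * Module.finrank K ↥(V ^ (n + k))) * (Module.finrank K ↥(V ^ n) : ℝ) ^ (2 * m) := by
        refine mul_le_mul_of_nonneg_right ?_ (by positivity)
        exact hlow'.trans ((hit _).trans (mul_le_mul_of_nonneg_left hVX (by positivity)))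
    _ = (κ * Module.finrank K ↥(V ^ n)) ^ (2 * m) * Module.finrank K ↥(V ^ (n + k)) := by ring
    _ ≤ _ := by gcongr

end

theorem growth_of_gk {K Q : Type*} [Field K] [DivisionRing Q] [Algebra K Q] (V : Submodule K Q)
    (hpos : ∀ n, (1 : ℝ) ≤ Module.finrank K ↥(V ^ n)) (h : gkWrt K V < 3) (B : ℝ) :
    ∀ᶠ n : ℕ in atTop, B * (Module.finrank K ↥(V ^ n) : ℝ) ≤ (n : ℝ) ^ 3 := by
  obtain ⟨a, ha, ha3⟩ := EReal.lt_iff_exists_real_btwn.1 h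
  have ha3' : a < 3 := EReal.coe_lt_coe_iff.1 ha3
  have h1 := eventually_lt_of_limsup_lt ha
  have h2 : ∀ᶠ n : ℕ in atTop, B ≤ (n : ℝ) ^ (3 - a) :=
    ((tendsto_rpow_atTop (by linarith : 0 < 3 - a)).comp tendsto_natCast_atTop_atTop).eventually_ge_atTop B
  filter_upwards [h1, h2, eventually_gt_atTop 1] with n h1 h2 hn
  have hn' : (1 : ℝ) < n := by exact_mod_cast hn
  have hlog : 0 < Real.log n := Real.log_pos hn'
  have h1' : Real.log (Module.finrank K ↥(V ^ n)) / Real.log n < a := by exact_mod_cast h1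
  rw [div_lt_iff₀ hlog] at h1'
  have hd : (Module.finrank K ↥(V ^ n) : ℝ) ≤ (n : ℝ) ^ a := by
    rw [← Real.log_le_log_iff (by linarith [hpos n]) (by positivity), Real.log_rpow (by linarith)]
    exact h1'.le
  have h0 := hpos n
  calc B * (Module.finrank K ↥(V ^ n) : ℝ) ≤ (n : ℝ) ^ (3 - a) * (n : ℝ) ^ a :=
        mul_le_mul h2 hd (by linarith) (by positivity)
    _ = (n : ℝ) ^ (3 : ℝ) := by rw [← Real.rpow_add (by linarith)]; congr 1; ring
    _ = _ := by norm_cast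

theorem abstract_main {K Q L : Type*} [Field K] [DivisionRing Q] [Algebra K Q] [Field L]
    [Module L Q] [Algebra K L] [IsScalarTower K L Q]
    (j : L →+* Q) (hj : ∀ (l : L) (q : Q), l • q = q * j l)
    (A : Subalgebra K Q) (V : Submodule K Q) (hV : V.FG) (h1V : (1 : Q) ∈ V)
    (hVA : Algebra.adjoin K (V : Set Q) = A) (hGKA : gkWrt K V < 3)
    (hQuot : ∀ q : Q, ∃ a ∈ A, ∃ b ∈ A, b ≠ 0 ∧ q = b⁻¹ * a)
    (x y : L)
    (hind : ∀ P : MvPolynomial (Fin 2) K, MvPolynomial.aeval ![x, y] P = 0 → P = 0) :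
    FiniteDimensional L Q := by
  by_contra hinf
  have h1' : (1 : Submodule K Q) ≤ V := by rwa [Submodule.one_le]
  have hVf : ∀ n, Module.Finite K ↥(V ^ n) := fun n => Module.Finite.of_fg (hV.pow n)
  have hpos : ∀ n, (1 : ℝ) ≤ Module.finrank K ↥(V ^ n) := by
    intro n
    have := hVf n
    have h : V ^ n ≠ ⊥ := (Submodule.ne_bot_iff _).2
      ⟨1, Submodule.one_le.1 (one_le_pow_of_one_le' h1' n), one_ne_zero⟩
    have := Submodule.one_le_finrank_iff.2 h
    exact_mod_cast this
  obtain ⟨c, hc, hd⟩ := main_ineq j hj A V hV h1V hVA hQuot x y hind hinf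
  refine numeric (fun n => (Module.finrank K ↥(V ^ n) : ℝ)) hpos ?_ c hc hd
    (growth_of_gk V hpos hGKA)
  intro n k hnk
  have := hVf k
  have h := Submodule.finrank_mono (pow_le_pow_right₀ h1' hnk)
  exact Nat.cast_le.2 h

/-- Part of Theorem 3: if `A` is a finitely generated domain of GK dimension `< 3` over
an algebraically closed field `K` and the quotient division algebra `Q = Q(A)` contains
a subfield `F ⊇ K` of transcendence degree at least `2` over `K`, then `Q` is
finite-dimensional over its centre. -/
theorem stmt11 {K Q : Type*} [Field K] [IsAlgClosed K] [DivisionRing Q] [Algebra K Q]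
    (A : Subalgebra K Q)
    (V : Submodule K Q) (hVfin : FiniteDimensional K ↥V) (h1V : (1 : Q) ∈ V)
    (hVA : Algebra.adjoin K (V : Set Q) = A)
    (hGKA : gkWrt K V < 3)
    (hQuot : ∀ q : Q, ∃ a ∈ A, ∃ b ∈ A, b ≠ 0 ∧ q = b⁻¹ * a)
    -- `F` is a subfield of `Q` containing `K`:
    (F : Subring Q) (hFK : ∀ c : K, algebraMap K Q c ∈ F)
    (hFinv : ∀ x ∈ F, x⁻¹ ∈ F)
    (hFcomm : ∀ x ∈ F, ∀ y ∈ F, x * y = y * x)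
    -- of transcendence degree at least 2 over `K`: it contains two algebraically
    -- independent elements
    (htr : ∃ x ∈ F, ∃ y ∈ F, ∀ p : MvPolynomial (Fin 2) K,
      (∑ m ∈ p.support, algebraMap K Q (MvPolynomial.coeff m p) * x ^ m 0 * y ^ m 1) = 0 →
        p = 0) :
    -- then `Q` is finite-dimensional over its centre:
    ∃ s : Finset Q, ∀ q : Q, ∃ c : Q → Q,
      (∀ x ∈ s, c x ∈ Subring.center Q) ∧ q = ∑ x ∈ s, c x * x := by
  classical
  obtain ⟨x, hx, y, hy, hxy⟩ := htr
  let instF : Field F :=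
    { (inferInstance : Ring F) with
      mul_comm := fun a b => Subtype.ext (hFcomm a a.2 b b.2)
      inv := fun a => ⟨(a : Q)⁻¹, hFinv a a.2⟩
      exists_pair_ne := ⟨0, 1, fun h => zero_ne_one (congrArg Subtype.val h)⟩
      mul_inv_cancel := fun a ha => Subtype.ext
        (mul_inv_cancel₀ (fun h => ha (Subtype.ext h)))
      inv_zero := Subtype.ext inv_zero
      nnqsmul := _
      nnqsmul_def := fun _ _ => rfl
      qsmul := _
      qsmul_def := fun _ _ => rfl }
  let j : F →+* Q := F.subtype
  let instM : Module F Q :=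
    { smul := fun l q => q * (l : Q)
      one_smul := fun q => mul_one q
      mul_smul := fun a b q => by
        change q * ((a : Q) * (b : Q)) = q * (b : Q) * (a : Q)
        rw [hFcomm a a.2 b b.2, mul_assoc]
      smul_zero := fun a => zero_mul _
      smul_add := fun a q r => add_mul _ _ _
      add_smul := fun a b q => mul_add _ _ _
      zero_smul := fun q => mul_zero q }
  let instA : Algebra K F := ((algebraMap K Q).codRestrict F hFK).toAlgebra
  have hj : ∀ (l : F) (q : Q), @HSMul.hSMul F Q Q (@instHSMul F Q instM.toSMul) l q = q * j l :=
    fun _ _ => rfl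
  have tow : @IsScalarTower K F Q instA.toSMul instM.toSMul _ :=
    @IsScalarTower.mk K F Q instA.toSMul instM.toSMul _ (by
      intro r l q
      change q * (algebraMap K Q r * (l : Q)) = r • (q * (l : Q))
      rw [Algebra.smul_def, ← mul_assoc, ← Algebra.commutes r q, mul_assoc])
  refine @finite_center Q _ F instF instM j hj ?_
  refine @abstract_main K Q F _ _ _ instF instM instA tow j hj A V
    ((Submodule.fg_iff_finiteDimensional V).2 hVfin) h1V hVA hGKA hQuot ⟨x, hx⟩ ⟨y, hy⟩ ?_
  intro P hP
  apply hxy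
  have h := congrArg j hP
  rw [MvPolynomial.aeval_def, MvPolynomial.eval₂_eq', map_sum, map_zero] at h
  rw [← h]
  refine Finset.sum_congr rfl fun d _ => ?_
  rw [map_mul, Fin.prod_univ_two, map_mul, map_pow, map_pow, mul_assoc]
  rfl
end

section
/- Let $K$ be an algebraically closed field and let $D_0$ be a division algebra over $K$ of GK dimension $1$ that is finitely generated as a division algebra. Then $D_0$ is commutative. -/
open Filter

/-- The GK dimension of a division algebra `D` over `K`: the supremum of GK growth
exponents over finite-dimensional subspaces `V` with `1 ∈ V`. -/
noncomputable def gkDim (K : Type*) (Q : Type*) [Field K] [Ring Q] [Algebra K Q] : EReal :=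
  sSup { x : EReal | ∃ V : Submodule K Q, FiniteDimensional K ↥V ∧ (1 : Q) ∈ V ∧
    x = gkWrt K V }

section TsenTheorem

open MvPolynomial


theorem ts_height {K σ : Type*} [Field K] [IsAlgClosed K] [Finite σ] :
    (vanishingIdeal K {(0 : σ → K)}).height = Nat.card σ := by
  have hd : ringKrullDim (MvPolynomial σ K) = Nat.card σ := by
    rw [MvPolynomial.ringKrullDim_of_isNoetherianRing]; simp
  have : FiniteRingKrullDim (MvPolynomial σ K) := by
    rw [finiteRingKrullDim_iff_ne_bot_and_top, hd]
    exact ⟨WithBot.natCast_ne_bot _, by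
      have h1 : ((Nat.card σ : ℕ∞)) ≠ ⊤ := ENat.natCast_ne_top _
      intro h; apply h1; exact WithBot.coe_injective h⟩
  obtain ⟨p, hp, hpd⟩ := Ideal.exists_isMaximal_height (R := MvPolynomial σ K)
  obtain ⟨x, rfl⟩ := (isMaximal_iff_eq_vanishingIdeal_singleton).1 hp
  let e : MvPolynomial σ K ≃ₐ[K] MvPolynomial σ K :=
    AlgEquiv.ofAlgHom (aeval fun i => X i + C (x i)) (aeval fun i => X i - C (x i))
      (by ext i; simp) (by ext i; simp)
  have hc : (vanishingIdeal K {(0 : σ → K)}).comap e.toRingEquiv = vanishingIdeal K {x} := by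
    ext p
    simp only [Ideal.mem_comap, mem_vanishingIdeal_singleton_iff]
    have : (aeval (0 : σ → K)) (e p) = aeval x p := by
      have : ((aeval (0 : σ → K)).comp e.toAlgHom) = (aeval x : MvPolynomial σ K →ₐ[K] K) := by
        ext i; simp [e]
      exact DFunLike.congr_fun this p
    show aeval (0 : σ → K) (e p) = 0 ↔ _
    rw [this]
  have := e.toRingEquiv.height_comap (vanishingIdeal K {(0 : σ → K)})
  rw [hc] at this
  rw [← this]
  rw [hd] at hpd
  exact_mod_cast hpd

theorem ts_proj {K σ ι : Type*} [Field K] [IsAlgClosed K] [Finite σ] [Finite ι]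
    (G : ι → MvPolynomial σ K) (h0 : ∀ i, eval 0 (G i) = 0)
    (hc : Nat.card ι < Nat.card σ) : ∃ x : σ → K, x ≠ 0 ∧ ∀ i, eval x (G i) = 0 := by
  by_contra! hne
  have hz : zeroLocus K (Ideal.span (Set.range G)) = {(0 : σ → K)} := by
    ext x
    rw [zeroLocus_span]
    constructor
    · intro hx
      by_contra hx0
      obtain ⟨i, hi⟩ := hne x hx0
      exact hi (by simpa using hx (G i) ⟨i, rfl⟩)
    · rintro rfl p ⟨i, rfl⟩
      simpa [aeval_eq_eval] using h0 i
  have hr := vanishingIdeal_zeroLocus_eq_radical (K := K) (Ideal.span (Set.range G))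
  rw [hz] at hr
  have hm : (vanishingIdeal K {(0 : σ → K)}).IsMaximal :=
    isMaximal_iff_eq_vanishingIdeal_singleton.2 ⟨0, rfl⟩
  have hmin : vanishingIdeal K {(0 : σ → K)} ∈ (Ideal.span (Set.range G)).minimalPrimes := by
    refine ⟨⟨hm.isPrime, hr ▸ Ideal.le_radical⟩, ?_⟩
    rintro q ⟨hq, hle⟩ -
    rw [hr]
    exact hq.radical_le_iff.2 hle
  have h1 := Ideal.height_le_card_of_mem_minimalPrimes_span (Set.finite_range G) hmin
  rw [ts_height] at h1
  have h2 : Set.ncard (Set.range G) ≤ Nat.card ι := by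
    rw [← Set.image_univ, ← Set.ncard_univ]
    exact Set.ncard_image_le Set.finite_univ
  have h4 : Nat.card σ ≤ Set.ncard (Set.range G) := by exact_mod_cast h1
  omega


theorem ts_eval_zero {R σ : Type*} [CommRing R] (P : MvPolynomial σ R) (d : ℕ) (hd : 0 < d)
    (hP : P.IsHomogeneous d) : eval 0 P = 0 := by
  rw [eval_zero, constantCoeff_eq]
  exact hP.coeff_eq_zero (by simpa using hd.ne)

theorem ts_natDegree {K σ : Type*} [Field K] [Fintype σ] (P : MvPolynomial σ (Polynomial K))
    (d c m : ℕ) (hP : P.IsHomogeneous d) (hc : ∀ α, (P.coeff α).natDegree ≤ c)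
    (x : σ → Polynomial K) (hx : ∀ s, (x s).natDegree ≤ m) :
    (eval x P).natDegree ≤ d * m + c := by
  rw [eval_eq]
  refine Polynomial.natDegree_sum_le_of_forall_le _ _ fun α hα => ?_
  refine Polynomial.natDegree_mul_le.trans ?_
  have h1 : α.degree = d := by
    by_contra h
    exact mem_support_iff.1 hα (hP.coeff_eq_zero h)
  have h2 : (∏ i ∈ α.support, x i ^ α i).natDegree ≤ d * m := by
    refine (Polynomial.natDegree_prod_le _ _).trans ?_
    rw [← h1, Finsupp.degree_apply, Finset.sum_mul]
    refine Finset.sum_le_sum fun i _ => ?_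
    exact Polynomial.natDegree_pow_le.trans (Nat.mul_le_mul_left _ (hx i))
  have := hc α
  omega

theorem ts_poly {K σ ι : Type*} [Field K] [IsAlgClosed K] [Fintype σ] [Fintype ι]
    (P : ι → MvPolynomial σ (Polynomial K)) (d : ℕ) (hd : 0 < d)
    (hP : ∀ i, (P i).IsHomogeneous d) (hcard : Fintype.card ι * d < Fintype.card σ) :
    ∃ x : σ → Polynomial K, x ≠ 0 ∧ ∀ i, eval x (P i) = 0 := by
  classical
  obtain ⟨c, hc⟩ : ∃ c : ℕ, ∀ i α, ((P i).coeff α).natDegree ≤ c := by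
    refine ⟨∑ i, ∑ α ∈ (P i).support, ((P i).coeff α).natDegree, fun i α => ?_⟩
    by_cases hα : α ∈ (P i).support
    · exact (Finset.single_le_sum (f := fun α => ((P i).coeff α).natDegree)
        (fun _ _ => Nat.zero_le _) hα).trans
        (Finset.single_le_sum (f := fun i => ∑ α ∈ (P i).support, ((P i).coeff α).natDegree)
        (fun _ _ => Nat.zero_le _) (Finset.mem_univ i))
    · rw [notMem_support_iff.1 hα]; simp
  set m := Fintype.card ι * (c + 1) with hm
  let φ : MvPolynomial σ (Polynomial K) →+* Polynomial (MvPolynomial (σ × Fin (m + 1)) K) :=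
    eval₂Hom (Polynomial.mapRingHom C)
      (fun s => ∑ j : Fin (m + 1), Polynomial.C (X (s, j)) * Polynomial.X ^ (j : ℕ))
  let xx : (σ × Fin (m + 1) → K) → σ → Polynomial K := fun y s =>
    ∑ j : Fin (m + 1), Polynomial.C (y (s, j)) * Polynomial.X ^ (j : ℕ)
  have key : ∀ y p, (φ p).map (eval y) = eval (xx y) p := by
    intro y p
    have : (Polynomial.mapRingHom (eval y)).comp φ = eval (xx y) := by
      apply MvPolynomial.ringHom_ext
      · intro r
        simp [φ]
        have : (eval y).comp C = RingHom.id K := by ext; simp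
        rw [this, Polynomial.map_id]
      · intro s
        simp [φ, xx]
    exact DFunLike.congr_fun this p
  let G : ι × Fin (d * m + c + 1) → MvPolynomial (σ × Fin (m + 1)) K := fun q =>
    (φ (P q.1)).coeff q.2
  have hG : ∀ y q, eval y (G q) = (eval (xx y) (P q.1)).coeff q.2 := by
    intro y q
    rw [← key, Polynomial.coeff_map]
  have hxx0 : xx 0 = 0 := by
    ext s; simp [xx]
  obtain ⟨y, hy0, hy⟩ := ts_proj G (fun q => by
      rw [hG, hxx0, ts_eval_zero _ d hd (hP _), Polynomial.coeff_zero]) (by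
      simp only [Nat.card_eq_fintype_card, Fintype.card_prod, Fintype.card_fin]
      nlinarith)
  have hcoef : ∀ s (j : Fin (m + 1)), (xx y s).coeff j = y (s, j) := by
    intro s j
    simp only [xx, Polynomial.finsetSum_coeff, Polynomial.coeff_C_mul_X_pow]
    rw [Finset.sum_eq_single j]
    · simp
    · intro b _ hb
      rw [if_neg]
      intro h; exact hb (Fin.ext h.symm)
    · simp
  refine ⟨xx y, ?_, fun i => ?_⟩
  · intro h
    apply hy0
    ext ⟨s, j⟩
    rw [← hcoef, h]; simp
  · have hdeg := ts_natDegree (P i) d c m (hP i) (hc i) (xx y) (fun s =>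
      Polynomial.natDegree_sum_le_of_forall_le _ _ fun j _ =>
        (Polynomial.natDegree_C_mul_X_pow_le _ _).trans (by omega))
    ext l
    rw [Polynomial.coeff_zero]
    by_cases hl : l < d * m + c + 1
    · rw [← hG y (i, ⟨l, hl⟩), hy]
    · exact Polynomial.coeff_eq_zero_of_natDegree_lt (by omega)

theorem tsen {K k σ ι : Type*} [Field K] [IsAlgClosed K] [Field k] [Algebra (Polynomial K) k]
    [IsFractionRing (Polynomial K) k] [Fintype σ] [Fintype ι]
    (F : ι → MvPolynomial σ k) (d : ℕ) (hd : 0 < d)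
    (hF : ∀ i, (F i).IsHomogeneous d) (hcard : Fintype.card ι * d < Fintype.card σ) :
    ∃ x : σ → k, x ≠ 0 ∧ ∀ i, eval x (F i) = 0 := by
  classical
  have hinj := IsFractionRing.injective (Polynomial K) k
  have h1 : ∀ i, ∃ b : Polynomial K, b ≠ 0 ∧ ∃ P : MvPolynomial σ (Polynomial K),
      MvPolynomial.map (algebraMap (Polynomial K) k) P = C (algebraMap _ k b) * F i := by
    intro i
    obtain ⟨b, hb⟩ := IsLocalization.exist_integer_multiples_of_finset
      (nonZeroDivisors (Polynomial K)) ((F i).support.image fun α => (F i).coeff α)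
    have hb' : ∀ α ∈ (F i).support, ∃ p : Polynomial K,
        algebraMap _ k p = algebraMap _ k (b : Polynomial K) * (F i).coeff α := by
      intro α hα
      obtain ⟨p, hp⟩ := hb _ (Finset.mem_image_of_mem _ hα)
      exact ⟨p, by rw [hp, Algebra.smul_def]⟩
    choose! p hp using hb'
    refine ⟨b, nonZeroDivisors.ne_zero b.2, ∑ α ∈ (F i).support, monomial α (p α), ?_⟩
    rw [map_sum]
    conv_rhs => rw [(F i).as_sum, Finset.mul_sum]
    refine Finset.sum_congr rfl fun α hα => ?_
    rw [map_monomial, hp α hα, C_mul_monomial]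
  choose b hb P hP using h1
  obtain ⟨x, hx0, hx⟩ := ts_poly P d hd (fun i => by
    intro α hα
    refine hF i (d := α) ?_
    intro h
    apply hα
    apply hinj
    rw [← coeff_map, hP, coeff_C_mul, h]; simp) hcard
  refine ⟨fun s => algebraMap _ k (x s), ?_, fun i => ?_⟩
  · intro h
    apply hx0
    ext1 s
    apply hinj
    simpa using congrFun h s
  · have : eval (fun s => algebraMap _ k (x s)) (C (algebraMap _ k (b i)) * F i) = 0 := by
      rw [← hP, eval_map]
      exact (eval₂_comp (algebraMap (Polynomial K) k) x (P i)).symm.trans (by rw [hx, map_zero])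
    rw [map_mul, eval_C] at this
    refine (mul_eq_zero.1 this).resolve_left ?_
    intro h
    exact hb i (hinj (by simpa using h))

end TsenTheorem


theorem dr_indep {D ι : Type*} [DivisionRing D] [Fintype ι] (B : Submonoid D) (u : ι → D)
    (hind : ∀ c : ι → D, (∀ i, ∀ b ∈ B, b * c i = c i * b) → ∑ i, c i * u i = 0 → ∀ i, c i = 0)
    (t : Finset ι) : ∀ (w : ι → D), (∀ i, i ∉ t → w i = 0) →
    (∀ b ∈ B, ∑ i, w i * b * u i = 0) → ∀ i, w i = 0 := by
  classical
  induction t using Finset.induction_on with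
  | empty => intro w h0 _ i; exact h0 i (by simp)
  | insert j t hj ih =>
    intro w h0 hw
    by_cases hwj : w j = 0
    · refine ih w (fun i hi => ?_) hw
      by_cases hij : i = j
      · rw [hij, hwj]
      · exact h0 i (by simp [hij, hi])
    exfalso
    set w' : ι → D := fun i => (w j)⁻¹ * w i with hw'
    have hw'j : w' j = 1 := inv_mul_cancel₀ hwj
    have hrel : ∀ b ∈ B, ∑ i, w' i * b * u i = 0 := by
      intro b hb
      have := congrArg (fun z => (w j)⁻¹ * z) (hw b hb)
      simpa [Finset.mul_sum, mul_assoc, hw'] using this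
    have hcomm : ∀ i, ∀ b ∈ B, b * w' i = w' i * b := by
      intro i b hb
      have := ih (fun i => b * w' i - w' i * b) (fun i hi => by
        by_cases hij : i = j
        · subst hij; simp [hw'j]
        · have : w i = 0 := h0 i (by simp [hij, hi])
          simp [hw', this]) (fun b' hb' => by
          have h1 := congrArg (fun z => b * z) (hrel b' hb')
          have h2 := hrel (b * b') (B.mul_mem hb hb')
          simp only [Finset.mul_sum, mul_zero] at h1
          rw [← sub_eq_zero.2 (h1.trans h2.symm), ← Finset.sum_sub_distrib]
          refine Finset.sum_congr rfl fun i _ => ?_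
          noncomm_ring) i
      exact sub_eq_zero.1 this
    have := hind w' hcomm (by simpa using hrel 1 B.one_mem) j
    rw [hw'j] at this
    exact one_ne_zero this

theorem dr_indep_center {D L Z ι κ : Type*} [DivisionRing D] [Field L] [Field Z] [Algebra Z D]
    [Algebra.IsCentral Z D] [Fintype ι] [Fintype κ] (i : L →+* D) [Module L D]
    (hL : ∀ (l : L) (x : D), l • x = i l * x) (v : Module.Basis κ L D) (x : ι → D)
    (hx : LinearIndependent Z x) :
    LinearIndependent L (fun j (r : κ) => v r * x j) := by
  rw [Fintype.linearIndependent_iff]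
  intro g hg
  have key := dr_indep (⊤ : Submonoid D) x (fun c hc hs => by
    have : ∀ j, ∃ z : Z, algebraMap Z D z = c j := by
      intro j
      have h1 : c j ∈ Subalgebra.center Z D := by
        rw [Subalgebra.mem_center_iff]
        intro b; exact hc j b trivial
      have h2 := Algebra.IsCentral.out h1
      exact Algebra.mem_bot.1 h2
    choose z hz using this
    have h3 := Fintype.linearIndependent_iff.1 hx z (by
      simpa [Algebra.smul_def, hz] using hs)
    intro j; rw [← hz, h3, map_zero]) Finset.univ (fun j => i (g j)) (by simp) (by
    intro b _
    have h4 : ∀ r, ∑ j, i (g j) * v r * x j = 0 := by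
      intro r
      have := congrFun hg r
      simpa [hL, mul_assoc] using this
    rw [← v.sum_repr b]
    simp only [hL, Finset.mul_sum, Finset.sum_mul]
    rw [Finset.sum_comm]
    refine Finset.sum_eq_zero fun r _ => ?_
    have := congrArg (fun z => i (v.repr b r) * z) (h4 r)
    simp only [mul_zero, Finset.mul_sum] at this
    rw [← this]
    refine Finset.sum_congr rfl fun j _ => ?_
    have : i (g j) * i (v.repr b r) = i (v.repr b r) * i (g j) := by
      rw [← map_mul, mul_comm, map_mul]
    rw [← mul_assoc, this]; noncomm_ring)
  intro j
  exact (map_eq_zero i).1 (key j)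

theorem dr_card_le {D L Z ι κ : Type*} [DivisionRing D] [Field L] [Field Z] [Algebra Z D]
    [Algebra.IsCentral Z D] [Fintype ι] [Fintype κ] (i : L →+* D) [Module L D]
    (hL : ∀ (l : L) (x : D), l • x = i l * x) (v : Module.Basis κ L D) (x : ι → D)
    (hx : LinearIndependent Z x) : Fintype.card ι ≤ Fintype.card κ * Fintype.card κ := by
  have : Module.Finite L D := Module.Finite.of_basis v
  have h := (dr_indep_center i hL v x hx).fintype_card_le_finrank
  rw [Module.finrank_pi_fintype] at h
  simpa [Module.finrank_eq_card_basis v] using h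

theorem dr_finite_center {D L Z κ : Type*} [DivisionRing D] [Field L] [Field Z] [Algebra Z D]
    [Algebra.IsCentral Z D] [Fintype κ] (i : L →+* D) [Module L D]
    (hL : ∀ (l : L) (x : D), l • x = i l * x) (v : Module.Basis κ L D) : Module.Finite Z D := by
  have : Module.rank Z D ≤ (Fintype.card κ * Fintype.card κ : ℕ) := by
    refine rank_le fun s hs => ?_
    have := dr_card_le (Z := Z) i hL v _ hs
    simpa using this
  exact Module.rank_lt_aleph0_iff.1 (this.trans_lt (Cardinal.natCast_lt_aleph0))

theorem dr_card_le' {D L Z κ : Type*} [DivisionRing D] [Field L] [Field Z] [Algebra Z D]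
    [Fintype κ] [Algebra Z L] [Module.Finite Z L] (i : L →ₐ[Z] D) [Module L D]
    (hL : ∀ (l : L) (x : D), l • x = i l * x) (v : Module.Basis κ L D)
    (hmax : ∀ c : D, (∀ l, i l * c = c * i l) → ∃ l, i l = c) :
    Fintype.card κ ≤ Module.finrank Z L := by
  let b := Module.finBasis Z L
  have hli : LinearIndependent D (fun r (j : Fin (Module.finrank Z L)) => i (b j) * v r) := by
    rw [Fintype.linearIndependent_iff]
    intro w hw
    refine dr_indep (MonoidHom.mrange (i : L →* D)) v (fun c hc hs => ?_) Finset.univ w (by simp) ?_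
    · have : ∀ r, ∃ l, i l = c r := fun r => hmax _ fun l => hc r _ ⟨l, rfl⟩
      choose l hl using this
      have := Fintype.linearIndependent_iff.1 v.linearIndependent l (by simpa [hL, hl] using hs)
      intro r; rw [← hl, this, map_zero]
    · rintro _ ⟨l, rfl⟩
      show ∑ r, w r * i l * v r = 0
      rw [← b.sum_repr l]
      simp only [map_sum, map_smul, Finset.mul_sum, Finset.sum_mul]
      rw [Finset.sum_comm]
      refine Finset.sum_eq_zero fun j _ => ?_
      have := congrFun hw j
      simp only [Finset.sum_apply, Pi.smul_apply, smul_eq_mul, Pi.zero_apply] at this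
      simp only [mul_smul_comm, smul_mul_assoc, ← Finset.smul_sum, mul_assoc, this, smul_zero]
  simpa using hli.fintype_card_le_finrank

theorem dr_dims {D L Z κ : Type*} [DivisionRing D] [Field L] [Field Z] [Algebra Z D]
    [Algebra.IsCentral Z D] [Module.Finite Z D]
    [Fintype κ] [Algebra Z L] [Module.Finite Z L] (i : L →ₐ[Z] D) [Module L D]
    (hL : ∀ (l : L) (x : D), l • x = i l * x) (v : Module.Basis κ L D)
    (hmax : ∀ c : D, (∀ l, i l * c = c * i l) → ∃ l, i l = c) :
    Module.finrank Z L = Fintype.card κ ∧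
      Module.finrank Z D = Fintype.card κ * Fintype.card κ := by
  have h1 := dr_card_le' i hL v hmax
  have h2 := dr_card_le (Z := Z) i.toRingHom hL v _ (Module.finBasis Z D).linearIndependent
  rw [Fintype.card_fin] at h2
  have : IsScalarTower Z L D := ⟨fun z l x => by
    rw [hL, hL, map_smul, smul_mul_assoc]⟩
  have h3 := Module.finrank_mul_finrank Z L D
  rw [Module.finrank_eq_card_basis v] at h3
  have h0 : 0 < Fintype.card κ := by
    rw [Fintype.card_pos_iff]; exact v.index_nonempty
  have h4 : Module.finrank Z L ≤ Fintype.card κ := by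
    rw [← h3] at h2
    exact Nat.le_of_mul_le_mul_right h2 h0
  have h5 := le_antisymm h4 h1
  exact ⟨h5, by rw [← h3, h5]⟩


/-- Right multiplication by `a`, as an `L`-linear endomorphism. -/
noncomputable def drR {D L : Type*} [DivisionRing D] [Field L] [Module L D]
    (h : ∀ (l : L) (x y : D), l • (x * y) = (l • x) * y) (a : D) : D →ₗ[L] D where
  toFun x := x * a
  map_add' x y := add_mul x y a
  map_smul' l x := (h l x a).symm

theorem dr_det_pow {D L Z κ : Type*} [DivisionRing D] [Field L] [Field Z] [Algebra Z D]
    [Algebra.IsCentral Z D] [Module.Finite Z D]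
    [Fintype κ] [Algebra Z L] [Module.Finite Z L] (i : L →ₐ[Z] D) [Module L D]
    (hL : ∀ (l : L) (x : D), l • x = i l * x) (v : Module.Basis κ L D)
    (hmax : ∀ c : D, (∀ l, i l * c = c * i l) → ∃ l, i l = c)
    (h : ∀ (l : L) (x y : D), l • (x * y) = (l • x) * y) (a : D) :
    LinearMap.det (drR h a) ^ Fintype.card κ =
      algebraMap Z L (LinearMap.det (LinearMap.mulRight Z a)) := by
  classical
  have hfin : Module.Finite L D := Module.Finite.of_basis v
  let x := Module.finBasis Z D
  have hli := dr_indep_center i.toRingHom hL v x x.linearIndependent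
  have hdim := (dr_dims i hL v hmax).2
  let X : Module.Basis (Fin (Module.finrank Z D)) L (κ → D) :=
    basisOfLinearIndependentOfCardEqFinrank' _ hli (by
      rw [Module.finrank_pi_fintype]
      simp [Module.finrank_eq_card_basis v, hdim])
  have hX : ∀ j r, X j r = v r * x j := by
    intro j r; simp [X]
  have hpi := LinearMap.det_pi (fun _ : κ => drR h a)
  rw [Finset.prod_const, Finset.card_univ] at hpi
  rw [← hpi, ← LinearMap.det_toMatrix X, ← LinearMap.det_toMatrix x, RingHom.map_det]
  congr 1
  have hx : ∀ j, x j * a = ∑ k, LinearMap.toMatrix x x (LinearMap.mulRight Z a) k j • x k := by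
    intro j
    have := x.sum_repr (LinearMap.mulRight Z a (x j))
    simp only [LinearMap.toMatrix_apply, LinearMap.mulRight_apply] at this ⊢
    exact this.symm
  have hcol : ∀ j, (LinearMap.pi fun r : κ => (drR h a).comp (LinearMap.proj r)) (X j) =
      ∑ k, algebraMap Z L (LinearMap.toMatrix x x (LinearMap.mulRight Z a) k j) • X k := by
    intro j
    ext r
    simp only [LinearMap.pi_apply, LinearMap.comp_apply, LinearMap.proj_apply, Finset.sum_apply,
      Pi.smul_apply, hX, hL]
    show v r * x j * a = _
    rw [mul_assoc, hx, Finset.mul_sum]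
    refine Finset.sum_congr rfl fun k _ => ?_
    rw [AlgHom.commutes, ← Algebra.smul_def, mul_smul_comm]
  ext k j
  rw [LinearMap.toMatrix_apply, hcol]
  simp [Finsupp.single_apply, Algebra.smul_def]

/-- The right module structure. -/
theorem dr_norm {D M Z : Type*} [DivisionRing D] [Field M] [Field Z] [Algebra Z D]
    [Module.Finite Z D] [Algebra Z M] [Module.Finite Z M] (i : M →ₐ[Z] D) (m : M) :
    ∃ n : ℕ, Module.finrank Z M * n = Module.finrank Z D ∧
      LinearMap.det (LinearMap.mulRight Z (i m)) = Algebra.norm Z m ^ n := by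
  let ρ : M →+* Module.End Z D :=
    { toFun := fun m => LinearMap.mulRight Z (i m)
      map_one' := by ext; simp
      map_mul' := fun p q => by
        ext x; simp only [LinearMap.mulRight_apply, Module.End.mul_apply]
        rw [mul_comm p q, map_mul, mul_assoc]
      map_zero' := by ext; simp
      map_add' := fun p q => by ext; simp [mul_add] }
  let _ : Module M D := Module.compHom D ρ
  have hs : ∀ (m : M) (x : D), m • x = x * i m := fun _ _ => rfl
  have hst : IsScalarTower Z M D := ⟨fun z p x => by
    rw [hs, hs, map_smul, mul_smul_comm]⟩
  have : Module.Finite M D := Module.Finite.of_restrictScalars_finite Z M D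
  refine ⟨Module.finrank M D, Module.finrank_mul_finrank Z M D, ?_⟩
  have h1 : LinearMap.mulRight Z (i m) = (m • (LinearMap.id : D →ₗ[M] D)).restrictScalars Z := by
    ext x; simp [hs]
  rw [h1, LinearMap.det_restrictScalars, LinearMap.det_smul, LinearMap.det_id, mul_one, map_pow]

universe u

theorem dr_exists_max {D : Type u} {Z : Type*} [DivisionRing D] [Field Z] [Algebra Z D]
    [Module.Finite Z D] (a : D) :
    ∃ (L : Type u) (_ : Field L) (_ : Algebra Z L) (_ : Module.Finite Z L) (i : L →ₐ[Z] D),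
      (∀ c : D, (∀ l, i l * c = c * i l) → ∃ l, i l = c) ∧ ∃ l, i l = a := by
  have hne : {S : Subalgebra Z D | a ∈ S ∧ ∀ x ∈ S, ∀ y ∈ S, x * y = y * x}.Nonempty := by
    refine ⟨Algebra.adjoin Z {a}, Algebra.subset_adjoin rfl, fun x hx y hy => ?_⟩
    have := Algebra.isMulCommutative_adjoin Z (s := {a}) (by
      rintro _ rfl _ rfl; rfl)
    exact congrArg Subtype.val (this.is_comm.comm ⟨x, hx⟩ ⟨y, hy⟩)
  have hwf : WellFoundedGT (Subalgebra Z D) := by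
    have h0 : WellFoundedGT (Submodule Z D) := inferInstance
    exact (StrictMono.wellFoundedGT (f := fun S : Subalgebra Z D => Subalgebra.toSubmodule S)
      fun S T h => by simpa using h)
  obtain ⟨S, ⟨haS, hS⟩, hSmax⟩ := hwf.wf.has_min _ hne
  have hmax : ∀ c : D, (∀ l ∈ S, l * c = c * l) → c ∈ S := by
    intro c hc
    by_contra hcS
    have hcom : ∀ x ∈ Algebra.adjoin Z (insert c (S : Set D)),
        ∀ y ∈ Algebra.adjoin Z (insert c (S : Set D)), x * y = y * x := by
      intro x hx y hy
      have := Algebra.isMulCommutative_adjoin Z (s := insert c (S : Set D)) (by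
        rintro p (rfl | hp) q (rfl | hq)
        · rfl
        · exact (hc q hq).symm
        · exact hc p hp
        · exact hS p hp q hq)
      exact congrArg Subtype.val (this.is_comm.comm ⟨x, hx⟩ ⟨y, hy⟩)
    refine hSmax (Algebra.adjoin Z (insert c (S : Set D)))
      ⟨Algebra.subset_adjoin (Set.mem_insert_of_mem _ haS), hcom⟩ ?_
    refine lt_of_le_of_ne (fun s hs => Algebra.subset_adjoin (Set.mem_insert_of_mem _ hs)) ?_
    intro h
    exact hcS (h ▸ Algebra.subset_adjoin (Set.mem_insert _ _))
  have hinv : ∀ x ∈ S, x⁻¹ ∈ S := by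
    intro x hx
    refine hmax _ fun l hl => ?_
    exact ((show Commute l x from hS l hl x hx).inv_right₀).eq
  have hF : IsField S :=
    { exists_pair_ne := ⟨0, 1, zero_ne_one⟩
      mul_comm := fun x y => Subtype.ext (hS x x.2 y y.2)
      mul_inv_cancel := fun {x} hx => ⟨⟨(x : D)⁻¹, hinv x x.2⟩, Subtype.ext
        (mul_inv_cancel₀ (fun h => hx (Subtype.ext h)))⟩ }
  refine ⟨S, hF.toField, S.algebra, ?_, S.val, ?_, ⟨a, haS⟩, rfl⟩
  · exact (inferInstance : Module.Finite Z S)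
  · intro c hc
    exact ⟨⟨c, hmax c fun l hl => hc ⟨l, hl⟩⟩, rfl⟩



theorem ac_mem_range {K A : Type*} [Field K] [IsAlgClosed K] [Ring A] [IsDomain A] [Algebra K A]
    (x : A) (hx : IsIntegral K x) : ∃ c : K, algebraMap K A c = x :=
  minpoly.mem_range_of_degree_eq_one K x
    (IsAlgClosed.degree_eq_one_of_irreducible K (minpoly.irreducible hx))

theorem ac_root {K Z L : Type*} [Field K] [IsAlgClosed K] [Field Z] [Field L] [Algebra Z L]
    (g : K →+* Z) (d : ℕ) (hd : 0 < d) (y : L) (c : Z) (h : y ^ d = algebraMap Z L c ^ d) :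
    ∃ z : Z, algebraMap Z L z = y := by
  by_cases hc : c = 0
  · refine ⟨0, ?_⟩
    rw [hc, map_zero, zero_pow hd.ne'] at h
    rw [map_zero, pow_eq_zero_iff hd.ne' |>.1 h]
  have hc' : algebraMap Z L c ≠ 0 := by simpa using hc
  let _ : Algebra K L := ((algebraMap Z L).comp g).toAlgebra
  have hIntegral : IsIntegral K (y / algebraMap Z L c) := by
    refine IsIntegral.of_pow hd ?_
    rw [div_pow, h, div_self (pow_ne_zero _ hc')]
    exact isIntegral_one
  obtain ⟨ζ, hζ⟩ := ac_mem_range _ hIntegral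
  refine ⟨g ζ * c, ?_⟩
  have : algebraMap Z L (g ζ) = y / algebraMap Z L c := hζ
  rw [map_mul, this, div_mul_cancel₀ _ hc']

theorem dr_det_mem {K D L Z κ : Type*} [Field K] [IsAlgClosed K] [DivisionRing D] [Field L]
    [Field Z] [Algebra Z D] (g : K →+* Z)
    [Algebra.IsCentral Z D] [Module.Finite Z D]
    [Fintype κ] [Algebra Z L] [Module.Finite Z L] (i : L →ₐ[Z] D) [Module L D]
    (hL : ∀ (l : L) (x : D), l • x = i l * x) (v : Module.Basis κ L D)
    (hmax : ∀ c : D, (∀ l, i l * c = c * i l) → ∃ l, i l = c)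
    (h : ∀ (l : L) (x y : D), l • (x * y) = (l • x) * y) (a : D) :
    ∃ z : Z, algebraMap Z L z = LinearMap.det (drR h a) := by
  have h0 : 0 < Fintype.card κ := by
    rw [Fintype.card_pos_iff]; exact v.index_nonempty
  have hdim := (dr_dims i hL v hmax).2
  have hpow := dr_det_pow i hL v hmax h a
  obtain ⟨M, _, _, _, i', hmax', m, rfl⟩ := dr_exists_max (Z := Z) a
  obtain ⟨n, hn, hdet⟩ := dr_norm i' m
  let _ : Module M D := Module.compHom D i'.toRingHom
  have hs : ∀ (m : M) (x : D), m • x = i' m * x := fun _ _ => rfl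
  have hst : IsScalarTower Z M D := ⟨fun z p x => by
    rw [hs, hs, map_smul, smul_mul_assoc]⟩
  have : Module.Finite M D := Module.Finite.of_restrictScalars_finite Z M D
  have hdim' := dr_dims i' hs (Module.finBasis M D) hmax'
  rw [Fintype.card_fin] at hdim'
  have e1 : Module.finrank M D = Fintype.card κ :=
    Nat.mul_self_inj.1 (hdim'.2.symm.trans hdim)
  have e2 : n = Fintype.card κ := by
    rw [hdim'.1, e1, hdim] at hn
    exact Nat.eq_of_mul_eq_mul_left h0 hn
  rw [hdet, e2, map_pow] at hpow
  exact ac_root g _ h0 _ _ hpow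

open MvPolynomial in
theorem dr_tsen {K k Z D : Type*} [Field K] [IsAlgClosed K] [Field k] [Algebra (Polynomial K) k]
    [IsFractionRing (Polynomial K) k] [Field Z] [Algebra k Z] [Module.Finite k Z]
    [DivisionRing D] [Algebra Z D] [Algebra.IsCentral Z D] [Module.Finite Z D] (x y : D) :
    x * y = y * x := by
  classical
  obtain ⟨L, _, _, _, i, hmax, -⟩ := dr_exists_max (Z := Z) (1 : D)
  let _ : Module L D := Module.compHom D i.toRingHom
  have hL : ∀ (m : L) (x : D), m • x = i m * x := fun _ _ => rfl
  have hst : IsScalarTower Z L D := ⟨fun z p x => by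
    rw [hL, hL, map_smul, smul_mul_assoc]⟩
  have h : ∀ (l : L) (x y : D), l • (x * y) = (l • x) * y := fun l x y => by
    rw [hL, hL, mul_assoc]
  have : Module.Finite L D := Module.Finite.of_restrictScalars_finite Z L D
  let v := Module.finBasis L D
  obtain ⟨-, hdim⟩ := dr_dims i hL v hmax
  rw [Fintype.card_fin] at hdim
  set d := Module.finrank L D with hd
  have hd0 : 0 < d := Module.finrank_pos
  let g : K →+* Z := (algebraMap k Z).comp ((algebraMap (Polynomial K) k).comp Polynomial.C)
  have hmem := dr_det_mem g i hL v hmax h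
  let β := Module.finBasis k Z
  let e := Module.finBasis Z D
  obtain ⟨π, hπ⟩ := (Algebra.linearMap Z L).exists_leftInverse_of_injective
    (LinearMap.ker_eq_bot.2 (algebraMap Z L).injective)
  have hπ' : ∀ z, π (algebraMap Z L z) = z := fun z => LinearMap.congr_fun hπ z
  -- the norm form
  let E : Fin (Module.finrank k Z) × Fin (Module.finrank Z D) → Matrix (Fin d) (Fin d) L :=
    fun q => LinearMap.toMatrix v v (drR h (β q.1 • e q.2))
  let τ := Fin (Module.finrank k Z) × Fin (Module.finrank Z D)
  let F : MvPolynomial τ L := Matrix.det (Matrix.of fun r s => ∑ q, C (E q r s) * X q)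
  have hF : F.IsHomogeneous d := by
    simp only [F]
    rw [Matrix.det_apply]
    refine IsHomogeneous.sum _ _ _ fun σ _ => ?_
    have h1 : (∏ r, (Matrix.of fun r s => ∑ q : τ, C (E q r s) * X q) (σ r) r).IsHomogeneous
        (∑ _r : Fin d, 1) := by
      refine IsHomogeneous.prod _ _ _ fun r _ => ?_
      refine IsHomogeneous.sum _ _ _ fun q _ => ?_
      simpa using (isHomogeneous_C τ (E q (σ r) r)).mul (isHomogeneous_X L q)
    rw [Finset.sum_const, Finset.card_univ, Fintype.card_fin, smul_eq_mul, mul_one] at h1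
    rcases Int.units_eq_one_or (Equiv.Perm.sign σ) with hσ | hσ
    · rw [hσ, one_smul]; exact h1
    · rw [hσ, Units.neg_smul, one_smul]; exact h1.neg
  let j : k →+* L := (algebraMap Z L).comp (algebraMap k Z)
  let A : (τ → k) → D := fun y => ∑ q, (algebraMap k Z (y q) * β q.1) • e q.2
  have hA : ∀ y, eval (fun q => j (y q)) F = LinearMap.det (drR h (A y)) := by
    intro y
    rw [← LinearMap.det_toMatrix v]
    simp only [F]
    rw [RingHom.map_det]
    congr 1
    ext r s
    have hsum : drR h (A y) = ∑ q, j (y q) • drR h (β q.1 • e q.2) := by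
      ext x
      simp only [LinearMap.sum_apply, LinearMap.smul_apply]
      show x * A y = ∑ q, j (y q) • (x * (β q.1 • e q.2))
      simp only [A, Finset.mul_sum]
      refine Finset.sum_congr rfl fun q _ => ?_
      simp only [j, RingHom.comp_apply, algebraMap_smul, mul_smul, mul_smul_comm]
    rw [hsum, map_sum]
    simp [Matrix.sum_apply, E, mul_comm]
    rfl
  let G : Fin (Module.finrank k Z) → MvPolynomial τ k := fun t =>
    ∑ α ∈ F.support, monomial α (β.repr (π (F.coeff α)) t)
  have hG : ∀ t, (G t).IsHomogeneous d := by
    intro t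
    refine IsHomogeneous.sum _ _ _ fun α hα => ?_
    refine isHomogeneous_monomial _ ?_
    by_contra hne
    exact mem_support_iff.1 hα (hF.coeff_eq_zero hne)
  have hGe : ∀ t y, eval y (G t) = β.repr (π (eval (fun q => j (y q)) F)) t := by
    intro t y
    simp only [G, map_sum, eval_monomial]
    rw [eval_eq (fun q => j (y q)) F, map_sum, map_sum, Finsupp.finsetSum_apply]
    refine Finset.sum_congr rfl fun α _ => ?_
    have h1 : F.coeff α * ∏ q ∈ α.support, j (y q) ^ α q =
        algebraMap k Z (α.prod fun q n => y q ^ n) • F.coeff α := by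
      rw [Algebra.smul_def, mul_comm]
      congr 1
      simp [Finsupp.prod, j]
    rw [h1, map_smul, algebraMap_smul, map_smul, Finsupp.smul_apply, smul_eq_mul, mul_comm]
  by_cases hd1 : d = 1
  · rw [hd1] at hdim
    obtain ⟨c, rfl⟩ := (finrank_eq_one_iff_of_nonzero' (1 : D) one_ne_zero).1 hdim x
    simp
  exfalso
  obtain ⟨y, hy0, hy⟩ := tsen (K := K) G d hd0 hG (by
    simp only [τ, Fintype.card_prod, Fintype.card_fin, hdim]
    have : 0 < Module.finrank k Z := Module.finrank_pos
    have : 1 < d := by omega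
    rw [← mul_assoc]
    exact lt_mul_of_one_lt_right (by positivity) this)
  obtain ⟨z, hz⟩ := hmem (A y)
  have hz0 : z = 0 := by
    rw [← β.repr.map_eq_zero_iff]
    ext t
    have := hy t
    rw [hGe, hA, ← hz, hπ'] at this
    simpa using this
  rw [hz0, map_zero] at hz
  have hAy : A y = 0 := by
    by_contra hne
    have := LinearMap.bot_lt_ker_of_det_eq_zero hz.symm
    apply this.ne'
    rw [LinearMap.ker_eq_bot]
    intro p q hpq
    exact mul_right_cancel₀ hne hpq
  apply hy0
  have h2 : ∑ s, (∑ t, y (t, s) • β t) • e s = 0 := by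
    rw [← hAy]
    simp only [A]
    rw [Fintype.sum_prod_type, Finset.sum_comm]
    simp [Finset.sum_mul, Algebra.smul_def]
  ext ⟨t, s⟩
  have h3 := Fintype.linearIndependent_iff.1 e.linearIndependent _ h2 s
  exact Fintype.linearIndependent_iff.1 β.linearIndependent (fun t => y (t, s)) h3 t

theorem gr_pow_mono {K D : Type*} [Field K] [Ring D] [Algebra K D]
    (V : Submodule K D) (h1 : (1 : D) ∈ V) (n : ℕ) : V ^ n ≤ V ^ (n + 1) := by
  intro a ha
  rw [pow_succ]
  simpa using Submodule.mul_mem_mul ha h1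

theorem gr_fd {K D : Type*} [Field K] [Ring D] [Algebra K D]
    (V : Submodule K D) [hV : FiniteDimensional K V] (n : ℕ) : FiniteDimensional K ↥(V ^ n) :=
  Module.Finite.iff_fg.2 (Submodule.FG.pow (Module.Finite.iff_fg.1 hV) n)

theorem gr_span_fd {K k D : Type*} [Field K] [Field k] [Algebra K k] [Ring D] [Algebra K D]
    [Module k D] [IsScalarTower K k D]
    (V : Submodule K D) [hV : FiniteDimensional K V] (n : ℕ) :
    FiniteDimensional k ↥(Submodule.span k ((V ^ n : Submodule K D) : Set D)) := by
  obtain ⟨T, hT⟩ := Submodule.FG.pow (Module.Finite.iff_fg.1 hV) n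
  rw [← hT, Submodule.span_span_of_tower]
  exact FiniteDimensional.span_finset k T

theorem gr_dim {K k D : Type*} [Field K] [Field k] [Algebra K k] [DivisionRing D] [Algebra K D]
    [Module k D] [IsScalarTower K k D] [IsScalarTower k D D]
    (t : k) (ht : LinearIndependent K (fun i : ℕ => t ^ i))
    (V : Submodule K D) [hV : FiniteDimensional K V] (h1 : (1 : D) ∈ V) (hx : t • (1 : D) ∈ V)
    (n : ℕ) :
    (n + 1) * Module.finrank k ↥(Submodule.span k ((V ^ n : Submodule K D) : Set D)) ≤
      Module.finrank K ↥(V ^ (2 * n)) := by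
  have := gr_span_fd (k := k) V n
  have := gr_fd V (2 * n)
  obtain ⟨T, hT, hc, -, hli⟩ := Submodule.exists_finset_span_eq_linearIndepOn k
    ((V ^ n : Submodule K D) : Set D)
  have hb : LinearIndependent K (fun i : Fin (n + 1) => t ^ (i : ℕ)) :=
    ht.comp _ Fin.val_injective
  have h := linearIndependent_smul hb hli
  have hpow : ∀ i : ℕ, t ^ i • (1 : D) = (t • (1 : D)) ^ i := by
    intro i
    induction i with
    | zero => simp
    | succ i ih =>
      rw [pow_succ', pow_succ', mul_smul, ih, smul_mul_assoc, one_mul]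
  have hmono : Monotone (fun i => V ^ i) := monotone_nat_of_le_succ (gr_pow_mono V h1)
  have hmem : ∀ p : Fin (n + 1) × (T : Set D), t ^ (p.1 : ℕ) • id (p.2 : D) ∈ V ^ (2 * n) := by
    rintro ⟨i, b⟩
    have e : t ^ (i : ℕ) • (b : D) = (t • (1 : D)) ^ (i : ℕ) * b := by
      rw [← hpow, smul_mul_assoc, one_mul]
    simp only [id, e]
    rw [two_mul, pow_add]
    refine Submodule.mul_mem_mul (hmono (Nat.lt_succ_iff.1 i.2) ?_) (hT b.2)
    exact Submodule.pow_mem_pow V hx _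
  have h' : LinearIndependent K (fun p : Fin (n + 1) × (T : Set D) =>
      (⟨t ^ (p.1 : ℕ) • id (p.2 : D), hmem p⟩ : ↥(V ^ (2 * n)))) := by
    refine LinearIndependent.of_comp (V ^ (2 * n)).subtype ?_
    exact h
  have := h'.fintype_card_le_finrank
  simpa [hc] using this

theorem gr_stab {K k D : Type*} [Field K] [Field k] [Algebra K k] [DivisionRing D] [Algebra K D]
    [Module k D] [IsScalarTower K k D] [IsScalarTower k D D]
    (t : k) (ht : LinearIndependent K (fun i : ℕ => t ^ i))
    (V : Submodule K D) [hV : FiniteDimensional K V] (h1 : (1 : D) ∈ V) (hx : t • (1 : D) ∈ V)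
    (hgk : gkWrt K V ≤ 1) :
    ∃ n, Submodule.span k ((V ^ (n + 1) : Submodule K D) : Set D) =
      Submodule.span k ((V ^ n : Submodule K D) : Set D) := by
  by_contra! hne
  have hfd := fun n => gr_span_fd (k := k) V n
  have hle : ∀ n, Submodule.span k ((V ^ n : Submodule K D) : Set D) ≤
      Submodule.span k ((V ^ (n + 1) : Submodule K D) : Set D) :=
    fun n => Submodule.span_mono (gr_pow_mono V h1 n)
  have hr : ∀ n, n + 1 ≤ Module.finrank k ↥(Submodule.span k ((V ^ n : Submodule K D) : Set D)) := by
    intro n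
    induction n with
    | zero =>
      have : Nontrivial ↥(Submodule.span k ((V ^ 0 : Submodule K D) : Set D)) := by
        refine ⟨⟨⟨1, Submodule.subset_span ?_⟩, 0, ?_⟩⟩
        · simp only [pow_zero, SetLike.mem_coe]
          exact Submodule.one_le.1 le_rfl
        · intro h
          exact one_ne_zero (congrArg Subtype.val h)
      exact Module.finrank_pos
    | succ n ih =>
      have := Submodule.finrank_lt_finrank_of_lt (lt_of_le_of_ne (hle n) (hne n).symm)
      omega
  have hbig : ∀ n : ℕ, (n + 1) * (n + 1) ≤ Module.finrank K ↥(V ^ (2 * n)) := fun n =>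
    (Nat.mul_le_mul_left _ (hr n)).trans (gr_dim t ht V h1 hx n)
  have h32 : ((3 / 2 : ℝ) : EReal) ≤ gkWrt K V := by
    refine Filter.le_limsup_of_frequently_le' ?_
    rw [Filter.frequently_atTop]
    intro a
    refine ⟨2 * (a + 8), by omega, ?_⟩
    rw [EReal.coe_le_coe_iff]
    set n := a + 8 with hn
    have hn8 : (8 : ℝ) ≤ n := by exact_mod_cast (by omega : 8 ≤ n)
    have hlog : 0 < Real.log ((2 * n : ℕ) : ℝ) := by
      apply Real.log_pos
      push_cast
      linarith
    rw [le_div_iff₀ hlog]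
    have hN : ((n : ℝ)) ^ 2 ≤ (Module.finrank K ↥(V ^ (2 * n)) : ℝ) := by
      have : (((n + 1) * (n + 1) : ℕ) : ℝ) ≤ (Module.finrank K ↥(V ^ (2 * n)) : ℝ) := by
        exact_mod_cast hbig n
      push_cast at this
      nlinarith
    have h2 : Real.log ((n : ℝ) ^ 2) ≤ Real.log (Module.finrank K ↥(V ^ (2 * n)) : ℝ) :=
      Real.log_le_log (by positivity) hN
    have h3 : Real.log ((2 * n : ℕ) : ℝ) = Real.log 2 + Real.log n := by
      push_cast
      rw [Real.log_mul] <;> linarith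
    have h4 : 3 * Real.log 2 ≤ Real.log n := by
      have := Real.log_le_log (by norm_num) hn8
      have h8 : Real.log 8 = 3 * Real.log 2 := by
        rw [show (8 : ℝ) = 2 ^ 3 by norm_num, Real.log_pow]
        norm_num
      linarith
    rw [Real.log_pow] at h2
    push_cast at h2
    rw [h3]
    linarith
  have h := h32.trans hgk
  have : ((3 / 2 : ℝ) : EReal) ≤ ((1 : ℝ) : EReal) := by simpa using h
  rw [EReal.coe_le_coe_iff] at this
  norm_num at this

theorem gr_fin {K k D : Type*} [Field K] [Field k] [Algebra K k] [DivisionRing D] [Algebra K D]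
    [Module k D] [IsScalarTower K k D] [IsScalarTower k D D]
    (t : k) (ht : LinearIndependent K (fun i : ℕ => t ^ i))
    (hGK : gkDim K D = 1)
    (hfg : ∃ S : Finset D, ∀ E : Subring D,
      (∀ c : K, algebraMap K D c ∈ E) → (∀ x ∈ E, x⁻¹ ∈ E) → (S : Set D) ⊆ E → E = ⊤) :
    Module.Finite k D := by
  classical
  obtain ⟨S, hS⟩ := hfg
  set V : Submodule K D := Submodule.span K ((insert 1 (insert (t • (1 : D)) S) : Finset D) : Set D)
    with hVdef
  have hV : FiniteDimensional K V := FiniteDimensional.span_finset K _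
  have h1 : (1 : D) ∈ V := Submodule.subset_span (by simp)
  have hx : t • (1 : D) ∈ V := Submodule.subset_span (by simp)
  have hSV : ∀ s ∈ S, s ∈ V := fun s hs => Submodule.subset_span (by simp [hs])
  have hgk : gkWrt K V ≤ 1 := by
    rw [← hGK]
    exact le_sSup ⟨V, hV, h1, rfl⟩
  obtain ⟨n, hn⟩ := gr_stab t ht V h1 hx hgk
  have hfd := gr_span_fd (k := k) V n
  set W := Submodule.span k ((V ^ n : Submodule K D) : Set D) with hW
  have hWV : ∀ v ∈ V, ∀ w ∈ W, w * v ∈ W := by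
    intro v hv w hw
    rw [hW] at hw
    induction hw using Submodule.span_induction with
    | mem a ha =>
      rw [← hn]
      refine Submodule.subset_span ?_
      rw [pow_succ]
      exact Submodule.mul_mem_mul ha hv
    | zero => simp
    | add a b _ _ iha ihb => rw [add_mul]; exact W.add_mem iha ihb
    | smul c a _ iha => rw [smul_mul_assoc]; exact W.smul_mem c iha
  let E : Subring D :=
    { carrier := {d | ∀ w ∈ W, w * d ∈ W}
      mul_mem' := by
        intro a b ha hb w hw
        rw [← mul_assoc]
        exact hb _ (ha _ hw)
      one_mem' := by
        intro w hw
        simpa using hw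
      add_mem' := by
        intro a b ha hb w hw
        rw [mul_add]
        exact W.add_mem (ha _ hw) (hb _ hw)
      zero_mem' := by
        intro w hw
        simp
      neg_mem' := by
        intro a ha w hw
        rw [mul_neg]
        exact W.neg_mem (ha _ hw) }
  have hE : E = ⊤ := by
    refine hS E ?_ ?_ ?_
    · intro c w hw
      have : w * algebraMap K D c = (algebraMap K k c) • w := by
        rw [← Algebra.commutes, ← Algebra.smul_def, algebraMap_smul]
      rw [this]
      exact W.smul_mem _ hw
    · intro d hd w hw
      by_cases h0 : d = 0
      · simp [h0]
      let R : W →ₗ[k] W :=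
        { toFun := fun w => ⟨w.1 * d, hd _ w.2⟩
          map_add' := fun a b => Subtype.ext (add_mul _ _ _)
          map_smul' := fun c a => Subtype.ext (smul_mul_assoc _ _ _) }
      have hinj : Function.Injective R := by
        intro a b hab
        have := congrArg Subtype.val hab
        exact Subtype.ext (mul_right_cancel₀ h0 this)
      obtain ⟨u, hu⟩ := LinearMap.injective_iff_surjective.1 hinj ⟨w, hw⟩
      have hu' : u.1 * d = w := congrArg Subtype.val hu
      rw [← hu', mul_inv_cancel_right₀ h0]
      exact u.2
    · intro s hs w hw
      exact hWV s (hSV s hs) w hw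
  have h1W : (1 : D) ∈ W := by
    refine Submodule.subset_span ?_
    have := Submodule.pow_mem_pow V h1 n
    simpa using this
  have hWtop : W = ⊤ := by
    refine Submodule.eq_top_iff'.2 fun d => ?_
    have hd : d ∈ E := by rw [hE]; trivial
    simpa using hd 1 h1W
  rw [hWtop] at hfd
  exact Module.Finite.equiv (Submodule.topEquiv (R := k) (M := D))

theorem gr_hom {K D : Type*} [Field K] [DivisionRing D] [Algebra K D] (x : D)
    (hx : ¬ IsIntegral K x) : ∃ j : FractionRing (Polynomial K) →+* D,
      ∀ p : Polynomial K, j (algebraMap _ _ p) = Polynomial.aeval x p := by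
  have hne : ∀ p : Polynomial K, p ≠ 0 → Polynomial.aeval x p ≠ 0 := by
    intro p hp h
    exact hx (IsAlgebraic.isIntegral ⟨p, hp, h⟩)
  let fS : nonZeroDivisors (Polynomial K) →* Dˣ :=
    { toFun := fun s => Units.mk0 (Polynomial.aeval x (s : Polynomial K))
        (hne _ (nonZeroDivisors.coe_ne_zero s))
      map_one' := by ext; simp
      map_mul' := fun a b => by ext; simp }
  refine ⟨OreLocalization.universalHom (Polynomial.aeval x : Polynomial K →ₐ[K] D).toRingHom fS
    (fun s => rfl), fun p => ?_⟩
  exact OreLocalization.universalHom_commutes _ _ _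

theorem gr_finite {K D : Type*} [Field K] [DivisionRing D] [Algebra K D]
    (hGK : gkDim K D = 1)
    (hfg : ∃ S : Finset D, ∀ E : Subring D,
      (∀ c : K, algebraMap K D c ∈ E) → (∀ x ∈ E, x⁻¹ ∈ E) → (S : Set D) ⊆ E → E = ⊤)
    (j : FractionRing (Polynomial K) →+* D)
    (hj : ∀ c : K, j (algebraMap K _ c) = algebraMap K D c)
    [Module (FractionRing (Polynomial K)) D] (hL : ∀ l (y : D), l • y = j l * y) :
    Module.Finite (FractionRing (Polynomial K)) D := by
  have : IsScalarTower K (FractionRing (Polynomial K)) D :=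
    ⟨fun c l y => by rw [hL, hL, Algebra.smul_def, map_mul, hj, mul_assoc, Algebra.smul_def]⟩
  have : IsScalarTower (FractionRing (Polynomial K)) D D :=
    ⟨fun c l y => by simp only [hL, smul_eq_mul, mul_assoc]⟩
  refine gr_fin (K := K) (algebraMap (Polynomial K) _ Polynomial.X) ?_ hGK hfg
  have h := (Polynomial.basisMonomials K).linearIndependent
  have h2 := h.map' (Algebra.linearMap (Polynomial K) (FractionRing (Polynomial K)) |>.restrictScalars K)
    (LinearMap.ker_eq_bot.2 (IsFractionRing.injective _ _))
  refine (linearIndependent_equiv' (Equiv.refl ℕ) ?_).1 h2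
  funext i
  simp [← map_pow, Polynomial.X_pow_eq_monomial]

theorem gr_main {K D Z : Type*} [Field K] [IsAlgClosed K] [DivisionRing D] [Algebra K D]
    [Field Z] [Algebra Z D] [Algebra.IsCentral Z D] [Algebra K Z] [IsScalarTower K Z D]
    (hGK : gkDim K D = 1)
    (hfg : ∃ S : Finset D, ∀ E : Subring D,
      (∀ c : K, algebraMap K D c ∈ E) → (∀ x ∈ E, x⁻¹ ∈ E) → (S : Set D) ⊆ E → E = ⊤) :
    ∀ x y : D, x * y = y * x := by
  have key : (∀ x : D, IsIntegral K x) → ∀ x y : D, x * y = y * x := by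
    intro hall x y
    obtain ⟨c, rfl⟩ := ac_mem_range x (hall x)
    exact Algebra.commutes c y
  by_cases hall : ∀ x : D, IsIntegral K x
  · exact key hall
  push Not at hall
  obtain ⟨x, hx⟩ := hall
  have hZD : Module.Finite Z D := by
    obtain ⟨j, hj⟩ := gr_hom x hx
    letI : Module (FractionRing (Polynomial K)) D := Module.compHom D j
    have hL : ∀ l (y : D), l • y = j l * y := fun _ _ => rfl
    have hjC : ∀ c : K, j (algebraMap K _ c) = algebraMap K D c := by
      intro c
      have := hj (Polynomial.C c)
      rw [Polynomial.aeval_C] at this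
      rw [← this, IsScalarTower.algebraMap_apply K (Polynomial K) (FractionRing (Polynomial K))]
      rfl
    have := gr_finite hGK hfg j hjC hL
    exact dr_finite_center j hL (Module.finBasis (FractionRing (Polynomial K)) D)
  by_cases hz : ∀ z : Z, IsIntegral K z
  · refine key fun d => ?_
    have : Module.Finite K Z := by
      refine Module.Finite.of_surjective (Algebra.linearMap K Z) fun z => ?_
      obtain ⟨c, hc⟩ := ac_mem_range z (hz z)
      exact ⟨c, hc⟩
    have : Module.Finite K D := Module.Finite.trans Z D
    exact IsIntegral.of_finite K d
  push Not at hz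
  obtain ⟨z, hz⟩ := hz
  obtain ⟨j, hj⟩ := gr_hom z hz
  have hjC : ∀ c : K, j (algebraMap K _ c) = algebraMap K Z c := by
    intro c
    have := hj (Polynomial.C c)
    rw [Polynomial.aeval_C] at this
    rw [← this, IsScalarTower.algebraMap_apply K (Polynomial K) (FractionRing (Polynomial K))]
    rfl
  letI : Algebra (FractionRing (Polynomial K)) Z := j.toAlgebra
  letI : Module (FractionRing (Polynomial K)) D := Module.compHom D ((algebraMap Z D).comp j)
  have hL : ∀ l (y : D), l • y = ((algebraMap Z D).comp j) l * y := fun _ _ => rfl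
  have hfin := gr_finite hGK hfg ((algebraMap Z D).comp j)
    (fun c => by rw [RingHom.comp_apply, hjC, ← IsScalarTower.algebraMap_apply]) hL
  have : Module.Finite (FractionRing (Polynomial K)) Z := by
    let φ : Z →ₗ[FractionRing (Polynomial K)] D :=
      { toFun := algebraMap Z D
        map_add' := map_add _
        map_smul' := fun c a => by
          rw [hL, Algebra.smul_def, map_mul]
          rfl }
    exact Module.Finite.of_injective φ (algebraMap Z D).injective
  exact fun x y => dr_tsen (K := K) (k := FractionRing (Polynomial K)) (Z := Z) x y

/-- A step in the proof of Theorem 3: a division algebra of GK dimension `1` over an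
algebraically closed field `K` that is finitely generated as a division algebra is
commutative. -/
theorem stmt12 {K D₀ : Type*} [Field K] [IsAlgClosed K] [DivisionRing D₀] [Algebra K D₀]
    (hGK : gkDim K D₀ = 1)
    -- `D₀` is finitely generated as a division algebra: some finite set generates it
    (hfg : ∃ S : Finset D₀, ∀ E : Subring D₀,
      (∀ c : K, algebraMap K D₀ c ∈ E) → (∀ x ∈ E, x⁻¹ ∈ E) → (S : Set D₀) ⊆ E → E = ⊤) :
    ∀ x y : D₀, x * y = y * x := by
  letI : Algebra (Subring.center D₀) D₀ :=
    RingHom.toAlgebra' (Subring.center D₀).subtype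
      (fun c x => (Subring.mem_center_iff.1 c.2 x).symm)
  have : Algebra.IsCentral (Subring.center D₀) D₀ :=
    ⟨fun d hd => by
      rw [Subalgebra.mem_center_iff] at hd
      exact Algebra.mem_bot.2 ⟨⟨d, Subring.mem_center_iff.2 hd⟩, rfl⟩⟩
  letI : Algebra K (Subring.center D₀) :=
    ((algebraMap K D₀).codRestrict (Subring.center D₀)
      (fun c => Subring.mem_center_iff.2 fun x => (Algebra.commutes c x).symm)).toAlgebra
  have : IsScalarTower K (Subring.center D₀) D₀ := IsScalarTower.of_algebraMap_eq fun c => rfl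
  exact gr_main (Z := Subring.center D₀) hGK hfg
end
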